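/- arXiv:2005.08574 — 8 statements merged into one kernel-verified Lean document; each statement's English description precedes it below -/
import Mathlib

section
/- For all positive integers r and n, the r-Shi arrangement S_n^r has exactly (rn+1)^{n−1} regions; that is, the complement in ℝⁿ of the union of the hyperplanes x_i − x_j = s (for 1 ≤ i < j ≤ n and s ∈ {−r+1, −r+2, …, r}) has exactly (rn+1)^{n−1} connected components. -/
/-- The complement of the `r`-Shi arrangement in `ℝⁿ`: the set of points avoiding all
hyperplanes `x i - x j = s` for `i < j` and `s ∈ {-r+1, …, r}`. -/
def shiArrangementCompl (r n : ℕ) : Set (Fin n → ℝ) :=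
  {x | ∀ i j : Fin n, i < j → ∀ s : ℤ, -(r : ℤ) + 1 ≤ s → s ≤ r → x i - x j ≠ (s : ℝ)}

open Topology

theorem shiaux_gen {E D : Type*} [TopologicalSpace E] (U : Set E) (φ : E → D)
    (hloc : ∀ x ∈ U, ∀ᶠ y in 𝓝 x, φ y = φ x)
    (hconn : ∀ v, IsPreconnected {x | x ∈ U ∧ φ x = v}) :
    Nat.card (ConnectedComponents U) = (φ '' U).ncard := by
  have hlc : IsLocallyConstant (fun x : U => φ x) := by
    rw [IsLocallyConstant.iff_eventually_eq]
    intro x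
    exact (continuous_subtype_val.tendsto x).eventually (hloc x x.2)
  rw [← Nat.card_coe_set_eq]
  let f : U → (φ '' U) := fun x => ⟨φ x, x, x.2, rfl⟩
  have hf : ∀ x y : U, (connectedComponentSetoid U) x y → f x = f y := by
    intro x y h
    have h' : connectedComponent x = connectedComponent y := h
    apply Subtype.ext
    exact hlc.apply_eq_of_isPreconnected isPreconnected_connectedComponent
      (mem_connectedComponent) (h' ▸ mem_connectedComponent)
  refine Nat.card_congr (Equiv.ofBijective (Quotient.lift f hf) ⟨?_, ?_⟩)
  · intro a b
    refine Quotient.inductionOn₂ a b ?_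
    intro x y h
    have h1 : φ x = φ y := congrArg Subtype.val h
    apply Quotient.sound
    change connectedComponent x = connectedComponent y
    have hp : IsPreconnected {z : U | φ z = φ y} := by
      rw [← Topology.IsInducing.subtypeVal.isPreconnected_image]
      convert hconn (φ y) using 1
      ext z; simp [and_comm]
    symm
    apply connectedComponent_eq
    exact hp.subset_connectedComponent rfl h1
  · rintro ⟨_, x, hx, rfl⟩
    exact ⟨Quotient.mk _ ⟨x, hx⟩, rfl⟩

theorem shiaux_congr {X Y : Type*} [TopologicalSpace X] [TopologicalSpace Y] (f : X → Y) (g : Y → X)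
    (hf : Continuous f) (hg : Continuous g) (hfg : ∀ y, f (g y) = y)
    (hgf : ∀ x, connectedComponent (g (f x)) = connectedComponent x) :
    Nat.card (ConnectedComponents X) = Nat.card (ConnectedComponents Y) := by
  refine Nat.card_congr ⟨hf.connectedComponentsMap, hg.connectedComponentsMap, ?_, ?_⟩
  · intro a
    refine Quotient.inductionOn a ?_
    intro x
    exact Quotient.sound (hgf x)
  · intro a
    refine Quotient.inductionOn a ?_
    intro x
    change ((f (g x) : Y) : ConnectedComponents Y) = _
    rw [hfg]; rfl

theorem shiaux_image {X Y : Type*} [TopologicalSpace X] [TopologicalSpace Y] (U : Set X) (V : Set Y)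
    (f : X → Y) (g : Y → X)
    (hf : Continuous f) (hg : Continuous g) (hU : ∀ x ∈ U, f x ∈ V) (hV : ∀ y ∈ V, g y ∈ U)
    (hfg : ∀ y ∈ V, f (g y) = y) (hgf : ∀ x ∈ U, g (f x) = x) :
    Nat.card (ConnectedComponents U) = Nat.card (ConnectedComponents V) := by
  refine shiaux_congr (fun x : U => (⟨f x, hU x x.2⟩ : V)) (fun y : V => (⟨g y, hV y y.2⟩ : U))
    (by fun_prop) (by fun_prop) ?_ ?_
  · intro y; exact Subtype.ext (hfg y y.2)
  · intro x; congr 1; exact Subtype.ext (hgf x x.2)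

theorem shiaux_cyl {Y : Type*} [TopologicalSpace Y] (V : Set Y) :
    Nat.card (ConnectedComponents {p : ℝ × Y | p.2 ∈ V}) = Nat.card (ConnectedComponents V) := by
  refine shiaux_congr (fun x : {p : ℝ × Y | p.2 ∈ V} => (⟨x.1.2, x.2⟩ : V))
    (fun y : V => ⟨(0, y.1), y.2⟩)
    (by fun_prop) (by fun_prop) ?_ ?_
  · intro y; rfl
  · rintro ⟨⟨t, y⟩, h⟩
    symm
    apply connectedComponent_eq
    have : IsPreconnected (Set.range (fun s : ℝ => (⟨(s, y), h⟩ : {p : ℝ × Y | p.2 ∈ V}))) :=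
      isPreconnected_range (by fun_prop)
    exact this.subset_connectedComponent ⟨t, rfl⟩ ⟨0, rfl⟩

section
set_option linter.unusedSectionVars false
variable {E : Type*} [AddCommGroup E] [Module ℝ E] [TopologicalSpace E] [IsTopologicalAddGroup E]
  [ContinuousSMul ℝ E]

/-- Complement of a finite arrangement. -/
def ShiArr (U : Set E) : Prop :=
  ∃ A : Set ((E →L[ℝ] ℝ) × ℝ), A.Finite ∧ U = {x | ∀ p ∈ A, p.1 x ≠ p.2}

theorem shiaux_iff_convex {ι : Type*} (F : ι → (E →L[ℝ] ℝ) × ℝ) (v : ι → Prop) :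
    Convex ℝ {x : E | (∀ i, (F i).1 x ≠ (F i).2) ∧ (fun i => (F i).2 < (F i).1 x) = v} := by
  have : {x : E | (∀ i, (F i).1 x ≠ (F i).2) ∧ (fun i => (F i).2 < (F i).1 x) = v}
      = ⋂ i, {x | (v i → (F i).2 < (F i).1 x) ∧ (¬ v i → (F i).1 x < (F i).2)} := by
    ext x
    simp only [Set.mem_ofPred_eq, Set.mem_iInter, funext_iff]
    constructor
    · rintro ⟨h1, h2⟩ i
      rw [← h2 i]
      exact ⟨id, fun h => lt_of_le_of_ne (not_lt.1 h) (h1 i)⟩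
    · intro h
      refine ⟨fun i => ?_, fun i => ?_⟩
      · by_cases hv : v i
        · exact ((h i).1 hv).ne'
        · exact ((h i).2 hv).ne
      · by_cases hv : v i
        · simpa [hv] using (h i).1 hv
        · simpa [hv] using ((h i).2 hv).le
  rw [this]
  refine convex_iInter fun i => ?_
  by_cases hv : v i
  · simpa [hv] using convex_halfSpace_gt (F i).1.toLinearMap.isLinear (F i).2
  · simpa [hv] using convex_halfSpace_lt (F i).1.toLinearMap.isLinear (F i).2

theorem shiaux_loc1 (f : E →L[ℝ] ℝ) (c : ℝ) (x : E) (h : f x ≠ c) :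
    ∀ᶠ y in 𝓝 x, (f y ≠ c) ∧ ((c < f y) = (c < f x)) := by
  have hc := f.continuous.continuousAt (x := x)
  rcases lt_or_gt_of_ne h with h | h
  · filter_upwards [hc.eventually_lt continuousAt_const h] with y hy
    exact ⟨hy.ne, by rw [eq_iff_iff]; exact iff_of_false hy.le.not_gt h.le.not_gt⟩
  · filter_upwards [continuousAt_const.eventually_lt hc h] with y hy
    exact ⟨hy.ne', by simp [hy, h]⟩

theorem shiaux_dr (U : Set E) (hU : ShiArr U) (g : E →L[ℝ] ℝ) (hg : g ≠ 0) (d : ℝ) :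
    Nat.card (ConnectedComponents {x | x ∈ U ∧ g x ≠ d}) =
      Nat.card (ConnectedComponents U) + Nat.card (ConnectedComponents {x | x ∈ U ∧ g x = d}) := by
  obtain ⟨A, hA, rfl⟩ := hU
  have : Finite A := hA
  let F : A → (E →L[ℝ] ℝ) × ℝ := fun i => i
  set U : Set E := {x | ∀ p ∈ A, p.1 x ≠ p.2} with hUdef
  have hmem : ∀ x, x ∈ U ↔ ∀ i, (F i).1 x ≠ (F i).2 := by
    intro x; simp [hUdef, F]
  let σ : E → (A → Prop) := fun x i => (F i).2 < (F i).1 x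
  have hloc : ∀ x ∈ U, ∀ᶠ y in 𝓝 x, y ∈ U ∧ σ y = σ x := by
    intro x hx
    rw [hmem] at hx
    have := Filter.eventually_all.2 (fun i => shiaux_loc1 (F i).1 (F i).2 x (hx i))
    filter_upwards [this] with y hy
    exact ⟨(hmem y).2 fun i => (hy i).1, funext fun i => (hy i).2⟩
  have hconv : ∀ v, Convex ℝ {x | x ∈ U ∧ σ x = v} := by
    intro v
    have := shiaux_iff_convex F v
    simpa only [hmem] using this
  have c1 : Nat.card (ConnectedComponents U) = (σ '' U).ncard :=
    shiaux_gen U σ (fun x hx => (hloc x hx).mono fun y hy => hy.2)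
      (fun v => (hconv v).isPreconnected)
  have c2 : Nat.card (ConnectedComponents {x | x ∈ U ∧ g x = d})
      = (σ '' {x | x ∈ U ∧ g x = d}).ncard := by
    refine shiaux_gen _ σ (fun x hx => (hloc x hx.1).mono fun y hy => hy.2) (fun v => ?_)
    have := (hconv v).inter (convex_hyperplane g.toLinearMap.isLinear d)
    convert this.isPreconnected using 1
    ext x; simp; tauto
  let τ : E → (A → Prop) × Prop := fun x => (σ x, d < g x)
  have c3 : Nat.card (ConnectedComponents {x | x ∈ U ∧ g x ≠ d})
      = (τ '' {x | x ∈ U ∧ g x ≠ d}).ncard := by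
    refine shiaux_gen _ τ (fun x hx => ?_) (fun v => ?_)
    · filter_upwards [hloc x hx.1, shiaux_loc1 g d x hx.2] with y h1 h2
      exact Prod.ext h1.2 h2.2
    · have := (hconv v.1).inter (shiaux_iff_convex (fun _ : Unit => (g, d)) (fun _ => v.2))
      convert this.isPreconnected using 1
      ext x; simp [τ, Prod.ext_iff, funext_iff]; tauto
  set P := σ '' {x | x ∈ U ∧ d < g x} with hP
  set M := σ '' {x | x ∈ U ∧ g x < d} with hM
  have e1 : τ '' {x | x ∈ U ∧ g x ≠ d} = (fun v => (v, True)) '' P ∪ (fun v => (v, False)) '' M := by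
    ext ⟨v, w⟩
    simp only [Set.mem_image, Set.mem_union, Set.mem_ofPred_eq, hP, hM, τ, Prod.mk.injEq]
    constructor
    · rintro ⟨x, ⟨hx, hne⟩, rfl, rfl⟩
      rcases lt_or_gt_of_ne hne with h | h
      · exact Or.inr ⟨_, ⟨x, ⟨hx, h⟩, rfl⟩, rfl, by simp [h.le]⟩
      · exact Or.inl ⟨_, ⟨x, ⟨hx, h⟩, rfl⟩, rfl, by simpa using h⟩
    · rintro (⟨_, ⟨x, ⟨hx, h⟩, rfl⟩, rfl, rfl⟩ | ⟨_, ⟨x, ⟨hx, h⟩, rfl⟩, rfl, rfl⟩)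
      · exact ⟨x, ⟨hx, h.ne'⟩, rfl, by simpa using h⟩
      · exact ⟨x, ⟨hx, h.ne⟩, rfl, by simpa using h.le⟩
  have e2 : σ '' {x | x ∈ U ∧ g x = d} = P ∩ M := by
    ext v
    constructor
    · rintro ⟨x, ⟨hx, hgx⟩, rfl⟩
      obtain ⟨w, hw⟩ : ∃ w, g w ≠ 0 := by
        by_contra! h
        exact hg (ContinuousLinearMap.ext h)
      obtain ⟨w, hw⟩ : ∃ w, g w = 1 := ⟨(g w)⁻¹ • w, by simp [hw]⟩
      have ht : Filter.Tendsto (fun t : ℝ => x + t • w) (𝓝 0) (𝓝 x) := by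
        have : Continuous (fun t : ℝ => x + t • w) := by fun_prop
        simpa using this.tendsto 0
      have hev := ht.eventually (hloc x hx)
      have h1 : ∃ᶠ t in 𝓝 (0:ℝ), 0 < t := frequently_gt_nhds 0
      have h2 : ∃ᶠ t in 𝓝 (0:ℝ), t < 0 := frequently_lt_nhds 0
      obtain ⟨t, h1, h1'⟩ := (h1.and_eventually hev).exists
      obtain ⟨u, h2, h2'⟩ := (h2.and_eventually hev).exists
      exact ⟨⟨x + t • w, ⟨h1'.1, by simp [hgx, hw, h1]⟩, h1'.2⟩,
        ⟨x + u • w, ⟨h2'.1, by simp [hgx, hw, h2]⟩, h2'.2⟩⟩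
    · rintro ⟨⟨x, ⟨hx, hgx⟩, rfl⟩, ⟨y, ⟨hy, hgy⟩, hyx⟩⟩
      have := ((hconv (σ x)).isPreconnected.image g g.continuous.continuousOn).Icc_subset
        ⟨y, ⟨hy, hyx⟩, rfl⟩ ⟨x, ⟨hx, rfl⟩, rfl⟩ ⟨hgy.le, hgx.le⟩
      obtain ⟨z, hz, hz'⟩ := this
      exact ⟨z, ⟨hz.1, hz'⟩, hz.2⟩
  have e3 : σ '' U = P ∪ M := by
    apply Set.Subset.antisymm
    · rintro _ ⟨x, hx, rfl⟩
      rcases lt_trichotomy (g x) d with h | h | h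
      · exact Or.inr ⟨x, ⟨hx, h⟩, rfl⟩
      · have : σ x ∈ P ∩ M := e2 ▸ ⟨x, ⟨hx, h⟩, rfl⟩
        exact Or.inl this.1
      · exact Or.inl ⟨x, ⟨hx, h⟩, rfl⟩
    · rintro _ (⟨x, hx, rfl⟩ | ⟨x, hx, rfl⟩)
      · exact ⟨x, hx.1, rfl⟩
      · exact ⟨x, hx.1, rfl⟩
  clear_value P M
  have i1 : ∀ w : Prop, Function.Injective (fun v : A → Prop => (v, w)) := by
    intro w a b h; exact congrArg Prod.fst h
  have dj : Disjoint ((fun v : A → Prop => (v, True)) '' P) ((fun v => (v, False)) '' M) := by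
    rw [Set.disjoint_left]
    rintro _ ⟨a, _, rfl⟩ ⟨b, _, h⟩
    simp at h
  rw [c1, c2, c3, e1, e2, e3, Set.ncard_union_add_ncard_inter, Set.ncard_union_eq dj,
    Set.ncard_image_of_injective _ (i1 _), Set.ncard_image_of_injective _ (i1 _)]

theorem ShiArr.of {T : Type*} (S : Set T) (hS : S.Finite) (F : T → E →L[ℝ] ℝ) (c : T → ℝ) :
    ShiArr {x : E | ∀ t ∈ S, F t x ≠ c t} := by
  refine ⟨(fun t => (F t, c t)) '' S, hS.image _, ?_⟩
  ext x; simp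

theorem ShiArr.inter {U V : Set E} (hU : ShiArr U) (hV : ShiArr V) : ShiArr (U ∩ V) := by
  obtain ⟨A, hA, rfl⟩ := hU
  obtain ⟨B, hB, rfl⟩ := hV
  refine ⟨A ∪ B, hA.union hB, ?_⟩
  ext x; constructor
  · rintro ⟨h1, h2⟩ p (hp | hp)
    · exact h1 p hp
    · exact h2 p hp
  · intro h
    exact ⟨fun p hp => h p (Or.inl hp), fun p hp => h p (Or.inr hp)⟩

end

/-- Shi arrangement together with an extra coordinate. -/
def shiT (r n : ℕ) (a : ℤ) (l m : ℕ) : Set (ℝ × (Fin n → ℝ)) :=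
  {p | p.2 ∈ shiArrangementCompl r n ∧ ∀ j : Fin n, ∀ s : ℤ, a ≤ s →
    (s < a + l ∨ (s = a + l ∧ n ≤ (j : ℕ) + m)) → p.1 - p.2 j ≠ (s : ℝ)}

theorem shiT_arr (r n : ℕ) (a : ℤ) (l m : ℕ) : ShiArr (shiT r n a l m) := by
  have h1 : ShiArr {p : ℝ × (Fin n → ℝ) | p.2 ∈ shiArrangementCompl r n} := by
    have := ShiArr.of (E := ℝ × (Fin n → ℝ))
      {t : Fin n × Fin n × ℤ | t.1 < t.2.1 ∧ -(r : ℤ) + 1 ≤ t.2.2 ∧ t.2.2 ≤ r}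
      ((Set.toFinite (Set.univ ×ˢ Set.univ ×ˢ Set.Icc (-(r : ℤ) + 1) r)).subset
        (by rintro ⟨i, j, s⟩ h; simp at h ⊢; tauto))
      (fun t => (ContinuousLinearMap.proj (R := ℝ) (φ := fun _ : Fin n => ℝ) t.1 -
        ContinuousLinearMap.proj (R := ℝ) (φ := fun _ : Fin n => ℝ) t.2.1).comp
        (ContinuousLinearMap.snd ℝ ℝ (Fin n → ℝ)))
      (fun t => (t.2.2 : ℝ))
    convert this using 1
    ext p
    simp only [shiArrangementCompl, Set.mem_ofPred_eq, Prod.forall]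
    exact ⟨fun h i j s hh => h i j hh.1 s hh.2.1 hh.2.2, fun h i j h1 s h2 h3 => h i j s ⟨h1, h2, h3⟩⟩
  have h2 := ShiArr.of (E := ℝ × (Fin n → ℝ))
      {t : Fin n × ℤ | a ≤ t.2 ∧ (t.2 < a + l ∨ (t.2 = a + l ∧ n ≤ (t.1 : ℕ) + m))}
      ((Set.toFinite (Set.univ ×ˢ Set.Icc a (a + l))).subset
        (by rintro ⟨i, s⟩ h; simp at h ⊢; omega))
      (fun t => ContinuousLinearMap.fst ℝ ℝ (Fin n → ℝ) - (ContinuousLinearMap.proj t.1).comp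
        (ContinuousLinearMap.snd ℝ ℝ (Fin n → ℝ)))
      (fun t => (t.2 : ℝ))
  convert h1.inter h2 using 1
  ext p
  simp only [shiT, Set.mem_inter_iff, Set.mem_ofPred_eq, Prod.forall]
  exact and_congr_right fun _ =>
    ⟨fun h i s hh => h i s hh.1 hh.2, fun h i s h1 h2 => h i s ⟨h1, h2⟩⟩

/-- Number of regions. -/
noncomputable abbrev shiC {X : Type*} [TopologicalSpace X] (U : Set X) : ℕ :=
  Nat.card (ConnectedComponents U)

theorem shiT_zero (r n : ℕ) (a : ℤ) : shiC (shiT r n a 0 0) = shiC (shiArrangementCompl r n) := by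
  have : shiT r n a 0 0 = {p : ℝ × (Fin n → ℝ) | p.2 ∈ shiArrangementCompl r n} := by
    ext p
    simp only [shiT, Set.mem_ofPred_eq, and_iff_left_iff_imp]
    intro _ j s h1 h2
    have := j.2
    omega
  rw [this]
  exact shiaux_cyl _

theorem shiT_full (r n : ℕ) (a : ℤ) (l : ℕ) : shiT r n a l n = shiT r n a (l + 1) 0 := by
  ext p
  simp only [shiT, Set.mem_ofPred_eq]
  refine and_congr_right fun _ => forall_congr' fun j => forall_congr' fun s => ?_
  have := j.2
  refine imp_congr_right fun h => imp_congr_left ?_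
  push_cast
  omega

/-- The restriction. -/
def shiW (r n l : ℕ) (j : Fin n) : Set (Fin n → ℝ) :=
  {y | y ∈ shiArrangementCompl r n ∧ ∀ k, k ≠ j → ∀ s : ℤ, -(l : ℤ) ≤ s →
    (s < 0 ∨ (s = 0 ∧ j < k)) → y j - y k ≠ (s : ℝ)}

theorem shiT_step (r n : ℕ) (a : ℤ) (l m : ℕ) (j : Fin n) (hj : (j : ℕ) + m + 1 = n) :
    shiC (shiT r n a l (m + 1)) = shiC (shiT r n a l m) + shiC (shiW r n l j) := by
  let g : (ℝ × (Fin n → ℝ)) →L[ℝ] ℝ :=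
    ContinuousLinearMap.fst ℝ ℝ (Fin n → ℝ) - (ContinuousLinearMap.proj j).comp
        (ContinuousLinearMap.snd ℝ ℝ (Fin n → ℝ))
  have hgv : ∀ p, g p = p.1 - p.2 j := fun p => rfl
  have hg : g ≠ 0 := by
    intro h
    have := hgv (1, 0)
    rw [h] at this
    simp at this
  have h := shiaux_dr (shiT r n a l m) (shiT_arr r n a l m) g hg ((a + l : ℤ) : ℝ)
  have e1 : {x | x ∈ shiT r n a l m ∧ g x ≠ ((a + l : ℤ) : ℝ)} = shiT r n a l (m + 1) := by
    ext p
    simp only [shiT, Set.mem_ofPred_eq, hgv]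
    constructor
    · rintro ⟨⟨h1, h2⟩, h3⟩
      refine ⟨h1, fun k s hs hs' => ?_⟩
      by_cases hk : s < a + l ∨ (s = a + l ∧ n ≤ (k : ℕ) + m)
      · exact h2 k s hs hk
      · have : s = a + l := by omega
        have : k = j := Fin.ext (by omega)
        subst this; subst s; exact h3
    · rintro ⟨h1, h2⟩
      exact ⟨⟨h1, fun k s hs hs' => h2 k s hs (by omega)⟩, h2 j _ (by omega) (by omega)⟩
  rw [e1] at h
  change shiC (shiT r n a l (m + 1)) = shiC (shiT r n a l m) + _ at h
  rw [h]
  congr 1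
  refine shiaux_image _ _ (fun p => p.2) (fun y => (y j + ((a + l : ℤ) : ℝ), y))
    (by fun_prop) (by fun_prop) ?_ ?_ (fun _ _ => rfl) ?_
  · rintro ⟨t, y⟩ ⟨⟨h1, h2⟩, h3⟩
    rw [hgv] at h3
    refine ⟨h1, fun k hk s hs hs' heq => ?_⟩
    refine h2 k (s + (a + l)) (by omega) ?_ ?_
    · rcases hs' with h | ⟨h, h'⟩
      · omega
      · have : (j : ℕ) < k := h'
        omega
    · push_cast at h3 heq ⊢
      try simp only at h3 heq ⊢
      linarith
  · rintro y ⟨h1, h2⟩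
    refine ⟨⟨h1, fun k s hs hs' heq => ?_⟩, ?_⟩
    · by_cases hk : k = j
      · subst hk
        have : s = a + l := by
          have : (s : ℝ) = ((a + l : ℤ) : ℝ) := by rw [← heq]; simp
          exact_mod_cast this
        omega
      · refine h2 k hk (s - (a + l)) (by omega) ?_ ?_
        · rcases hs' with h | ⟨h, h'⟩
          · omega
          · have : (k : ℕ) ≠ j := fun h => hk (Fin.ext h)
            exact Or.inr ⟨by omega, Fin.lt_def.2 (by omega)⟩
        · push_cast at heq ⊢
          linarith
    · rw [hgv]; simp
  · rintro ⟨t, y⟩ ⟨_, h3⟩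
    rw [hgv] at h3
    ext1
    · simp only at h3 ⊢; linarith
    · rfl

theorem shiW_small (r n l : ℕ) (j : Fin n) (hl : l < r) :
    shiW r n l j = shiArrangementCompl r n := by
  ext y
  simp only [shiW, Set.mem_ofPred_eq, and_iff_left_iff_imp]
  intro h k hk s hs hs' heq
  rcases lt_or_gt_of_ne hk with h' | h'
  · refine h k j h' (-s) (by omega) (by omega) ?_
    push_cast; linarith
  · exact h j k h' s (by omega) (by omega) heq

theorem shi_split (r n : ℕ) (j : Fin (n + 1)) (y : Fin (n + 1) → ℝ) :
    y ∈ shiArrangementCompl r (n + 1) ↔ (fun k => y (j.succAbove k)) ∈ shiArrangementCompl r n ∧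
      ∀ k : Fin n, ∀ s : ℤ, -(r : ℤ) ≤ s → s ≤ r → ((k : ℕ) < j → s < r) →
        ((j : ℕ) ≤ k → -(r : ℤ) < s) → y j - y (j.succAbove k) ≠ (s : ℝ) := by
  constructor
  · intro h
    refine ⟨fun i k hik s h1 h2 => h _ _ (Fin.strictMono_succAbove j hik) s h1 h2, ?_⟩
    intro k s h1 h2 h3 h4 heq
    by_cases hk : (k : ℕ) < j
    · have : j.succAbove k < j := by
        rw [Fin.succAbove_of_castSucc_lt _ _ (Fin.lt_def.2 hk)]; exact Fin.lt_def.2 hk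
      have := h3 hk
      refine h _ _ ‹_› (-s) (by omega) (by omega) ?_
      push_cast; linarith
    · have : j < j.succAbove k := by
        rw [Fin.succAbove_of_le_castSucc _ _ (Fin.le_def.2 (not_lt.1 hk))]
        exact Fin.lt_def.2 (by simp; omega)
      have := h4 (by omega)
      exact h _ _ ‹_› s (by omega) (by omega) heq
  · rintro ⟨h1, h2⟩ i k hik s hs hs' heq
    rcases Fin.eq_self_or_eq_succAbove j i with rfl | ⟨i, rfl⟩
    · rcases Fin.eq_self_or_eq_succAbove i k with rfl | ⟨k, rfl⟩
      · exact lt_irrefl _ hik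
      · refine h2 k s (by omega) hs' (fun h => ?_) (by omega) heq
        rw [Fin.succAbove_of_castSucc_lt _ _ (Fin.lt_def.2 h)] at hik
        have := Fin.lt_def.1 hik
        simp at this
        omega
    · rcases Fin.eq_self_or_eq_succAbove j k with rfl | ⟨k, rfl⟩
      · refine h2 i (-s) (by omega) (by omega) (by omega) (fun h => ?_) (by push_cast; linarith)
        rw [Fin.succAbove_of_le_castSucc _ _ (Fin.le_def.2 h)] at hik
        have := Fin.lt_def.1 hik
        simp at this
        omega
      · exact h1 i k ((Fin.strictMono_succAbove j).lt_iff_lt.1 hik) s hs hs' heq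

theorem shi_insert {n : ℕ} (j : Fin (n + 1)) (U : Set (Fin (n + 1) → ℝ)) (V : Set (ℝ × (Fin n → ℝ)))
    (h : ∀ y, y ∈ U ↔ (y j, fun k => y (j.succAbove k)) ∈ V) : shiC U = shiC V := by
  have e : ∀ p : ℝ × (Fin n → ℝ), (j.insertNth p.1 p.2 : Fin (n + 1) → ℝ) j = p.1 ∧
      (fun k => (j.insertNth p.1 p.2 : Fin (n + 1) → ℝ) (j.succAbove k)) = p.2 :=
    fun p => ⟨by simp, by simp⟩
  refine shiaux_image U V (fun y => (y j, fun k => y (j.succAbove k)))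
    (fun p => j.insertNth p.1 p.2) (by fun_prop) ?_ (fun y hy => (h y).1 hy) ?_ ?_ ?_
  · exact Continuous.finInsertNth (A := fun _ => ℝ) j continuous_fst continuous_snd
  · intro p hp
    rw [h, (e p).1, (e p).2]; exact hp
  · intro p _
    exact Prod.ext (e p).1 (e p).2
  · intro y _
    exact j.insertNth_self_removeNth y

theorem shi_succ (r n : ℕ) :
    shiC (shiArrangementCompl r (n + 1)) = shiC (shiT r n (-(r : ℤ) + 1) (r + r) 0) := by
  apply shi_insert 0
  intro y
  rw [shi_split r n 0 y]
  simp only [shiT, Set.mem_ofPred_eq]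
  refine and_congr_right fun _ => forall_congr' fun k => forall_congr' fun s => ?_
  have := k.2
  constructor
  · intro h h1 h2
    push_cast at h2
    exact h (by omega) (by omega) (by simp) (by intro; omega)
  · intro h h1 h2 h3 h4
    have := h4 (by simp)
    exact h (by omega) (by push_cast; omega)

theorem shiW_large (r n l m : ℕ) (hr : 0 < r) (j : Fin (n + 1)) (hl : r ≤ l) (hj : (j : ℕ) + m = n) :
    shiC (shiW r (n + 1) l j) = shiC (shiT r n (-(l : ℤ)) (r + l) m) := by
  apply shi_insert j
  intro y
  simp only [shiW, shiT, Set.mem_ofPred_eq]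
  rw [shi_split r n j y, and_assoc]
  refine and_congr_right fun _ => ?_
  have hlt : ∀ k : Fin n, j < j.succAbove k ↔ (j : ℕ) ≤ k := by
    intro k
    rw [Fin.lt_succAbove_iff_le_castSucc, Fin.le_def]; simp
  constructor
  · rintro ⟨h1, h2⟩ k s hs hs'
    push_cast at hs'
    by_cases hc : s < 0
    · exact h2 _ (Fin.succAbove_ne j k) s hs (Or.inl hc)
    · exact h1 k s (by omega) (by omega) (by omega) (by omega)
  · intro h
    refine ⟨fun k s a1 a2 a3 a4 => h k s (by omega) (by push_cast; omega), fun k hk s hs hs' => ?_⟩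
    obtain ⟨k, rfl⟩ := Fin.exists_succAbove_eq hk
    rw [hlt] at hs'
    exact h k s hs (by push_cast; omega)

theorem shi_small (r n : ℕ) (a : ℤ) (c : ℕ) (hc : shiC (shiArrangementCompl r n) = c) (l : ℕ)
    (hl : l ≤ r) : shiC (shiT r n a l 0) = c * (1 + l * n) := by
  induction l with
  | zero => rw [shiT_zero, hc]; simp
  | succ l ih =>
    have key : ∀ m, m ≤ n → shiC (shiT r n a l m) = c * (1 + l * n + m) := by
      intro m
      induction m with
      | zero => intro _; rw [ih (by omega)]; simp
      | succ m ihm =>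
        intro hm
        rw [shiT_step r n a l m ⟨n - 1 - m, by omega⟩ (by simp; omega), ihm (by omega),
          shiW_small r n l _ (by omega), hc]
        ring
    rw [← shiT_full, key n le_rfl]
    ring

theorem shi_large (r n : ℕ) (hr : 0 < r)
    (hP : shiC (shiArrangementCompl r n) = (r * n + 1) ^ (n - 1))
    (hQ : ∀ n', n' + 1 = n → ∀ (a : ℤ) (d m : ℕ), m ≤ n' →
      shiC (shiT r n' a (r + d) m) = (1 + d + r * n') ^ (n' - m) * (2 + d + r * n') ^ m)
    (a : ℤ) (d m : ℕ) (hm : m ≤ n) :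
    shiC (shiT r n a (r + d) m) = (1 + d + r * n) ^ (n - m) * (2 + d + r * n) ^ m := by
  have step : ∀ d, shiC (shiT r n a (r + d) 0) = (1 + d + r * n) ^ n → ∀ m, m ≤ n →
      shiC (shiT r n a (r + d) m) = (1 + d + r * n) ^ (n - m) * (2 + d + r * n) ^ m := by
    intro d h0 m
    induction m with
    | zero => intro _; rw [h0]; simp
    | succ m ihm =>
      intro hm
      obtain ⟨n', rfl⟩ : ∃ n', n = n' + 1 := ⟨n - 1, by omega⟩
      obtain ⟨u, rfl⟩ : ∃ u, n' = u + m := ⟨n' - m, by omega⟩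
      rw [shiT_step r _ a _ m ⟨u, by omega⟩ rfl, ihm (by omega),
        shiW_large r _ _ m hr _ (by omega) rfl, hQ _ rfl _ _ _ (by omega)]
      have e1 : u + m + 1 - m = u + 1 := by omega
      have e2 : u + m - m = u := by omega
      have e3 : u + m + 1 - (m + 1) = u := by omega
      rw [e1, e2, e3]
      ring
  have base : ∀ d, shiC (shiT r n a (r + d) 0) = (1 + d + r * n) ^ n := by
    intro d
    induction d with
    | zero =>
      rw [Nat.add_zero, shi_small r n a _ hP r le_rfl]
      rcases n with _ | n
      · simp
      · simp only [Nat.add_sub_cancel]; ring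
    | succ d ih =>
      rw [← Nat.add_assoc, ← shiT_full, step d ih n le_rfl]
      simp only [Nat.sub_self, pow_zero, one_mul]
      ring
  exact step d (base d) m hm

theorem shi_main (r : ℕ) (hr : 0 < r) (n : ℕ) :
    shiC (shiArrangementCompl r n) = (r * n + 1) ^ (n - 1) ∧
    ∀ (a : ℤ) (d m : ℕ), m ≤ n →
      shiC (shiT r n a (r + d) m) = (1 + d + r * n) ^ (n - m) * (2 + d + r * n) ^ m := by
  induction n with
  | zero =>
    have hP : shiC (shiArrangementCompl r 0) = (r * 0 + 1) ^ (0 - 1) := by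
      have hu : shiArrangementCompl r 0 = Set.univ := by
        ext x; simp [shiArrangementCompl]
      have : shiC (shiArrangementCompl r 0) = ((fun _ => ()) '' (shiArrangementCompl r 0)).ncard := by
        apply shiaux_gen
        · simp
        · intro v; exact Set.Subsingleton.isPreconnected (Set.subsingleton_of_subsingleton)
      rw [this, hu]
      simp
    exact ⟨hP, shi_large r 0 hr hP (by intro n' h; omega)⟩
  | succ n ih =>
    have hP : shiC (shiArrangementCompl r (n + 1)) = (r * (n + 1) + 1) ^ (n + 1 - 1) := by
      rw [shi_succ, ih.2 _ _ _ (Nat.zero_le _)]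
      simp only [Nat.add_sub_cancel, Nat.sub_zero, pow_zero, mul_one]
      ring
    refine ⟨hP, shi_large r _ hr hP ?_⟩
    intro n' h
    obtain rfl : n' = n := by omega
    exact ih.2

/-- The `r`-Shi arrangement `S_n^r` has exactly `(rn+1)^(n-1)` regions. -/
theorem shi_arrangement_card_regions (r n : ℕ) (hr : 0 < r) (hn : 0 < n) :
    Nat.card (ConnectedComponents ↥(shiArrangementCompl r n)) = (r * n + 1) ^ (n - 1) :=
  (shi_main r hr n).1
end

section
/- For all positive integers r and n, the number of O-rooted labeled r-trees on the vertex set O ∪ V, where |O| = r and |V| = n, is (rn+1)^{n−1}. -/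
/-- The father set of a vertex `v ∈ V` in the graph `G` on `O ⊕ V` under the ordering `ν`
(where `ν j` is the `j`-th vertex of the rearrangement, so `v` occupies position `ν.symm v`):
the set of neighbours of `v` that are roots or vertices occurring earlier in `ν`. -/
def fatherSet {r n : ℕ} (G : SimpleGraph (Fin r ⊕ Fin n)) (ν : Equiv.Perm (Fin n))
    (v : Fin n) : Set (Fin r ⊕ Fin n) :=
  {w | G.Adj (Sum.inr v) w ∧
    ((∃ o : Fin r, w = Sum.inl o) ∨ ∃ u : Fin n, w = Sum.inr u ∧ ν.symm u < ν.symm v)}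

/-- `ν` is a valid rearrangement for `G`: each vertex of `V` is adjacent to exactly `r`
vertices among the roots and the earlier vertices, and these `r` vertices are pairwise
adjacent in `G`. -/
def IsValidRearrangement {r n : ℕ} (G : SimpleGraph (Fin r ⊕ Fin n))
    (ν : Equiv.Perm (Fin n)) : Prop :=
  ∀ v : Fin n, Nat.card (fatherSet G ν v) = r ∧ G.IsClique (fatherSet G ν v)

/-- An `O`-rooted labeled `r`-tree on `O ⊕ V` (with `|O| = r`, `|V| = n`): a graph
admitting a valid rearrangement. -/
def IsORootedRTree {r n : ℕ} (G : SimpleGraph (Fin r ⊕ Fin n)) : Prop :=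
  ∃ ν : Equiv.Perm (Fin n), IsValidRearrangement G ν

/-- Acyclic coded functions. -/
def Acyc {V A R : Type} (f : V → A ⊕ V × R) : Prop :=
  ∃ ρ : V → ℕ, ∀ v w i, f v = Sum.inr (w, i) → ρ w < ρ v

lemma Acyc.exists_inl {V A R : Type} [Finite V] [Nonempty V] {f : V → A ⊕ V × R} (h : Acyc f) :
    ∃ v a, f v = Sum.inl a := by
  obtain ⟨ρ, hρ⟩ := h
  obtain ⟨v, hv⟩ := Finite.exists_min ρ
  rcases hf : f v with a | ⟨w, i⟩
  · exact ⟨v, a, hf⟩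
  · exact absurd (hρ v w i hf) (not_lt.2 (hv w))

open Classical in
noncomputable def glue {V A R : Type} (S : Finset V) (h : {v // v ∈ S} → A)
    (g : {v // v ∉ S} → ({v // v ∈ S} × R) ⊕ ({v // v ∉ S} × R)) (v : V) : A ⊕ V × R :=
  if hv : v ∈ S then Sum.inl (h ⟨v, hv⟩)
  else Sum.inr (Sum.elim (fun x => (x.1.1, x.2)) (fun x => (x.1.1, x.2)) (g ⟨v, hv⟩))

lemma card_fiber {V A R : Type} [Fintype V] [Finite A] [Finite R] (S : Finset V) :
    Nat.card {f : {f : V → A ⊕ V × R // Acyc f} //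
      Finset.univ.filter (fun v => (f.1 v).isLeft = true) = S} =
    Nat.card A ^ S.card *
    Nat.card {g : {v // v ∉ S} → ({v // v ∈ S} × R) ⊕ ({v // v ∉ S} × R) // Acyc g} := by
  classical
  have hA : Nat.card ({v // v ∈ S} → A) = Nat.card A ^ S.card := by
    simp [Nat.card_fun]
  rw [← hA, ← Nat.card_prod]
  symm
  have key : ∀ x : ({v // v ∈ S} → A) ×
      {g : {v // v ∉ S} → ({v // v ∈ S} × R) ⊕ ({v // v ∉ S} × R) // Acyc g},
      Acyc (glue S x.1 x.2.1) := by
    rintro ⟨h, g, ρ, hρ⟩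
    refine ⟨fun v => if hv : v ∈ S then 0 else ρ ⟨v, hv⟩ + 1, ?_⟩
    intro v w i hf
    by_cases hv : v ∈ S
    · simp [glue, hv] at hf
    · simp only [glue, hv, dite_false, Sum.inr.injEq] at hf
      rcases hg : g ⟨v, hv⟩ with ⟨⟨s, hs⟩, j⟩ | ⟨⟨s, hs⟩, j⟩
      · rw [hg] at hf
        simp at hf
        obtain ⟨rfl, rfl⟩ := hf
        simp [hs, hv]
      · have := hρ _ _ _ hg
        rw [hg] at hf
        simp at hf
        obtain ⟨rfl, rfl⟩ := hf
        simp [hs, hv, this]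
  refine Nat.card_eq_of_bijective (fun x => ⟨⟨glue S x.1 x.2.1, key x⟩, ?_⟩) ⟨?_, ?_⟩
  · ext v
    rw [Finset.mem_filter]
    by_cases hv : v ∈ S <;> simp [glue, hv]
  · rintro ⟨h, g, hg⟩ ⟨h', g', hg'⟩ e
    simp only [Subtype.mk.injEq] at e
    have e1 : h = h' := by
      ext ⟨v, hv⟩
      have := congrFun e v
      simpa [glue, hv] using this
    have e2 : g = g' := by
      ext1 ⟨v, hv⟩
      have := congrFun e v
      simp only [glue, hv, dite_false, Sum.inr.injEq] at this
      rcases h1 : g ⟨v, hv⟩ with ⟨⟨s, hs⟩, j⟩ | ⟨⟨s, hs⟩, j⟩ <;>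
      rcases h2 : g' ⟨v, hv⟩ with ⟨⟨s', hs'⟩, j'⟩ | ⟨⟨s', hs'⟩, j'⟩ <;>
      rw [h1, h2] at this <;> simp at this ⊢ <;> grind
    subst e1 e2
    rfl
  · rintro ⟨⟨f, ρ, hρ⟩, hf⟩
    have hS : ∀ v, v ∈ S ↔ (f v).isLeft = true := by
      intro v; rw [← hf]; simp
    have h1 : ∀ v : {v // v ∈ S}, ∃ a, f v.1 = Sum.inl a := by
      rintro ⟨v, hv⟩
      exact Sum.isLeft_iff.1 ((hS v).1 hv)
    choose h hh using h1
    have h2 : ∀ v : {v // v ∉ S}, ∃ b : ({v // v ∈ S} × R) ⊕ ({v // v ∉ S} × R),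
        f v.1 = Sum.inr (Sum.elim (fun x => (x.1.1, x.2)) (fun x => (x.1.1, x.2)) b) := by
      rintro ⟨v, hv⟩
      rcases hfv : f v with a | ⟨w, i⟩
      · exact absurd ((hS v).2 (by simp [hfv])) hv
      · by_cases hw : w ∈ S
        · exact ⟨Sum.inl (⟨w, hw⟩, i), by simp⟩
        · exact ⟨Sum.inr (⟨w, hw⟩, i), by simp⟩
    choose g hg using h2
    refine ⟨⟨h, g, fun v => ρ v.1, ?_⟩, ?_⟩
    · intro v w i hvw
      have := hg v
      rw [hvw] at this
      exact hρ _ _ _ this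
    · apply Subtype.ext
      apply Subtype.ext
      funext v
      by_cases hv : v ∈ S
      · simp [glue, hv, hh ⟨v, hv⟩]
      · simp only [glue, hv, dite_false]
        exact (hg ⟨v, hv⟩).symm

lemma card_acyc_aux (R : Type) [Finite R] : ∀ (n : ℕ) (V A : Type) [Fintype V] [Finite A],
    Fintype.card V = n → Nat.card {f : V → A ⊕ V × R // Acyc f} =
      if n = 0 then 1 else Nat.card A * (Nat.card A + Nat.card R * n) ^ (n - 1) := by
  intro n
  induction n using Nat.strong_induction_on with
  | _ n ih =>
  intro V A _ _ hV
  classical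
  rcases n with _ | m
  · have : IsEmpty V := Fintype.card_eq_zero_iff.1 hV
    rw [if_pos rfl, Nat.card_eq_one_iff_unique]
    exact ⟨inferInstance, ⟨⟨fun v => isEmptyElim v, fun _ => 0, fun v => isEmptyElim v⟩⟩⟩
  have hne : Nonempty V := Fintype.card_pos_iff.1 (by omega)
  rw [Nat.card_congr (Equiv.sigmaFiberEquiv (fun f : {f : V → A ⊕ V × R // Acyc f} =>
      Finset.univ.filter (fun v => (f.1 v).isLeft = true))).symm, Nat.card_sigma]
  set a := Nat.card A
  set r := Nat.card R
  let T : ℕ → ℕ := fun k => a ^ k * (if k = m + 1 then 1 else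
    (k * r) * (k * r + r * (m + 1 - k)) ^ (m - k))
  have hterm : ∀ S : Finset V, Nat.card {f : {f : V → A ⊕ V × R // Acyc f} //
      Finset.univ.filter (fun v => (f.1 v).isLeft = true) = S} = T S.card := by
    intro S
    rw [card_fiber]
    have hc : Fintype.card {v // v ∉ S} = m + 1 - S.card := by
      rw [Fintype.card_subtype_compl, hV]; simp
    have hle : S.card ≤ m + 1 := hV ▸ S.card_le_univ
    rcases Nat.eq_zero_or_pos S.card with h0 | hpos
    · have : IsEmpty {g : {v // v ∉ S} → ({v // v ∈ S} × R) ⊕ ({v // v ∉ S} × R) // Acyc g} := by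
        refine ⟨fun ⟨g, hg⟩ => ?_⟩
        have : Nonempty {v // v ∉ S} := Fintype.card_pos_iff.1 (by omega)
        obtain ⟨v, ⟨s, i⟩, h⟩ := hg.exists_inl
        have := s.2
        exact absurd this (by simp [Finset.card_eq_zero.1 h0])
      simp [T, h0]
    · rw [ih (m + 1 - S.card) (by omega) _ _ hc]
      simp only [T]
      have : Nat.card ({v // v ∈ S} × R) = S.card * r := by simp [r]
      rw [this]
      congr 1
      by_cases h : S.card = m + 1
      · simp [h]
      · rw [if_neg h, if_neg (by omega)]
        congr 2
        omega
  simp_rw [hterm]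
  rw [if_neg (by omega), ← Finset.powerset_univ, Finset.sum_powerset_apply_card, Finset.card_univ, hV,
    Finset.sum_range_succ']
  have : ∀ k ∈ Finset.range (m+1), (m + 1).choose (k+1) • T (k+1) =
      a * (a ^ k * (r * (m+1)) ^ (m - k) * m.choose k) := by
    intro k hk
    have hk : k ≤ m := by simpa [Nat.lt_succ_iff] using hk
    simp only [T, smul_eq_mul]
    by_cases h : k = m
    · subst h; simp; ring
    · obtain ⟨d, rfl⟩ : ∃ d, m = k + 1 + d := ⟨m - (k+1), by omega⟩
      rw [if_neg (by omega)]
      have h1 : k + 1 + d + 1 - (k + 1) = d + 1 := by omega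
      have h2 : k + 1 + d - (k + 1) = d := by omega
      have h3 : k + 1 + d - k = d + 1 := by omega
      rw [h1, h2, h3]
      have := Nat.add_one_mul_choose_eq (k + 1 + d) k
      have e : (k + 1) * r + r * (d + 1) = r * (k + 1 + d + 1) := by ring
      rw [e]
      calc _ = ((k + 1 + d + 1).choose (k+1) * (k+1)) * (a^(k+1) * r * (r * (k + 1 + d + 1))^d) := by ring
        _ = _ := by rw [← this]; ring
  rw [Finset.sum_congr rfl this, ← Finset.mul_sum, Nat.add_sub_cancel, add_pow]
  simp [T]

section trees
variable {r n : ℕ}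

/-- The clique with a given code, relative to a father family `F` and a labelling `e`. -/
def cliq (e : Set (Fin r ⊕ Fin n) → Fin r → Fin r ⊕ Fin n) (F : Fin n → Set (Fin r ⊕ Fin n)) :
    Unit ⊕ Fin n × Fin r → Set (Fin r ⊕ Fin n)
  | Sum.inl _ => Set.range Sum.inl
  | Sum.inr (w, i) => insert (Sum.inr w) (F w \ {e (F w) i})

def GoodE (e : Set (Fin r ⊕ Fin n) → Fin r → Fin r ⊕ Fin n) : Prop :=
  ∀ s, s.ncard = r → Function.Injective (e s) ∧ Set.range (e s) = s

lemma exists_goodE : ∃ e : Set (Fin r ⊕ Fin n) → Fin r → Fin r ⊕ Fin n, GoodE e := by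
  have : ∀ s : Set (Fin r ⊕ Fin n), ∃ g : Fin r → Fin r ⊕ Fin n,
      s.ncard = r → Function.Injective g ∧ Set.range g = s := by
    intro s
    by_cases h : s.ncard = r
    · have h' : Nat.card s = r := h
      let E := (Finite.equivFinOfCardEq h').symm
      refine ⟨fun i => (E i).1, fun _ => ⟨Subtype.val_injective.comp E.injective, ?_⟩⟩
      have : (fun i => (E i).1) = Subtype.val ∘ E := rfl
      rw [this, Set.range_comp, E.surjective.range_eq]
      simp
    · exact ⟨Sum.inl, fun h' => absurd h' h⟩
  choose e he using this
  exact ⟨e, he⟩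

lemma ncard_inl : (Set.range (Sum.inl : Fin r → Fin r ⊕ Fin n)).ncard = r := by
  rw [← Set.image_univ, Set.ncard_image_of_injective _ Sum.inl_injective]
  simp [Set.ncard_univ]

lemma inr_mem_father {G : SimpleGraph (Fin r ⊕ Fin n)} {ν : Equiv.Perm (Fin n)} {v u : Fin n} :
    Sum.inr u ∈ fatherSet G ν v ↔ G.Adj (Sum.inr v) (Sum.inr u) ∧ ν.symm u < ν.symm v := by
  simp [fatherSet]

lemma inl_mem_father {G : SimpleGraph (Fin r ⊕ Fin n)} {ν : Equiv.Perm (Fin n)} {v : Fin n}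
    {o : Fin r} :
    Sum.inl o ∈ fatherSet G ν v ↔ G.Adj (Sum.inr v) (Sum.inl o) := by
  simp [fatherSet]

lemma IsValidRearrangement.ncard {G : SimpleGraph (Fin r ⊕ Fin n)} {ν : Equiv.Perm (Fin n)}
    (h : IsValidRearrangement G ν) (v : Fin n) : (fatherSet G ν v).ncard = r := (h v).1

lemma pos_induction (ν : Equiv.Perm (Fin n)) {P : Fin n → Prop}
    (h : ∀ v, (∀ w, ν.symm w < ν.symm v → P w) → P v) (v : Fin n) : P v := by
  have : WellFounded (fun a b : Fin n => ν.symm a < ν.symm b) :=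
    InvImage.wf ν.symm wellFounded_lt
  exact this.induction v (fun v ih => h v ih)

lemma father_unique {G : SimpleGraph (Fin r ⊕ Fin n)} {ν ν' : Equiv.Perm (Fin n)}
    (h : IsValidRearrangement G ν) (h' : IsValidRearrangement G ν') :
    fatherSet G ν = fatherSet G ν' := by
  funext v
  induction v using pos_induction ν with
  | h v ih =>
  refine Set.eq_of_subset_of_ncard_le ?_ (by rw [h.ncard, h'.ncard]) (Set.toFinite _)
  rintro (o | w) hw
  · rw [inl_mem_father] at hw ⊢; exact hw
  · by_contra hc
    rw [inr_mem_father] at hw hc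
    have hne : w ≠ v := by rintro rfl; exact lt_irrefl _ hw.2
    have hlt : ν'.symm v < ν'.symm w := by
      have h1 : ¬ ν'.symm w < ν'.symm v := fun h => hc ⟨hw.1, h⟩
      have h2 : ν'.symm w ≠ ν'.symm v := fun h => hne (ν'.symm.injective h)
      omega
    have : Sum.inr v ∈ fatherSet G ν' w := inr_mem_father.2 ⟨hw.1.symm, hlt⟩
    rw [← ih w hw.2, inr_mem_father] at this
    exact lt_asymm this.2 hw.2

lemma base_clique (hn : 0 < n) {G : SimpleGraph (Fin r ⊕ Fin n)} {ν : Equiv.Perm (Fin n)}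
    (h : IsValidRearrangement G ν) : G.IsClique (Set.range Sum.inl) := by
  have : fatherSet G ν (ν ⟨0, hn⟩) = Set.range Sum.inl := by
    refine Set.eq_of_subset_of_ncard_le ?_ (by rw [h.ncard, ncard_inl]) (Set.toFinite _)
    rintro (o | w) hw
    · simp
    · rw [inr_mem_father] at hw
      have := hw.2
      simp [Fin.lt_def] at this
  rw [← this]
  exact (h _).2

lemma adj_iff (hn : 0 < n) {G : SimpleGraph (Fin r ⊕ Fin n)} {ν : Equiv.Perm (Fin n)}
    (h : IsValidRearrangement G ν) (a b : Fin r ⊕ Fin n) :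
    G.Adj a b ↔ (a ≠ b ∧ a ∈ Set.range Sum.inl ∧ b ∈ Set.range Sum.inl) ∨
      (∃ v, a = Sum.inr v ∧ b ∈ fatherSet G ν v) ∨ (∃ v, b = Sum.inr v ∧ a ∈ fatherSet G ν v) := by
  constructor
  · intro hab
    rcases a with a | a <;> rcases b with b | b
    · exact Or.inl ⟨hab.ne, ⟨a, rfl⟩, ⟨b, rfl⟩⟩
    · exact Or.inr (Or.inr ⟨b, rfl, inl_mem_father.2 hab.symm⟩)
    · exact Or.inr (Or.inl ⟨a, rfl, inl_mem_father.2 hab⟩)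
    · right
      have hne : ν.symm a ≠ ν.symm b := fun h => hab.ne (by rw [ν.symm.injective h])
      rcases lt_or_gt_of_ne hne with hlt | hlt
      · exact Or.inr ⟨b, rfl, inr_mem_father.2 ⟨hab.symm, hlt⟩⟩
      · exact Or.inl ⟨a, rfl, inr_mem_father.2 ⟨hab, hlt⟩⟩
  · rintro (⟨hne, ha, hb⟩ | ⟨v, rfl, hb⟩ | ⟨v, rfl, ha⟩)
    · exact base_clique hn h ha hb hne
    · exact hb.1
    · exact ha.1.symm

def RTRel (e : Set (Fin r ⊕ Fin n) → Fin r → Fin r ⊕ Fin n) (f : Fin n → Unit ⊕ Fin n × Fin r)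
    (G : SimpleGraph (Fin r ⊕ Fin n)) (ν : Equiv.Perm (Fin n)) : Prop :=
  IsValidRearrangement G ν ∧ (∀ v w i, f v = Sum.inr (w, i) → ν.symm w < ν.symm v) ∧
    ∀ v, fatherSet G ν v = cliq e (fatherSet G ν) (f v)

lemma RTRel.acyc {e : Set (Fin r ⊕ Fin n) → Fin r → Fin r ⊕ Fin n}
    {f : Fin n → Unit ⊕ Fin n × Fin r} {G : SimpleGraph (Fin r ⊕ Fin n)} {ν : Equiv.Perm (Fin n)}
    (h : RTRel e f G ν) : Acyc f :=
  ⟨fun v => (ν.symm v).1, fun v w i hf => h.2.1 v w i hf⟩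

lemma RTRel.unique_f {e : Set (Fin r ⊕ Fin n) → Fin r → Fin r ⊕ Fin n} (he : GoodE e)
    {f f' : Fin n → Unit ⊕ Fin n × Fin r} {G : SimpleGraph (Fin r ⊕ Fin n)}
    {ν ν' : Equiv.Perm (Fin n)}
    (h : RTRel e f G ν) (h' : RTRel e f' G ν') : f = f' := by
  have hF := father_unique h.1 h'.1
  funext v
  have hv := h.2.2 v
  have hv' := h'.2.2 v
  rw [← hF, hv] at hv'
  rcases hf : f v with ⟨⟩ | ⟨w, i⟩ <;> rcases hf' : f' v with ⟨⟩ | ⟨w', i'⟩ <;>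
    rw [hf, hf'] at hv' <;> simp only [cliq] at hv'
  · have : (Sum.inr w' : Fin r ⊕ Fin n) ∈ Set.range Sum.inl := by rw [hv']; simp
    simp at this
  · have : (Sum.inr w : Fin r ⊕ Fin n) ∈ Set.range Sum.inl := by rw [← hv']; simp
    simp at this
  · have h1 : w = w' := by
      by_contra hne
      have m1 : (Sum.inr w : Fin r ⊕ Fin n) ∈ insert (Sum.inr w')
        (fatherSet G ν w' \ {e (fatherSet G ν w') i'}) := by rw [← hv']; simp
      have m2 : (Sum.inr w' : Fin r ⊕ Fin n) ∈ insert (Sum.inr w)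
        (fatherSet G ν w \ {e (fatherSet G ν w) i}) := by rw [hv']; simp
      have m1 := (m1.resolve_left (by simpa using hne)).1
      have m2 := (m2.resolve_left (by simpa using Ne.symm hne)).1
      exact lt_asymm (inr_mem_father.1 m1).2 (inr_mem_father.1 m2).2
    subst h1
    have hnot : (Sum.inr w : Fin r ⊕ Fin n) ∉ fatherSet G ν w := by
      simp [inr_mem_father]
    obtain ⟨hinj, hran⟩ := he _ (h.1.ncard w)
    have hmem : e (fatherSet G ν w) i ∈ fatherSet G ν w := by
      exact hran.subset ⟨i, rfl⟩
    have : i = i' := by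
      by_contra hne
      have : e (fatherSet G ν w) i ∈ insert (Sum.inr w)
          (fatherSet G ν w \ {e (fatherSet G ν w) i}) := by
        rw [hv']
        exact Or.inr ⟨hmem, fun hc => hne (hinj hc)⟩
      rcases this with h1 | h1
      · exact hnot (h1 ▸ hmem)
      · exact h1.2 rfl
    rw [this]

lemma RTRel.unique_G (hn : 0 < n) {e : Set (Fin r ⊕ Fin n) → Fin r → Fin r ⊕ Fin n}
    {f : Fin n → Unit ⊕ Fin n × Fin r} {G G' : SimpleGraph (Fin r ⊕ Fin n)}
    {ν ν' : Equiv.Perm (Fin n)}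
    (h : RTRel e f G ν) (h' : RTRel e f G' ν') : G = G' := by
  have hF : fatherSet G ν = fatherSet G' ν' := by
    funext v
    induction v using pos_induction ν with
    | h v ih =>
    rw [h.2.2, h'.2.2]
    rcases hf : f v with ⟨⟩ | ⟨w, i⟩
    · rfl
    · simp only [cliq]
      rw [ih w (h.2.1 v w i hf)]
  ext a b
  rw [adj_iff hn h.1, adj_iff hn h'.1, hF]

lemma exists_f {e : Set (Fin r ⊕ Fin n) → Fin r → Fin r ⊕ Fin n} (he : GoodE e)
    {G : SimpleGraph (Fin r ⊕ Fin n)} {ν : Equiv.Perm (Fin n)} (h : IsValidRearrangement G ν) :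
    ∃ f, RTRel e f G ν := by
  have : ∀ v, ∃ c : Unit ⊕ Fin n × Fin r, (∀ w i, c = Sum.inr (w, i) → ν.symm w < ν.symm v) ∧
      fatherSet G ν v = cliq e (fatherSet G ν) c := by
    intro v
    by_cases hO : fatherSet G ν v ⊆ Set.range Sum.inl
    · refine ⟨Sum.inl (), by simp, ?_⟩
      simp only [cliq]
      exact Set.eq_of_subset_of_ncard_le hO (by rw [h.ncard, ncard_inl]) (Set.toFinite _)
    · have hne : {u : Fin n | Sum.inr u ∈ fatherSet G ν v}.Nonempty := by
        rw [Set.not_subset] at hO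
        obtain ⟨(o | u), hu, hu'⟩ := hO
        · simp at hu'
        · exact ⟨u, hu⟩
      obtain ⟨u, hu, hmax⟩ := Set.exists_max_image _ ν.symm (Set.toFinite _) hne
      have hu : Sum.inr u ∈ fatherSet G ν v := hu
      have hsub : fatherSet G ν v \ {Sum.inr u} ⊆ fatherSet G ν u := by
        rintro x ⟨hx, hxu⟩
        have hadj : G.Adj (Sum.inr u) x := (h v).2 hu hx (fun hc => hxu hc.symm)
        rcases x with o | x
        · exact inl_mem_father.2 hadj
        · refine inr_mem_father.2 ⟨hadj, lt_of_le_of_ne (hmax x hx) ?_⟩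
          intro hc
          exact hxu (by rw [ν.symm.injective hc]; rfl)
      have hcard : (fatherSet G ν v \ {Sum.inr u}).ncard + 1 = r := by
        rw [Set.ncard_sdiff_singleton_add_one hu, h.ncard]
      have hss : (fatherSet G ν v \ {Sum.inr u}).ncard < (fatherSet G ν u).ncard := by
        rw [h.ncard]; omega
      obtain ⟨x, hx, hx'⟩ := Set.exists_mem_notMem_of_ncard_lt_ncard hss
      obtain ⟨hinj, hran⟩ := he _ (h.ncard u)
      obtain ⟨i, rfl⟩ : x ∈ Set.range (e (fatherSet G ν u)) := by rw [hran]; exact hx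
      refine ⟨Sum.inr (u, i), ?_, ?_⟩
      · rintro w j hc
        simp only [Sum.inr.injEq, Prod.mk.injEq] at hc
        obtain ⟨rfl, rfl⟩ := hc
        exact (inr_mem_father.1 hu).2
      · simp only [cliq]
        have : fatherSet G ν v \ {Sum.inr u} = fatherSet G ν u \ {e (fatherSet G ν u) i} := by
          refine Set.eq_of_subset_of_ncard_le ?_ ?_ (Set.toFinite _)
          · intro y hy
            refine ⟨hsub hy, ?_⟩
            rintro rfl
            exact hx' hy
          · have := Set.ncard_sdiff_singleton_add_one hx
            rw [h.ncard] at this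
            omega
        rw [← this, Set.insert_sdiff_singleton, Set.insert_eq_of_mem hu]
  choose f hf using this
  exact ⟨f, h, fun v w i hv => (hf v).1 w i hv, fun v => (hf v).2⟩

lemma exists_F (e : Set (Fin r ⊕ Fin n) → Fin r → Fin r ⊕ Fin n)
    (f : Fin n → Unit ⊕ Fin n × Fin r) (ν : Equiv.Perm (Fin n))
    (hν : ∀ v w i, f v = Sum.inr (w, i) → ν.symm w < ν.symm v) :
    ∃ F : Fin n → Set (Fin r ⊕ Fin n), ∀ v, F v = cliq e F (f v) := by
  let I : ℕ → Fin n → Set (Fin r ⊕ Fin n) := fun k =>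
    Nat.rec (fun _ => ∅) (fun _ F v => cliq e F (f v)) k
  have hI : ∀ k v, I (k + 1) v = cliq e (I k) (f v) := fun _ _ => rfl
  have hst : ∀ v k, (ν.symm v).1 < k → I (k + 1) v = I k v := by
    intro v
    induction v using pos_induction ν with
    | h v ih =>
    intro k hk
    obtain ⟨k, rfl⟩ : ∃ j, k = j + 1 := ⟨k - 1, by omega⟩
    rw [hI (k + 1), hI k]
    rcases hf : f v with ⟨⟩ | ⟨w, i⟩
    · rfl
    · have hlt := hν v w i hf
      simp only [cliq]
      rw [ih w hlt k (by have := Fin.lt_def.1 hlt; omega)]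
  refine ⟨I n, fun v => ?_⟩
  rw [← hI, hst v n (ν.symm v).2]

lemma exists_G {e : Set (Fin r ⊕ Fin n) → Fin r → Fin r ⊕ Fin n} (he : GoodE e)
    {f : Fin n → Unit ⊕ Fin n × Fin r} (h : Acyc f) : ∃ G ν, RTRel e f G ν := by
  obtain ⟨ρ, hρ⟩ := h
  obtain ⟨ν, hν⟩ : ∃ ν : Equiv.Perm (Fin n),
      ∀ v w i, f v = Sum.inr (w, i) → ν.symm w < ν.symm v := by
    refine ⟨Tuple.sort ρ, fun v w i hf => ?_⟩
    by_contra hc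
    have := Tuple.monotone_sort ρ (not_lt.1 hc)
    simp at this
    exact absurd (hρ v w i hf) (by omega)
  obtain ⟨F, hF⟩ := exists_F e f ν hν
  have hearly : ∀ v u, Sum.inr u ∈ F v → ν.symm u < ν.symm v := by
    intro v
    induction v using pos_induction ν with
    | h v ih =>
    intro u hu
    rw [hF] at hu
    rcases hf : f v with ⟨⟩ | ⟨w, i⟩ <;> rw [hf] at hu <;> simp only [cliq] at hu
    · simp at hu
    · have hlt := hν v w i hf
      rcases hu with hu | hu
      · rw [Sum.inr_injective hu]; exact hlt
      · exact (ih w hlt u hu.1).trans hlt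
  have hcard : ∀ v, (F v).ncard = r := by
    intro v
    induction v using pos_induction ν with
    | h v ih =>
    rw [hF]
    rcases hf : f v with ⟨⟩ | ⟨w, i⟩
    · exact ncard_inl
    · have hlt := hν v w i hf
      obtain ⟨hinj, hran⟩ := he _ (ih w hlt)
      have hmem : e (F w) i ∈ F w := by
        exact hran.subset ⟨i, rfl⟩
      simp only [cliq]
      rw [Set.ncard_insert_of_notMem, Set.ncard_sdiff_singleton_add_one hmem, ih w hlt]
      intro hc
      exact lt_irrefl _ (hearly w w hc.1)
  let G : SimpleGraph (Fin r ⊕ Fin n) := SimpleGraph.fromRel (fun a b =>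
    (a ∈ Set.range Sum.inl ∧ b ∈ Set.range Sum.inl) ∨ ∃ v, a = Sum.inr v ∧ b ∈ F v)
  have hadj : ∀ v b, b ∈ F v → G.Adj (Sum.inr v) b := by
    intro v b hb
    refine (SimpleGraph.fromRel_adj _ _ _).2 ⟨?_, Or.inl (Or.inr ⟨v, rfl, hb⟩)⟩
    rintro rfl
    exact lt_irrefl _ (hearly v v hb)
  have hfs : fatherSet G ν = F := by
    funext v
    ext b
    constructor
    · rintro ⟨hb, hb'⟩
      obtain ⟨-, hb⟩ := (SimpleGraph.fromRel_adj _ _ _).1 hb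
      rcases hb with (hb | ⟨u, hu, hb⟩) | (hb | ⟨u, rfl, hbu⟩)
      · simp at hb
      · rw [Sum.inr_injective hu]; exact hb
      · simp at hb
      · exfalso
        rcases hb' with ⟨o, ho⟩ | ⟨u', hu', hlt⟩
        · simp at ho
        · rw [← Sum.inr_injective hu'] at hlt
          exact lt_asymm hlt (hearly _ _ hbu)
    · intro hb
      refine ⟨hadj v b hb, ?_⟩
      rcases b with o | u
      · exact Or.inl ⟨o, rfl⟩
      · exact Or.inr ⟨u, rfl, hearly v u hb⟩
  have hcl : ∀ v, G.IsClique (F v) := by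
    intro v
    induction v using pos_induction ν with
    | h v ih =>
    rw [hF]
    rcases hf : f v with ⟨⟩ | ⟨w, i⟩
    · intro a ha b hb hab
      exact (SimpleGraph.fromRel_adj _ _ _).2 ⟨hab, Or.inl (Or.inl ⟨ha, hb⟩)⟩
    · simp only [cliq]
      refine SimpleGraph.IsClique.insert ((ih w (hν v w i hf)).subset Set.sdiff_subset) ?_
      intro b hb _
      exact hadj w b hb.1
  refine ⟨G, ν, ?_, hν, ?_⟩
  · intro v
    rw [hfs]
    exact ⟨hcard v, hcl v⟩
  · rw [hfs]; exact hF

end trees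

/-- The number of `O`-rooted labeled `r`-trees on `O ∪ V` with `|O| = r` and `|V| = n` is
`(rn+1)^(n-1)`. -/
theorem card_o_rooted_r_trees (r n : ℕ) (hr : 0 < r) (hn : 0 < n) :
    Nat.card {G : SimpleGraph (Fin r ⊕ Fin n) // IsORootedRTree G} =
      (r * n + 1) ^ (n - 1) := by
  obtain ⟨e, he⟩ := exists_goodE (r := r) (n := n)
  have hcount := card_acyc_aux (Fin r) n (Fin n) Unit (by simp)
  rw [if_neg (by omega)] at hcount
  have h1 : ∀ G : {G : SimpleGraph (Fin r ⊕ Fin n) // IsORootedRTree G},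
      ∃ f : {f : Fin n → Unit ⊕ Fin n × Fin r // Acyc f}, ∃ ν, RTRel e f.1 G.1 ν := by
    rintro ⟨G, ν, hG⟩
    obtain ⟨f, hf⟩ := exists_f he hG
    exact ⟨⟨f, hf.acyc⟩, ν, hf⟩
  choose Φ ν hΦ using h1
  have hbij : Function.Bijective Φ := by
    constructor
    · intro G G' hGG
      have h1 := hΦ G
      have h2 := hΦ G'
      rw [← hGG] at h2
      exact Subtype.ext (RTRel.unique_G hn h1 h2)
    · rintro ⟨f, hf⟩
      obtain ⟨G, ν', hG⟩ := exists_G he hf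
      refine ⟨⟨G, ν', hG.1⟩, Subtype.ext ?_⟩
      exact RTRel.unique_f he (hΦ _) hG
  rw [Nat.card_eq_of_bijective Φ hbij, hcount]
  simp [add_comm]
end

section
/- For all positive integers r and n, the number of r-parking functions of length n is (rn+1)^{n−1}. -/
/-- An `r`-parking function of length `n` (0-indexed): a sequence of nonnegative integers
whose nondecreasing rearrangement `a₀ ≤ a₁ ≤ ⋯ ≤ a_{n-1}` satisfies `aᵢ ≤ r·i`. -/
def IsRParkingFunction (r n : ℕ) (α : Fin n → ℕ) : Prop :=
  ∃ σ : Equiv.Perm (Fin n), Monotone (α ∘ σ) ∧ ∀ i : Fin n, α (σ i) ≤ r * i.val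

open Finset in
theorem rpf_iff (r n : ℕ) (hr : 0 < r) (α : Fin n → ℕ) :
    IsRParkingFunction r n α ↔
      ∀ m ≤ r * n, m ≤ r * (univ.filter (fun i => α i < m)).card := by
  constructor
  · rintro ⟨σ, -, h⟩ m hm
    by_contra! hlt
    set c := (univ.filter (fun i => α i < m)).card with hc
    have hcn : c < n := by
      by_contra! h1
      have := Nat.mul_le_mul_left r h1
      omega
    have hsub : (Finset.Iic (⟨c, hcn⟩ : Fin n)).map σ.toEmbedding ⊆
        univ.filter (fun i => α i < m) := by
      intro x hx
      simp only [Finset.mem_map, Finset.mem_Iic] at hx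
      obtain ⟨j, hj, rfl⟩ := hx
      simp only [Finset.mem_filter, Finset.mem_univ, true_and]
      have h1 : j.val ≤ c := hj
      have h2 := Nat.mul_le_mul_left r h1
      have h3 := h j
      simp only [Equiv.coe_toEmbedding]
      omega
    have := Finset.card_le_card hsub
    rw [Finset.card_map, Fin.card_Iic] at this
    simp only at this
    omega
  · intro h
    refine ⟨Tuple.sort α, Tuple.monotone_sort α, fun i => ?_⟩
    by_contra! hlt
    have hin : r * i.val + 1 ≤ r * n := by
      have := Nat.mul_le_mul_left r (Nat.succ_le_of_lt i.isLt)
      rw [Nat.mul_succ] at this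
      omega
    have h1 := h _ hin
    have hsub : univ.filter (fun j => α j < r * i.val + 1) ⊆
        (Finset.Iio i).map (Tuple.sort α).toEmbedding := by
      intro x hx
      simp only [Finset.mem_filter, Finset.mem_univ, true_and] at hx
      simp only [Finset.mem_map, Finset.mem_Iio, Equiv.coe_toEmbedding]
      refine ⟨(Tuple.sort α).symm x, ?_, by simp⟩
      by_contra! hle
      have := Tuple.monotone_sort α hle
      simp only [Function.comp, Equiv.apply_symm_apply] at this
      omega
    have h2 := Finset.card_le_card hsub
    rw [Finset.card_map, Fin.card_Iio] at h2
    have := Nat.mul_le_mul_left r h2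
    omega

theorem cycle_lem (N : ℕ) (hN : 0 < N) (P : ℕ → ℤ) (hP : ∀ t, P (t + N) = P t - 1) :
    ∃! s, s < N ∧ ∀ m < N, P s ≤ P (s + m) := by
  have huniq : ∀ s s', s < N → s' < N → (∀ m < N, P s ≤ P (s + m)) →
      (∀ m < N, P s' ≤ P (s' + m)) → ¬ s < s' := by
    intro s s' hs hs' h h' hlt
    have h1 := h (s' - s) (by omega)
    have h2 := h' (s + N - s') (by omega)
    rw [show s + (s' - s) = s' by omega] at h1
    rw [show s' + (s + N - s') = s + N by omega, hP] at h2
    omega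
  obtain ⟨t, ht, hmin⟩ := Finset.exists_min_image (Finset.range N) P ⟨0, by simpa using hN⟩
  have hex : ∃ s, s < N ∧ ∀ m < N, P s ≤ P m :=
    ⟨t, by simpa using ht, fun m hm => hmin m (by simpa using hm)⟩
  classical
  let s := Nat.find hex
  have hs : s < N ∧ ∀ m < N, P s ≤ P m := Nat.find_spec hex
  have hs2 : ∀ k < s, P s < P k := by
    intro k hk
    by_contra! hle
    exact Nat.find_min hex hk ⟨by omega, fun m hm => hle.trans (hs.2 m hm)⟩
  have hgood : ∀ m < N, P s ≤ P (s + m) := by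
    intro m hm
    by_cases h : s + m < N
    · exact hs.2 _ h
    · have := hs2 (s + m - N) (by omega)
      have h3 := hP (s + m - N)
      rw [show s + m - N + N = s + m by omega] at h3
      omega
  refine ⟨s, ⟨hs.1, hgood⟩, ?_⟩
  rintro s' ⟨h1, h2⟩
  have := huniq s s' hs.1 h1 hgood h2
  have := huniq s' s h1 hs.1 h2 hgood
  omega

open Finset in
theorem count_shift (N n : ℕ) [NeZero N] (f : Fin n → ZMod N) (s m : ℕ) (hm : m ≤ N) :
    ∑ k ∈ range (s + m), (univ.filter (fun i => f i = (k : ZMod N))).card =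
    ∑ k ∈ range s, (univ.filter (fun i => f i = (k : ZMod N))).card +
      (univ.filter (fun i => (f i - (s : ZMod N)).val < m)).card := by
  rw [Finset.sum_range_add]
  congr 1
  symm
  rw [Finset.card_eq_sum_card_fiberwise (f := fun i => (f i - (s : ZMod N)).val) (t := range m)]
  · refine Finset.sum_congr rfl fun k hk => ?_
    have hk : k < m := by simpa using hk
    congr 1
    ext i
    simp only [mem_filter, mem_univ, true_and]
    constructor
    · rintro ⟨_, h⟩
      have := ZMod.natCast_zmod_val (f i - (s : ZMod N))
      rw [h] at this
      push_cast
      rw [this]; ring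
    · intro h
      have : (f i - (s : ZMod N)).val = k := by
        rw [h]; push_cast
        rw [add_sub_cancel_left, ZMod.val_natCast, Nat.mod_eq_of_lt (by omega)]
      exact ⟨by omega, this⟩
  · intro i hi
    simpa using hi

open Finset in
theorem exu (r n N : ℕ) (hN : N = r * n + 1) [NeZero N] (f : Fin n → ZMod N) :
    ∃! s : ZMod N, ∀ m ≤ r * n, m ≤ r * (univ.filter (fun i => (f i - s).val < m)).card := by
  let C : ℕ → ℕ := fun t => ∑ k ∈ range t, (univ.filter (fun i => f i = (k : ZMod N))).card
  have hC : ∀ s m, m ≤ N → C (s + m) = C s +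
      (univ.filter (fun i => (f i - (s : ZMod N)).val < m)).card := count_shift N n f
  have hCN : ∀ t, C (t + N) = C t + n := by
    intro t
    rw [hC t N le_rfl]
    congr 1
    rw [Finset.filter_true_of_mem (fun i _ => ZMod.val_lt _)]
    simp
  obtain ⟨s, ⟨hs, hg⟩, hu⟩ := cycle_lem N (by omega) (fun t => (r : ℤ) * C t - t) (by
    intro t
    simp only [hCN]
    rw [hN]
    push_cast
    ring)
  have key : ∀ s : ℕ, (∀ m < N, (r : ℤ) * C s - s ≤ (r : ℤ) * C (s + m) - ((s + m : ℕ) : ℤ)) ↔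
      ∀ m ≤ r * n, m ≤ r * (univ.filter (fun i => (f i - (s : ZMod N)).val < m)).card := by
    intro s
    refine forall_congr' fun m => ?_
    have : m < N ↔ m ≤ r * n := by omega
    rw [this]
    refine imp_congr_right fun hm => ?_
    rw [hC s m (by omega)]
    push_cast
    rw [mul_add]
    zify
    constructor <;> intro h <;> linarith
  refine ⟨(s : ZMod N), (key s).1 hg, ?_⟩
  intro s' hs'
  have h1 := hu s'.val ⟨ZMod.val_lt _, (key _).2 (by rwa [ZMod.natCast_zmod_val])⟩
  rw [← h1, ZMod.natCast_zmod_val]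

open Finset in
/-- The number of `r`-parking functions of length `n` is `(rn+1)^(n-1)`. -/
theorem card_r_parking_functions (r n : ℕ) (hr : 0 < r) (hn : 0 < n) :
    Nat.card {α : Fin n → ℕ // IsRParkingFunction r n α} = (r * n + 1) ^ (n - 1) := by
  obtain ⟨N, hN⟩ : ∃ N, N = r * n + 1 := ⟨_, rfl⟩
  have : NeZero N := ⟨by omega⟩
  let Q : (Fin n → ZMod N) → Prop := fun g =>
    ∀ m ≤ r * n, m ≤ r * (univ.filter (fun i => (g i).val < m)).card
  have hlt : ∀ α : Fin n → ℕ, IsRParkingFunction r n α → ∀ i, α i < N := by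
    rintro α ⟨σ, -, h⟩ i
    have h1 := h (σ.symm i)
    rw [Equiv.apply_symm_apply] at h1
    have := Nat.mul_le_mul_left r (σ.symm i).isLt.le
    omega
  have hval : ∀ α : Fin n → ℕ, IsRParkingFunction r n α → ∀ i, ((α i : ℕ) : ZMod N).val = α i :=
    fun α h i => by rw [ZMod.val_natCast, Nat.mod_eq_of_lt (hlt α h i)]
  let e1 : {α : Fin n → ℕ // IsRParkingFunction r n α} ≃ {g : Fin n → ZMod N // Q g} :=
    { toFun := fun α => ⟨fun i => (α.1 i : ZMod N), by
        have := (rpf_iff r n hr α.1).1 α.2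
        simpa only [Q, hval α.1 α.2] using this⟩
      invFun := fun g => ⟨fun i => (g.1 i).val, (rpf_iff r n hr _).2 g.2⟩
      left_inv := fun α => Subtype.ext (funext fun i => hval α.1 α.2 i)
      right_inv := fun g => Subtype.ext (funext fun i => ZMod.natCast_zmod_val _) }
  choose S hS hSu using fun f : Fin n → ZMod N => exu r n N hN f
  let e2 : (Fin n → ZMod N) ≃ {g : Fin n → ZMod N // Q g} × ZMod N :=
    { toFun := fun f => (⟨fun i => f i - S f, hS f⟩, S f)
      invFun := fun p => fun i => p.1.1 i + p.2
      left_inv := fun f => by ext i; simp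
      right_inv := fun p => by
        obtain ⟨⟨g, hg⟩, s⟩ := p
        have : s = S (fun i => g i + s) := hSu _ s (by simpa [Q] using hg)
        simp only [← this, add_sub_cancel_right] }
  have hcard := Nat.card_congr e2
  rw [Nat.card_prod, ← Nat.card_congr e1, Nat.card_fun, Nat.card_zmod, Nat.card_fin] at hcard
  rw [← hN]
  obtain ⟨k, rfl⟩ : ∃ k, n = k + 1 := ⟨n - 1, by omega⟩
  rw [pow_succ] at hcard
  exact (Nat.eq_of_mul_eq_mul_right (by omega) hcard).symm
end

section
/- For all positive integers r and n, the r-Catalan arrangement C_n^r has exactly n!·C(n,r) regions, where C(n,r) = (1/(rn+1))·binom(rn+n, n) is the Fuss–Catalan number; equivalently, (rn+1) times the number of connected components of the complement of C_n^r equals n!·binom(rn+n, n). -/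
/-- The complement of the `r`-Catalan arrangement in `ℝⁿ`: the set of points avoiding all
hyperplanes `x i - x j = s` for `i < j` and `s ∈ {0, ±1, …, ±r}`. -/
def catalanArrangementCompl (r n : ℕ) : Set (Fin n → ℝ) :=
  {x | ∀ i j : Fin n, i < j → ∀ s : ℤ, -(r : ℤ) ≤ s → s ≤ r → x i - x j ≠ (s : ℝ)}

namespace CatArr

/-! ### Counting sequences -/

def IsCode (r m k : ℕ) (c : Fin m → ℕ) : Prop :=
  (∀ h : 0 < m, c ⟨0, h⟩ ≤ k) ∧
    ∀ i (h : i + 1 < m), c ⟨i + 1, h⟩ ≤ c ⟨i, by omega⟩ + r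

def codeEquiv (r m k : ℕ) : {c : Fin (m+1) → ℕ // IsCode r (m+1) k c} ≃
    Σ j : Fin (k+1), {c : Fin m → ℕ // IsCode r m (j + r) c} where
  toFun c := ⟨⟨c.1 0, by have := c.2.1 (by omega); simp at this; omega⟩,
    ⟨fun i => c.1 i.succ, by
      refine ⟨fun h => ?_, fun i h => ?_⟩
      · exact c.2.2 0 (by omega)
      · exact c.2.2 (i+1) (by omega)⟩⟩
  invFun p := ⟨Fin.cons (p.1 : ℕ) p.2.1, by
      refine ⟨fun h => ?_, fun i h => ?_⟩
      · have := p.1.2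
        show (p.1 : ℕ) ≤ k
        omega
      · rcases i with _ | i
        · exact p.2.2.1 (by omega)
        · exact p.2.2.2 i (by omega)⟩
  left_inv c := by
    apply Subtype.ext
    exact Fin.cons_self_tail c.1
  right_inv p := by
    rcases p with ⟨j, c, hc⟩
    rfl

theorem code_finite (r m : ℕ) : ∀ k, Finite {c : Fin m → ℕ // IsCode r m k c} := by
  induction m with
  | zero => intro k; infer_instance
  | succ m ih => intro k; exact Finite.of_equiv _ (codeEquiv r m k).symm

theorem code_card_succ (r m k : ℕ) : Nat.card {c : Fin (m+1) → ℕ // IsCode r (m+1) k c} =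
    ∑ j ∈ Finset.range (k+1), Nat.card {c : Fin m → ℕ // IsCode r m (j + r) c} := by
  have := code_finite r m
  rw [Nat.card_congr (codeEquiv r m k), Nat.card_sigma,
    Finset.sum_range (fun j => Nat.card {c : Fin m → ℕ // IsCode r m (j + r) c})]

theorem code_card_zero (r k : ℕ) : Nat.card {c : Fin 0 → ℕ // IsCode r 0 k c} = 1 := by
  rw [Nat.card_eq_one_iff_unique]
  exact ⟨inferInstance, ⟨⟨fun i => i.elim0, fun h => by omega, fun i h => by omega⟩⟩⟩

theorem code_card (r m : ℕ) : ∀ k, (Nat.card {c : Fin (m+1) → ℕ // IsCode r (m+1) k c} : ℤ) =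
    ((r+1)*(m+1)+k).choose (m+1) - r * ((r+1)*(m+1)+k).choose m := by
  induction m with
  | zero =>
    intro k
    rw [code_card_succ]
    simp [code_card_zero]
    ring
  | succ m ih =>
    intro k
    induction k with
    | zero =>
      rw [code_card_succ]
      simp only [zero_add, Finset.sum_range_one]
      rw [ih]
      have e : (r+1)*(m+1+1)+0 = ((r+1)*(m+1)+r)+1 := by ring
      rw [e, Nat.choose_succ_succ, Nat.choose_succ_succ]
      have h := Nat.choose_succ_right_eq ((r+1)*(m+1)+r) (m+1)
      have e2 : (r+1)*(m+1)+r - (m+1) = r * (m+1+1) := by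
        have : (r+1)*(m+1)+r = r * (m+1+1) + (m+1) := by ring
        omega
      rw [e2, ← mul_assoc] at h
      have h2 := Nat.eq_of_mul_eq_mul_right (by omega) h
      simp only [Nat.succ_eq_add_one, Nat.cast_add]
      rw [h2]
      push_cast
      ring
    | succ k ihk =>
      rw [code_card_succ, Finset.sum_range_succ, ← code_card_succ, Nat.cast_add, ihk, ih]
      have e : (r+1)*(m+1+1)+(k+1) = ((r+1)*(m+1)+(k+1+r))+1 := by ring
      have e' : (r+1)*(m+1+1)+k = ((r+1)*(m+1)+(k+1+r)) := by ring
      rw [e, e', Nat.choose_succ_succ, Nat.choose_succ_succ]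
      push_cast
      ring

theorem code_card_final (r n : ℕ) (hn : 0 < n) :
    (r * n + 1) * Nat.card {c : Fin n → ℕ // IsCode r n 0 c} = (r * n + n).choose n := by
  obtain ⟨m, rfl⟩ : ∃ m, n = m + 1 := ⟨n - 1, by omega⟩
  have h := code_card r m 0
  have e : (r+1)*(m+1)+0 = r * (m+1) + (m+1) := by ring
  rw [e] at h
  have h1 := Nat.choose_succ_right_eq (r * (m+1) + (m+1)) m
  have e2 : r * (m+1) + (m+1) - m = r * (m+1) + 1 := by omega
  rw [e2] at h1
  zify at h1 ⊢
  rw [h]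
  linear_combination (r:ℤ) * h1

/-! ### Gap lemma -/

theorem gap (T : Finset ℝ) (a : ℝ) (k : ℕ) (hk : k ≤ (T.filter (fun u => a < u)).card) :
    ∃ t, a < t ∧ t ∉ T ∧ (T.filter (fun u => t < u)).card = k := by
  induction k with
  | zero =>
    obtain ⟨M, hM⟩ := (insert a T).bddAbove
    have hM' : ∀ u ∈ insert a T, u ≤ M := fun u hu => hM hu
    refine ⟨M + 1, ?_, ?_, ?_⟩
    · have := hM' a (by simp); linarith
    · intro h; have := hM' (M+1) (by simp [h]); linarith
    · rw [Finset.card_eq_zero, Finset.filter_eq_empty_iff]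
      intro u hu
      have := hM' u (by simp [hu]); linarith
  | succ k ih =>
    obtain ⟨t, hat, htT, hc⟩ := ih (by omega)
    have hne : (T.filter (fun u => a < u ∧ u < t)).Nonempty := by
      by_contra hcon
      rw [Finset.not_nonempty_iff_eq_empty, Finset.filter_eq_empty_iff] at hcon
      have : T.filter (fun u => a < u) ⊆ T.filter (fun u => t < u) := by
        intro u hu
        simp only [Finset.mem_filter] at hu ⊢
        refine ⟨hu.1, ?_⟩
        have h1 : ¬ u < t := fun h => hcon hu.1 ⟨hu.2, h⟩
        exact lt_of_le_of_ne (not_lt.1 h1) (fun h => htT (h ▸ hu.1))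
      have := Finset.card_le_card this
      omega
    set B := T.filter (fun u => a < u ∧ u < t) with hB
    set m := B.max' hne with hm
    have hmB : m ∈ B := B.max'_mem hne
    have hmax : ∀ u ∈ B, u ≤ m := fun u hu => B.le_max' u hu
    rw [hB, Finset.mem_filter] at hmB
    obtain ⟨hmT, ham, hmt⟩ := hmB
    set D := insert a (T.filter (fun u => u < m)) with hD
    have hDne : D.Nonempty := ⟨a, by simp [hD]⟩
    set b := D.max' hDne with hb
    have hbm : b < m := by
      rw [hb, Finset.max'_lt_iff]
      intro u hu
      simp only [hD, Finset.mem_insert, Finset.mem_filter] at hu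
      rcases hu with rfl | hu
      · exact ham
      · exact hu.2
    have hDb : ∀ u ∈ D, u ≤ b := fun u hu => D.le_max' u hu
    have hab : a ≤ b := hDb a (by simp [hD])
    have hTb : ∀ u ∈ T, u < m → u ≤ b := fun u hu h => hDb u (by simp [hD, hu, h])
    refine ⟨(b + m)/2, by linarith, ?_, ?_⟩
    · intro h
      have := hTb _ h (by linarith)
      linarith
    · have : T.filter (fun u => (b+m)/2 < u) = insert m (T.filter (fun u => t < u)) := by
        ext u
        simp only [Finset.mem_filter, Finset.mem_insert]
        constructor
        · rintro ⟨hu, h⟩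
          by_cases h1 : u < m
          · have := hTb u hu h1; linarith
          by_cases h2 : u < t
          · left
            apply le_antisymm _ (not_lt.1 h1)
            apply hmax
            rw [hB, Finset.mem_filter]
            exact ⟨hu, by linarith, h2⟩
          · right
            exact ⟨hu, lt_of_le_of_ne (not_lt.1 h2) (fun h => htT (h ▸ hu))⟩
        · rintro (rfl | ⟨hu, h⟩)
          · exact ⟨hmT, by linarith⟩
          · exact ⟨hu, by linarith⟩
      rw [this, Finset.card_insert_of_notMem, hc]
      simp only [Finset.mem_filter, not_and, not_lt]
      intro _; exact hmt.le

/-! ### Sorted points -/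

def Good (r m : ℕ) (x : ℕ → ℝ) : Prop :=
  ∀ i j, i < j → j < m → x i < x j ∧ ∀ s : ℕ, s ≤ r → x i + s ≠ x j

def pts (r : ℕ) (j : ℕ) : Finset (ℕ × ℕ) := Finset.range j ×ˢ Finset.Icc 1 r

noncomputable def cnt (r : ℕ) (x : ℕ → ℝ) (j : ℕ) : ℕ :=
  ((pts r j).filter (fun p => x j < x p.1 + p.2)).card

theorem cnt_zero (r : ℕ) (x : ℕ → ℝ) : cnt r x 0 = 0 := by simp [cnt, pts]

theorem cnt_aux (r : ℕ) (x : ℕ → ℝ) (j : ℕ) :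
    ((pts r (j+1)).filter (fun p => x j < x p.1 + p.2)).card = cnt r x j + r := by
  have : (pts r (j+1)).filter (fun p => x j < x p.1 + p.2) =
      (pts r j).filter (fun p => x j < x p.1 + p.2) ∪ ({j} ×ˢ Finset.Icc 1 r) := by
    ext ⟨i, s⟩
    simp only [pts, Finset.mem_filter, Finset.mem_union, Finset.mem_product, Finset.mem_range,
      Finset.mem_Icc, Finset.mem_singleton]
    constructor
    · rintro ⟨⟨h1, h2⟩, h3⟩
      rcases Nat.lt_succ_iff_lt_or_eq.1 h1 with h | h
      · exact Or.inl ⟨⟨h, h2⟩, h3⟩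
      · exact Or.inr ⟨h, h2⟩
    · rintro (⟨⟨h1, h2⟩, h3⟩ | ⟨rfl, h2⟩)
      · exact ⟨⟨by omega, h2⟩, h3⟩
      · refine ⟨⟨by omega, h2⟩, ?_⟩
        have : (1:ℝ) ≤ s := by exact_mod_cast h2.1
        linarith
  rw [this, Finset.card_union_of_disjoint]
  · simp [cnt]
  · rw [Finset.disjoint_left]
    rintro ⟨i, s⟩ h1 h2
    simp [pts] at h1 h2
    omega

theorem cnt_succ_le (r m : ℕ) (x : ℕ → ℝ) (hx : Good r m x) (j : ℕ) (hj : j + 1 < m) :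
    cnt r x (j+1) ≤ cnt r x j + r := by
  rw [← cnt_aux]
  apply Finset.card_le_card
  intro p hp
  simp only [Finset.mem_filter] at hp ⊢
  refine ⟨hp.1, ?_⟩
  have := (hx j (j+1) (by omega) hj).1
  linarith

/-- comparison of points -/
theorem Good.inj {r m : ℕ} {x : ℕ → ℝ} (hx : Good r m x) {p q : ℕ × ℕ} (hp : p ∈ pts r m)
    (hq : q ∈ pts r m) (h : x p.1 + p.2 = x q.1 + q.2) : p = q := by
  rcases p with ⟨i, s⟩
  rcases q with ⟨j, t⟩
  simp only [pts, Finset.mem_product, Finset.mem_range, Finset.mem_Icc] at hp hq h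
  wlog hij : i ≤ j generalizing i j s t
  · refine (this j t i s ?_ ?_ ?_ ?_).symm <;> first | assumption | exact h.symm | omega
  rcases hij.eq_or_lt with rfl | hij
  · have : (s:ℝ) = t := by linarith
    have : s = t := by exact_mod_cast this
    rw [this]
  · exfalso
    obtain ⟨h1, h2⟩ := hx i j hij hq.1
    have hlt : (t:ℝ) < s := by linarith
    have hlt : t < s := by exact_mod_cast hlt
    apply h2 (s - t) (by omega)
    rw [Nat.cast_sub hlt.le]
    linarith

theorem exists_good (r : ℕ) (c : ℕ → ℕ) (h0 : c 0 = 0) (n : ℕ)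
    (h : ∀ i, i + 1 < n → c (i+1) ≤ c i + r) :
    ∃ x, Good r n x ∧ ∀ j < n, cnt r x j = c j := by
  induction n with
  | zero => exact ⟨fun _ => 0, fun i j _ h => by omega, fun j h => by omega⟩
  | succ n ih =>
    obtain ⟨x, hx, hc⟩ := ih (fun i hi => h i (by omega))
    obtain ⟨t, ht1, ht2, ht3⟩ : ∃ t, (∀ i < n, x i < t) ∧
        (∀ p ∈ pts r n, x p.1 + p.2 ≠ t) ∧
        ((pts r n).filter (fun p => t < x p.1 + p.2)).card = c n := by
      rcases n with _ | n
      · exact ⟨0, fun i hi => by omega, fun p hp => by simp [pts] at hp, by simp [pts, h0]⟩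
      set T := (pts r (n+1)).image (fun p => x p.1 + p.2) with hT
      have hinj : Set.InjOn (fun p : ℕ × ℕ => x p.1 + p.2) (pts r (n+1)) :=
        fun p hp q hq hpq => hx.inj hp hq hpq
      have hcard : ∀ t, (T.filter (fun u => t < u)).card =
          ((pts r (n+1)).filter (fun p => t < x p.1 + p.2)).card := by
        intro t
        rw [hT, Finset.filter_image, Finset.card_image_of_injOn]
        exact hinj.mono (by intro p hp; exact (Finset.mem_filter.1 hp).1)
      obtain ⟨t, h1, h2, h3⟩ := gap T (x n) (c (n+1)) (by
        rw [hcard, cnt_aux, hc n (by omega)]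
        exact h n (by omega))
      refine ⟨t, ?_, ?_, ?_⟩
      · intro i hi
        rcases Nat.lt_succ_iff_lt_or_eq.1 hi with h | rfl
        · exact (hx i n h (by omega)).1.trans h1
        · exact h1
      · intro p hp he
        exact h2 (hT ▸ Finset.mem_image.2 ⟨p, hp, he⟩)
      · rw [← hcard, h3]
    refine ⟨Function.update x n t, ?_, ?_⟩
    · intro i j hij hj
      rw [Function.update_of_ne (by omega)]
      rcases Nat.lt_succ_iff_lt_or_eq.1 hj with h | rfl
      · rw [Function.update_of_ne (by omega)]
        exact hx i j hij h
      · rw [Function.update_self]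
        refine ⟨ht1 i hij, fun s hs => ?_⟩
        rcases Nat.eq_zero_or_pos s with rfl | h
        · have := ht1 i hij
          simp; exact this.ne
        · exact ht2 (i, s) (by simp [pts, hij, hs]; omega)
    · intro j hj
      rcases Nat.lt_succ_iff_lt_or_eq.1 hj with h | rfl
      · rw [← hc j h]
        unfold cnt
        congr 1
        apply Finset.filter_congr
        intro p hp
        simp only [pts, Finset.mem_product, Finset.mem_range] at hp
        rw [Function.update_of_ne (by omega), Function.update_of_ne (by omega)]
      · rw [← ht3]
        unfold cnt
        congr 1
        apply Finset.filter_congr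
        intro p hp
        simp only [pts, Finset.mem_product, Finset.mem_range] at hp
        rw [Function.update_self, Function.update_of_ne (by omega)]

theorem signs_of_cnt (r m : ℕ) (x y : ℕ → ℝ) (hx : Good r m x) (hy : Good r m y)
    (h : ∀ j < m, cnt r x j = cnt r y j) : ∀ j < m, ∀ i < j, ∀ s ≤ r,
      (x i + s < x j ↔ y i + s < y j) := by
  intro j
  induction j using Nat.strong_induction_on with
  | _ j ih =>
  intro hj
  -- weak comparison of points below `j`
  have key : ∀ p ∈ pts r j, ∀ q ∈ pts r j, x p.1 + p.2 < x q.1 + q.2 →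
      y p.1 + p.2 < y q.1 + q.2 := by
    rintro ⟨i, s⟩ hp ⟨k, t⟩ hq hlt
    simp only [pts, Finset.mem_product, Finset.mem_range, Finset.mem_Icc] at hp hq hlt ⊢
    rcases lt_trichotomy i k with hik | rfl | hik
    · rcases le_or_gt t s with hts | hts
      · have := ih k hq.1 (by omega) i hik (s - t) (by omega)
        rw [Nat.cast_sub hts] at this
        have := this.1 (by linarith)
        linarith
      · have := (hy i k hik (by omega)).1
        have h2 : (s:ℝ) < t := by exact_mod_cast hts
        linarith
    · linarith
    · rcases le_or_gt s t with hts | hts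
      · have h1 := ih i hp.1 (by omega) k hik (t - s) (by omega)
        have h2 := (hy k i hik (by omega)).2 (t - s) (by omega)
        rw [Nat.cast_sub hts] at h1 h2
        have h3 : ¬ (y k + ((t:ℝ) - s) < y i) := by
          intro h; have := h1.2 h; linarith
        have := lt_of_le_of_ne (not_lt.1 h3) (Ne.symm h2)
        linarith
      · have := (hx k i hik (by omega)).1
        have h2 : (t:ℝ) < s := by exact_mod_cast hts
        linarith
  have hA : (pts r j).filter (fun p => x j < x p.1 + p.2) =
      (pts r j).filter (fun p => y j < y p.1 + p.2) := by
    have hc := h j hj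
    unfold cnt at hc
    by_cases hsub : (pts r j).filter (fun p => x j < x p.1 + p.2) ⊆
      (pts r j).filter (fun p => y j < y p.1 + p.2)
    · exact Finset.eq_of_subset_of_card_le hsub hc.ge
    · symm
      refine Finset.eq_of_subset_of_card_le ?_ hc.le
      rw [Finset.not_subset] at hsub
      obtain ⟨p, hp, hp'⟩ := hsub
      intro q hq
      simp only [Finset.mem_filter, not_and, not_lt] at hp hp' hq ⊢
      refine ⟨hq.1, ?_⟩
      by_contra hcon
      have h1 := key q hq.1 p hp.1 (by linarith)
      have h2 := hp' hp.1
      linarith [hq.2]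
  intro i hi s hs
  obtain ⟨hx1, hx2⟩ := hx i j hi hj
  obtain ⟨hy1, hy2⟩ := hy i j hi hj
  rcases Nat.eq_zero_or_pos s with rfl | hs0
  · simp [hx1, hy1]
  have hmem : (i, s) ∈ pts r j := by simp [pts, hi, hs]; omega
  have h1 : x j < x i + s ↔ y j < y i + s := by
    have := Finset.ext_iff.1 hA (i, s)
    simpa [hmem] using this
  have hx3 := hx2 s hs
  have hy3 := hy2 s hs
  constructor
  · intro h
    exact lt_of_le_of_ne (not_lt.1 fun h' => by linarith [h1.2 h']) hy3
  · intro h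
    exact lt_of_le_of_ne (not_lt.1 fun h' => by linarith [h1.1 h']) hx3

/-! ### The arrangement -/

theorem mem_compl_iff {r n : ℕ} {x : Fin n → ℝ} : x ∈ catalanArrangementCompl r n ↔
    ∀ i j : Fin n, i ≠ j → ∀ s : ℕ, s ≤ r → x i + s ≠ x j := by
  constructor
  · intro h i j hij s hs he
    rcases lt_or_gt_of_ne hij with hlt | hlt
    · apply h i j hlt (-(s:ℤ)) (by omega) (by omega)
      push_cast; linarith
    · apply h j i hlt (s:ℤ) (by omega) (by omega)
      push_cast; linarith
  · intro h i j hij s hs1 hs2 he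
    rcases le_total 0 s with h0 | h0
    · apply h j i hij.ne' s.toNat (by omega)
      have : ((s.toNat : ℤ) : ℝ) = s := by rw [Int.toNat_of_nonneg h0]
      rw [Int.cast_natCast] at this
      rw [this]; linarith
    · apply h i j hij.ne (-s).toNat (by omega)
      have : (((-s).toNat : ℤ) : ℝ) = ((-s : ℤ) : ℝ) := by rw [Int.toNat_of_nonneg (by omega)]
      rw [Int.cast_natCast] at this
      rw [this]; push_cast; linarith

/-- same signs -/
def SS (r : ℕ) {n : ℕ} (x y : Fin n → ℝ) : Prop :=
  ∀ i j, ∀ s : ℕ, s ≤ r → (x i + s < x j ↔ y i + s < y j)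

/-- the open cell of `x` -/
def cell (r : ℕ) {n : ℕ} (x : Fin n → ℝ) : Set (Fin n → ℝ) :=
  ⋂ i : Fin n, ⋂ j : Fin n, ⋂ s : Fin (r+1),
    {z | (x i + (s:ℕ) < x j → z i + (s:ℕ) < z j) ∧ (x j < x i + (s:ℕ) → z j < z i + (s:ℕ))}

theorem cell_open (r n : ℕ) (x : Fin n → ℝ) : IsOpen (cell r x) := by
  refine isOpen_iInter_of_finite fun i => isOpen_iInter_of_finite fun j =>
    isOpen_iInter_of_finite fun s => ?_
  refine IsOpen.and ?_ ?_
  · by_cases h : x i + (s:ℕ) < x j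
    · simp only [h, forall_const]
      exact isOpen_lt (by fun_prop) (by fun_prop)
    · simp [h]
  · by_cases h : x j < x i + (s:ℕ)
    · simp only [h, forall_const]
      exact isOpen_lt (by fun_prop) (by fun_prop)
    · simp [h]

theorem cell_convex (r n : ℕ) (x : Fin n → ℝ) : Convex ℝ (cell r x) := by
  refine convex_iInter fun i => convex_iInter fun j => convex_iInter fun s => ?_
  intro z hz w hw a b ha hb hab
  simp only [Set.mem_ofPred_eq, Pi.add_apply, Pi.smul_apply, smul_eq_mul] at hz hw ⊢
  have hs : ((s:ℕ):ℝ) = a * (s:ℕ) + b * (s:ℕ) := by rw [← add_mul, hab, one_mul]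
  have main : ∀ p q p' q' : ℝ, p < q → p' < q' → a * p + b * p' < a * q + b * q' := by
    intro p q p' q' h1 h2
    rcases ha.eq_or_lt with rfl | ha
    · have : b = 1 := by linarith
      subst this; linarith
    · have := mul_lt_mul_of_pos_left h1 ha
      have := mul_le_mul_of_nonneg_left h2.le hb
      linarith
  constructor
  · intro h
    have := main _ _ _ _ (hz.1 h) (hw.1 h)
    linarith
  · intro h
    have := main _ _ _ _ (hz.2 h) (hw.2 h)
    linarith

theorem mem_cell {r n : ℕ} {x z : Fin n → ℝ} : z ∈ cell r x ↔
    ∀ i j, ∀ s : ℕ, s ≤ r →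
      (x i + s < x j → z i + s < z j) ∧ (x j < x i + s → z j < z i + s) := by
  simp only [cell, Set.mem_iInter, Set.mem_ofPred_eq]
  constructor
  · intro h i j s hs
    exact h i j ⟨s, by omega⟩
  · intro h i j s
    exact h i j s (by omega)

theorem self_mem_cell (r n : ℕ) (x : Fin n → ℝ) : x ∈ cell r x :=
  mem_cell.2 fun _ _ _ _ => ⟨id, id⟩

theorem cell_subset {r n : ℕ} {x : Fin n → ℝ} (hx : x ∈ catalanArrangementCompl r n) :
    cell r x ⊆ catalanArrangementCompl r n := by
  intro z hz
  rw [mem_cell] at hz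
  rw [mem_compl_iff] at hx ⊢
  intro i j hij s hs
  rcases lt_or_gt_of_ne (hx i j hij s hs) with h | h
  · exact ((hz i j s hs).1 h).ne
  · exact ((hz i j s hs).2 h).ne'

theorem SS_of_mem_cell {r n : ℕ} {x z : Fin n → ℝ} (hx : x ∈ catalanArrangementCompl r n)
    (hz : z ∈ cell r x) : SS r x z := by
  intro i j s hs
  have h := (mem_cell.1 hz i j s hs)
  refine ⟨h.1, fun h2 => ?_⟩
  by_cases hij : i = j
  · subst hij
    have : (0:ℝ) ≤ s := Nat.cast_nonneg s
    linarith
  rcases lt_or_gt_of_ne (mem_compl_iff.1 hx i j hij s hs) with h3 | h3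
  · exact h3
  · linarith [h.2 h3]

theorem mem_cell_of_SS {r n : ℕ} {x z : Fin n → ℝ} (hz : z ∈ catalanArrangementCompl r n)
    (h : SS r x z) : z ∈ cell r x := by
  rw [mem_cell]
  intro i j s hs
  refine ⟨(h i j s hs).1, fun h2 => ?_⟩
  by_cases hij : i = j
  · subst hij; linarith
  rcases lt_or_gt_of_ne (mem_compl_iff.1 hz i j hij s hs) with h3 | h3
  · linarith [(h i j s hs).2 h3]
  · exact h3

theorem inj_of_mem {r n : ℕ} {x : Fin n → ℝ} (hx : x ∈ catalanArrangementCompl r n) :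
    Function.Injective x := by
  intro i j h
  by_contra hij
  exact mem_compl_iff.1 hx i j hij 0 (by omega) (by simpa using h)

theorem sort_strict {r n : ℕ} {x : Fin n → ℝ} (hx : x ∈ catalanArrangementCompl r n) :
    StrictMono (x ∘ Tuple.sort x) :=
  (Tuple.monotone_sort x).strictMono_of_injective ((inj_of_mem hx).comp (Equiv.injective _))

theorem sort_unique {n : ℕ} {x : Fin n → ℝ} {σ : Equiv.Perm (Fin n)} (h : StrictMono (x ∘ σ)) :
    σ = Tuple.sort x := by
  rw [Tuple.eq_sort_iff]
  exact ⟨h.monotone, fun i j hij he => absurd he (h hij).ne⟩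

/-- extension to `ℕ` -/
noncomputable def ext {n : ℕ} (x : Fin n → ℝ) (j : ℕ) : ℝ := if h : j < n then x ⟨j, h⟩ else 0

theorem ext_of_lt {n : ℕ} (x : Fin n → ℝ) {j : ℕ} (h : j < n) : ext x j = x ⟨j, h⟩ := by
  simp [ext, h]

theorem good_sort {r n : ℕ} {x : Fin n → ℝ} (hx : x ∈ catalanArrangementCompl r n) :
    Good r n (ext (x ∘ Tuple.sort x)) := by
  intro i j hij hj
  rw [ext_of_lt _ hj, ext_of_lt _ (hij.trans hj)]
  refine ⟨sort_strict hx (by simpa using hij), fun s hs => ?_⟩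
  apply mem_compl_iff.1 hx _ _ _ s hs
  intro h
  have := (Tuple.sort x).injective h
  simp at this
  omega

noncomputable def code (r : ℕ) {n : ℕ} (x : Fin n → ℝ) (j : Fin n) : ℕ :=
  cnt r (ext (x ∘ Tuple.sort x)) j

theorem isCode_code {r n : ℕ} {x : Fin n → ℝ} (hx : x ∈ catalanArrangementCompl r n) :
    IsCode r n 0 (code r x) :=
  ⟨fun _ => (cnt_zero r _).le, fun i h => cnt_succ_le r n _ (good_sort hx) i h⟩

theorem sort_eq_of_SS {r n : ℕ} {x y : Fin n → ℝ} (hx : x ∈ catalanArrangementCompl r n)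
    (h : SS r x y) : Tuple.sort x = Tuple.sort y := by
  apply sort_unique
  intro i j hij
  have := h (Tuple.sort x i) (Tuple.sort x j) 0 (by omega)
  simp only [Nat.cast_zero, add_zero] at this
  exact this.1 (sort_strict hx hij)

theorem SS.symm {r n : ℕ} {x y : Fin n → ℝ} (h : SS r x y) : SS r y x :=
  fun i j s hs => (h i j s hs).symm

theorem code_eq_of_SS {r n : ℕ} {x y : Fin n → ℝ} (hx : x ∈ catalanArrangementCompl r n)
    (hy : y ∈ catalanArrangementCompl r n) (h : SS r x y) : code r x = code r y := by
  funext j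
  unfold code
  rw [← sort_eq_of_SS hx h]
  unfold cnt
  congr 1
  apply Finset.filter_congr
  rintro ⟨i, s⟩ hp
  simp only [pts, Finset.mem_product, Finset.mem_range, Finset.mem_Icc] at hp ⊢
  rw [ext_of_lt _ j.2, ext_of_lt _ (hp.1.trans j.2), ext_of_lt _ j.2, ext_of_lt _ (hp.1.trans j.2)]
  simp only [Function.comp]
  constructor
  · exact ((mem_cell.1 (mem_cell_of_SS hy h)) _ _ s hp.2.2).2
  · exact ((mem_cell.1 (mem_cell_of_SS hx h.symm)) _ _ s hp.2.2).2

theorem SS_of_code_eq {r n : ℕ} {x y : Fin n → ℝ} (hx : x ∈ catalanArrangementCompl r n)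
    (hy : y ∈ catalanArrangementCompl r n) (hs : Tuple.sort x = Tuple.sort y)
    (hc : code r x = code r y) : SS r x y := by
  have hgx := good_sort hx
  have hgy := good_sort hy
  have key := signs_of_cnt r n _ _ hgx hgy (fun j hj => congrFun hc ⟨j, hj⟩)
  intro i j s hsr
  obtain ⟨i, rfl⟩ := (Tuple.sort x).surjective i
  obtain ⟨j, rfl⟩ := (Tuple.sort x).surjective j
  rcases lt_or_ge i j with hij | hij
  · have := key j j.2 i hij s hsr
    rw [ext_of_lt _ j.2, ext_of_lt _ i.2, ext_of_lt _ j.2, ext_of_lt _ i.2, ← hs] at this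
    exact this
  · have h1 : x (Tuple.sort x j) ≤ x (Tuple.sort x i) := Tuple.monotone_sort x hij
    have h2 : y (Tuple.sort x j) ≤ y (Tuple.sort x i) := by
      rw [hs]; exact Tuple.monotone_sort y hij
    have : (0:ℝ) ≤ s := Nat.cast_nonneg s
    constructor <;> intro h <;> linarith

noncomputable def inv (r n : ℕ) (x : catalanArrangementCompl r n) :
    Equiv.Perm (Fin n) × {c : Fin n → ℕ // IsCode r n 0 c} :=
  (Tuple.sort x.1, ⟨code r x.1, isCode_code x.2⟩)

theorem inv_surj (r n : ℕ) : Function.Surjective (inv r n) := by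
  rintro ⟨σ, c, hc⟩
  obtain ⟨x, hx, hxc⟩ := exists_good r (fun j => if h : j < n then c ⟨j, h⟩ else 0)
    (by
      by_cases h : 0 < n
      · have := hc.1 h
        simp only [h, dif_pos]; omega
      · simp [h]) n
    (by
      intro i hi
      simp only [hi, dif_pos, (by omega : i < n)]
      exact hc.2 i hi)
  set z : Fin n → ℝ := fun i => x (σ.symm i) with hz
  have hmono : StrictMono (z ∘ σ) := by
    intro i j hij
    simp only [hz, Function.comp, Equiv.symm_apply_apply]
    exact (hx i j hij j.2).1
  have hzU : z ∈ catalanArrangementCompl r n := by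
    rw [mem_compl_iff]
    intro i j hij s hs
    obtain ⟨i, rfl⟩ := σ.surjective i
    obtain ⟨j, rfl⟩ := σ.surjective j
    simp only [hz, Equiv.symm_apply_apply]
    have hij' : i ≠ j := fun h => hij (by rw [h])
    rcases lt_or_gt_of_ne hij' with h | h
    · exact (hx i j h j.2).2 s hs
    · have := (hx j i h i.2).1
      have h0 : (0:ℝ) ≤ s := Nat.cast_nonneg s
      intro he; linarith
  have hsort := sort_unique hmono
  refine ⟨⟨z, hzU⟩, ?_⟩
  refine Prod.ext hsort.symm (Subtype.ext ?_)
  funext j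
  have h1 := hxc j j.2
  simp only [j.2, dif_pos] at h1
  show code r z j = c j
  rw [← h1]
  unfold code
  rw [← hsort]
  have hext : ∀ i < n, ext (z ∘ σ) i = x i := by
    intro i hi
    rw [ext_of_lt _ hi]
    simp [hz]
  unfold cnt
  congr 1
  apply Finset.filter_congr
  rintro ⟨i, s⟩ hp
  simp only [pts, Finset.mem_product, Finset.mem_range, Finset.mem_Icc] at hp ⊢
  rw [hext _ j.2, hext _ (hp.1.trans j.2)]

theorem inv_eq_of_SS {r n : ℕ} {x y : catalanArrangementCompl r n} (h : SS r x.1 y.1) :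
    inv r n x = inv r n y :=
  Prod.ext (sort_eq_of_SS x.2 h) (Subtype.ext (code_eq_of_SS x.2 y.2 h))

theorem inv_locConst (r n : ℕ) : IsLocallyConstant (inv r n) := by
  rw [IsLocallyConstant.iff_exists_open]
  intro x
  refine ⟨Subtype.val ⁻¹' cell r x.1, (cell_open r n x.1).preimage continuous_subtype_val,
    self_mem_cell r n x.1, fun y hy => ?_⟩
  exact (inv_eq_of_SS (SS_of_mem_cell x.2 hy)).symm

theorem comp_eq_iff {r n : ℕ} (x y : catalanArrangementCompl r n) :
    (x : ConnectedComponents (catalanArrangementCompl r n)) = y ↔ inv r n x = inv r n y := by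
  rw [ConnectedComponents.coe_eq_coe]
  constructor
  · intro h
    refine (inv_locConst r n).apply_eq_of_isPreconnected
      (isPreconnected_connectedComponent (x := x)) mem_connectedComponent ?_
    rw [h]; exact mem_connectedComponent
  · intro h
    have hSS := SS_of_code_eq x.2 y.2 (congrArg Prod.fst h)
      (congrArg (fun p => p.2.1) h)
    have hpre : IsPreconnected (Subtype.val ⁻¹' cell r x.1 : Set (catalanArrangementCompl r n)) := by
      rw [← Topology.IsInducing.subtypeVal.isPreconnected_image, Subtype.image_preimage_coe,
        Set.inter_eq_right.2 (cell_subset x.2)]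
      exact (cell_convex r n x.1).isPreconnected
    have := hpre.subset_connectedComponent (x := x) (self_mem_cell r n x.1)
    exact connectedComponent_eq (this (mem_cell_of_SS y.2 hSS))

theorem card_regions (r n : ℕ) :
    Nat.card (ConnectedComponents (catalanArrangementCompl r n)) =
      n.factorial * Nat.card {c : Fin n → ℕ // IsCode r n 0 c} := by
  have : Nat.card (Equiv.Perm (Fin n) × {c : Fin n → ℕ // IsCode r n 0 c}) =
      n.factorial * Nat.card {c : Fin n → ℕ // IsCode r n 0 c} := by
    rw [Nat.card_prod, Nat.card_perm, Nat.card_fin]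
  rw [← this]
  refine Nat.card_congr (Equiv.ofBijective
    (Quotient.lift (inv r n) (fun a b hab => (comp_eq_iff a b).1 (Quotient.sound hab))) ⟨?_, ?_⟩)
  · intro a b
    induction a using Quotient.inductionOn
    induction b using Quotient.inductionOn
    intro h
    exact (comp_eq_iff _ _).2 h
  · intro p
    obtain ⟨x, hx⟩ := inv_surj r n p
    exact ⟨Quotient.mk _ x, hx⟩

end CatArr

/-- The `r`-Catalan arrangement `C_n^r` has exactly `n! · C(n,r)` regions, where
`C(n,r) = (1/(rn+1))·binom(rn+n,n)` is the Fuss–Catalan number; equivalently,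
`(rn+1)` times the number of regions equals `n! · binom(rn+n, n)`. -/
theorem catalan_arrangement_card_regions (r n : ℕ) (hr : 0 < r) (hn : 0 < n) :
    (r * n + 1) * Nat.card (ConnectedComponents ↥(catalanArrangementCompl r n)) =
      n.factorial * (r * n + n).choose n := by
  rw [CatArr.card_regions, ← CatArr.code_card_final r n hn]
  ring
end

section
/- For all positive integers r and n, the number of r-Dyck paths of length n equals the Fuss–Catalan number C(n,r) = (1/(rn+1))·binom(rn+n, n); equivalently, the number of nondecreasing sequences (h_1,…,h_n) of nonnegative integers with h_i ≤ r(i−1) for all i equals C(n,r). -/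
def dyckS (r b lo s : ℕ) : Set (Fin b → ℕ) :=
  {h | Monotone h ∧ ∀ i : Fin b, lo ≤ h i ∧ h i ≤ s + r * i.val}

theorem dyckS_finite (r b lo s : ℕ) : (dyckS r b lo s).Finite := by
  apply (Set.finite_Icc (fun _ : Fin b => lo) (fun i : Fin b => s + r * i.val)).subset
  intro h hh
  exact ⟨fun i => (hh.2 i).1, fun i => (hh.2 i).2⟩

theorem dyckS_split (r b lo s : ℕ) (hls : lo ≤ s) :
    dyckS r (b+1) lo s =
      (fun g : Fin b → ℕ => (Fin.cons lo g : Fin (b+1) → ℕ)) '' dyckS r b lo (s + r)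
        ∪ dyckS r (b+1) (lo+1) s := by
  ext h
  constructor
  · rintro ⟨hm, hb⟩
    by_cases h0 : h 0 = lo
    · left
      refine ⟨Fin.tail h, ⟨?_, ?_⟩, ?_⟩
      · intro i j hij
        exact hm (Fin.succ_le_succ_iff.2 hij)
      · intro i
        have := hb i.succ
        simp only [Fin.val_succ] at this
        refine ⟨this.1, ?_⟩
        show h i.succ ≤ _
        nlinarith [this.2]
      · show Fin.cons lo (Fin.tail h) = h
        rw [← h0]
        exact Fin.cons_self_tail h
    · right
      refine ⟨hm, fun i => ⟨?_, (hb i).2⟩⟩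
      have h1 := (hb 0).1
      have h2 := hm (Fin.zero_le i)
      omega
  · rintro (⟨g, ⟨hm, hb⟩, rfl⟩ | ⟨hm, hb⟩)
    · refine ⟨?_, ?_⟩
      · intro i j
        refine Fin.cases ?_ (fun i => ?_) i
        · refine Fin.cases ?_ (fun j => ?_) j
          · simp
          · intro _
            simpa using (hb j).1
        · refine Fin.cases ?_ (fun j => ?_) j
          · intro hij
            simp at hij
          · intro hij
            simpa using hm (Fin.succ_le_succ_iff.1 hij)
      · intro i
        refine Fin.cases ?_ (fun i => ?_) i
        · simpa using hls
        · have := hb i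
          simp only [Fin.cons_succ, Fin.val_succ]
          exact ⟨this.1, by nlinarith [this.2]⟩
    · exact ⟨hm, fun i => ⟨by have := (hb i).1; omega, (hb i).2⟩⟩

theorem dyckS_ncard_split (r b lo s : ℕ) (hls : lo ≤ s) :
    (dyckS r (b+1) lo s).ncard =
      (dyckS r b lo (s + r)).ncard + (dyckS r (b+1) (lo+1) s).ncard := by
  rw [dyckS_split r b lo s hls, Set.ncard_union_eq ?_ ((dyckS_finite _ _ _ _).image _)
    (dyckS_finite _ _ _ _), Set.ncard_image_of_injective]
  · exact Fin.cons_right_injective (α := fun _ => ℕ) lo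
  · rw [Set.disjoint_left]
    rintro _ ⟨g, _, rfl⟩ ⟨_, hb⟩
    have := (hb 0).1
    simp at this

theorem dyckS_ncard (r : ℕ) (hr : 0 < r) (b : ℕ) : ∀ d lo s : ℕ, s + 1 = lo + d →
    (d + r * b) * (dyckS r b lo s).ncard = d * (d + r * b + b - 1).choose b := by
  induction b with
  | zero =>
    intro d lo s _
    have : dyckS r 0 lo s = Set.univ := by
      ext h
      simp [dyckS, Subsingleton.monotone]
    rw [this]
    simp [Set.ncard_univ]
  | succ b ihb =>
    intro d
    induction d with
    | zero =>
      intro lo s h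
      have : dyckS r (b+1) lo s = ∅ := by
        ext g
        simp only [Set.mem_empty_iff_false, iff_false]
        rintro ⟨_, hb⟩
        have := hb 0
        simp at this
        omega
      rw [this]
      simp
    | succ d ihd =>
      intro lo s h
      have hX := ihd (lo+1) s (by omega)
      have hY := ihb (d+1+r) lo (s+r) (by omega)
      rw [dyckS_ncard_split r b lo s (by omega)]
      generalize (dyckS r b lo (s + r)).ncard = Y at *
      generalize (dyckS r (b+1) (lo+1) s).ncard = X at *
      obtain ⟨M, hM⟩ : ∃ M, M = d + r * (b+1) := ⟨_, rfl⟩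
      have hM0 : 0 < M := by rw [hM]; positivity
      have e1 : d + 1 + r + r * b + b - 1 = M + b := by
        rw [hM, Nat.mul_succ]; omega
      have e2 : d + r * (b+1) + (b+1) - 1 = M + b := by omega
      have e3 : d + 1 + r * (b+1) + (b+1) - 1 = M + b + 1 := by omega
      rw [e1] at hY
      rw [e2] at hX
      rw [e3, Nat.choose_succ_succ]
      have hc := Nat.choose_succ_right_eq (M+b) b
      rw [Nat.add_sub_cancel] at hc
      generalize (M+b).choose b = A at *
      simp only [Nat.succ_eq_add_one] at *
      generalize (M+b).choose (b+1) = B at *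
      have hX' : (b+1) * X = d * A := by
        apply Nat.eq_of_mul_eq_mul_left hM0
        rw [← hM] at hX
        calc M * ((b+1) * X) = (b+1) * (M * X) := by ring
          _ = d * (B * (b+1)) := by rw [hX]; ring
          _ = _ := by rw [hc]; ring
      apply Nat.eq_of_mul_eq_mul_left (Nat.succ_pos b)
      simp only [Nat.succ_eq_add_one]
      zify at *
      rw [hM] at hc
      linear_combination (b+1 : ℤ) * hY + (d + 1 + r * (b+1) : ℤ) * hX' - (d+1 : ℤ) * hc

/-- The number of `r`-Dyck paths of length `n`, identified via height sequences with
nondecreasing sequences `(h₀,…,h_{n-1})` of nonnegative integers satisfying `hᵢ ≤ r·i`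
(0-indexed), equals the Fuss–Catalan number `C(n,r) = (1/(rn+1))·binom(rn+n,n)`;
equivalently, `(rn+1)` times this number equals `binom(rn+n, n)`. -/
theorem card_r_dyck_paths (r n : ℕ) (hr : 0 < r) (hn : 0 < n) :
    (r * n + 1) *
        Nat.card {h : Fin n → ℕ // Monotone h ∧ ∀ i : Fin n, h i ≤ r * i.val} =
      (r * n + n).choose n := by
  have key := dyckS_ncard r hr n 1 0 0 rfl
  have e : dyckS r n 0 0 = {h | Monotone h ∧ ∀ i : Fin n, h i ≤ r * i.val} := by
    ext h
    simp [dyckS]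
  have e2 : 1 + r * n + n - 1 = r * n + n := by omega
  rw [e, e2, one_mul, add_comm 1] at key
  exact key
end

section
/- For each region Δ of the r-Catalan arrangement C_n^r there is a unique permutation π_Δ ∈ S_n with x_{π_Δ(1)} > x_{π_Δ(2)} > ⋯ > x_{π_Δ(n)} for every x ∈ Δ. For a region Δ with π_Δ equal to the identity and x ∈ Δ, the number h_j(Δ) = #{(i,k) ∈ {1,…,n}×{1,…,r} : x_i − x_j − k > 0} is independent of the choice of x ∈ Δ, and (h_1(Δ),…,h_n(Δ)) is the height sequence of an r-Dyck path P_Δ of length n. For a general region Δ, set P_Δ = P_{π_Δ(Δ)}, where a permutation π acts on ℝⁿ by π(x) = (x_{π(1)},…,x_{π(n)}). Then the map Δ ↦ (π_Δ, P_Δ) is a bijection from the set of regions of C_n^r onto S_n × D_n^r, where D_n^r is the set of r-Dyck paths of length n. -/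
/-- An `r`-Dyck path of length `n`, identified with its height sequence: a nondecreasing
sequence `(h₀,…,h_{n-1})` of nonnegative integers with `hᵢ ≤ r·i` (0-indexed). -/
def DyckHeight (r n : ℕ) : Type :=
  {h : Fin n → ℕ // Monotone h ∧ ∀ i : Fin n, h i ≤ r * i.val}

open Finset in
noncomputable def cnt (r : ℕ) {n : ℕ} (y : Fin n → ℝ) (j : Fin n) : Finset (Fin n × ℕ) :=
  (univ ×ˢ Icc 1 r).filter (fun p => 0 < y p.1 - y j - (p.2 : ℝ))

lemma mem_cnt {r n : ℕ} {y : Fin n → ℝ} {j : Fin n} {p : Fin n × ℕ} :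
    p ∈ cnt r y j ↔ (1 ≤ p.2 ∧ p.2 ≤ r) ∧ 0 < y p.1 - y j - (p.2 : ℝ) := by
  simp [cnt]

lemma natCard_cnt (r n : ℕ) (y : Fin n → ℝ) (j : Fin n) :
    Nat.card {p : Fin n × ℕ | p.2 ∈ Finset.Icc 1 r ∧ 0 < y p.1 - y j - (p.2 : ℝ)} =
      (cnt r y j).card := by
  rw [← Nat.card_eq_finsetCard]
  congr 1
  congr 1
  ext p
  simp [mem_cnt]

lemma lt_of_mem_cnt {r n : ℕ} {y : Fin n → ℝ} (hy : StrictAnti y) {j : Fin n} {p : Fin n × ℕ}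
    (hp : p ∈ cnt r y j) : p.1 < j := by
  rw [mem_cnt] at hp
  have : (0 : ℝ) ≤ p.2 := by positivity
  exact hy.lt_iff_gt.1 (by linarith [hp.2])

lemma cnt_aux {r n : ℕ} {y z : Fin n → ℝ} (hy : StrictAnti y) (hz : StrictAnti z)
    (j : Fin n) (ih : ∀ m < j, cnt r y m = cnt r z m)
    {a b : Fin n × ℕ} (ha : a ∈ cnt r y j) (ha' : a ∉ cnt r z j)
    (hb : b ∈ cnt r z j) (hb' : b ∉ cnt r y j) : a.1 < b.1 → False := by
  intro hab
  have hbj := lt_of_mem_cnt hz hb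
  have e := ih _ hbj
  rw [mem_cnt] at ha ha' hb hb'
  have h1 : y b.1 - y j - (b.2 : ℝ) ≤ 0 := by
    by_contra h; exact hb' ⟨hb.1, by linarith⟩
  have h2 : z a.1 - z j - (a.2 : ℝ) ≤ 0 := by
    by_contra h; exact ha' ⟨ha.1, by linarith⟩
  have h3 := hz hab
  have h4 : b.2 < a.2 := by
    have : (b.2 : ℝ) < a.2 := by linarith [hb.2]
    exact_mod_cast this
  have hc : ((a.2 - b.2 : ℕ) : ℝ) = (a.2 : ℝ) - b.2 := by push_cast [h4.le]; rfl
  have m1 : (a.1, a.2 - b.2) ∈ cnt r y b.1 := by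
    rw [mem_cnt]
    refine ⟨⟨by simp only; omega, by have := ha.1.2; simp only; omega⟩, ?_⟩
    simp only [hc]
    linarith [ha.2]
  rw [e, mem_cnt] at m1
  have := m1.2
  simp only [hc] at this
  linarith [hb.2]

lemma cnt_eq {r n : ℕ} {y z : Fin n → ℝ} (hy : StrictAnti y) (hz : StrictAnti z)
    (h : ∀ j, (cnt r y j).card = (cnt r z j).card) (j : Fin n) : cnt r y j = cnt r z j := by
  induction j using WellFoundedLT.induction with
  | ind j ih =>
    by_contra hne
    have h1 : ¬ cnt r y j ⊆ cnt r z j := fun hs =>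
      hne (Finset.eq_of_subset_of_card_le hs (h j).ge)
    have h2 : ¬ cnt r z j ⊆ cnt r y j := fun hs =>
      hne (Finset.eq_of_subset_of_card_le hs (h j).le).symm
    obtain ⟨a, ha, ha'⟩ := Finset.not_subset.1 h1
    obtain ⟨b, hb, hb'⟩ := Finset.not_subset.1 h2
    rcases lt_trichotomy a.1 b.1 with hab | hab | hab
    · exact cnt_aux hy hz j ih ha ha' hb hb' hab
    · rw [mem_cnt] at ha ha' hb hb'
      have h1 : y b.1 - y j - (b.2 : ℝ) ≤ 0 := by
        by_contra h; exact hb' ⟨hb.1, by linarith⟩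
      have h2 : z a.1 - z j - (a.2 : ℝ) ≤ 0 := by
        by_contra h; exact ha' ⟨ha.1, by linarith⟩
      rw [hab] at ha h2
      linarith [ha.2, hb.2]
    · exact cnt_aux hz hy j (fun m hm => (ih m hm).symm) hb hb' ha ha' hab

def SameSign (r : ℕ) {n : ℕ} (x y : Fin n → ℝ) : Prop :=
  ∀ i j : Fin n, ∀ s : ℤ, -(r : ℤ) ≤ s → s ≤ r → ((s : ℝ) < x i - x j ↔ (s : ℝ) < y i - y j)

lemma compl_ne {r n : ℕ} {x : Fin n → ℝ} (hx : x ∈ catalanArrangementCompl r n)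
    {i j : Fin n} (hij : i ≠ j) {s : ℤ} (h1 : -(r : ℤ) ≤ s) (h2 : s ≤ r) :
    x i - x j ≠ (s : ℝ) := by
  rcases lt_or_gt_of_ne hij with h | h
  · exact hx i j h s h1 h2
  · intro e
    refine hx j i h (-s) (by omega) (by omega) ?_
    push_cast
    linarith

/-- the pair `(π, h)` describes `x` -/
def Spec (r : ℕ) {n : ℕ} (x : Fin n → ℝ) (π : Equiv.Perm (Fin n)) (h : Fin n → ℕ) : Prop :=
  StrictAnti (x ∘ π) ∧ ∀ j, h j = (cnt r (x ∘ π) j).card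

lemma sameSign_of_spec {r n : ℕ} {x y : Fin n → ℝ} (hx : x ∈ catalanArrangementCompl r n)
    (hy : y ∈ catalanArrangementCompl r n) {π : Equiv.Perm (Fin n)} {h : Fin n → ℕ}
    (sx : Spec r x π h) (sy : Spec r y π h) : SameSign r x y := by
  have key := cnt_eq sx.1 sy.1 (fun j => by rw [← sx.2 j, ← sy.2 j])
  have pos : ∀ i j : Fin n, i < j → ∀ s : ℤ, s ≤ r →
      ((s : ℝ) < x (π i) - x (π j) ↔ (s : ℝ) < y (π i) - y (π j)) := by
    intro i j hij s hs
    have h1 : x (π j) < x (π i) := sx.1 hij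
    have h2 : y (π j) < y (π i) := sy.1 hij
    rcases le_or_gt s 0 with h0 | h0
    · have : (s : ℝ) ≤ 0 := by exact_mod_cast h0
      constructor <;> intro <;> linarith
    · lift s to ℕ using h0.le
      have := Finset.ext_iff.1 (key j) (i, s)
      simp only [mem_cnt, Function.comp] at this
      have hb : 1 ≤ s ∧ s ≤ r := by omega
      simp only [hb, true_and, and_self] at this
      push_cast
      constructor
      · intro h; have := this.1 (by linarith); linarith
      · intro h; have := this.2 (by linarith); linarith
  intro i j s h1 h2
  obtain ⟨i, rfl⟩ := π.surjective i
  obtain ⟨j, rfl⟩ := π.surjective j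
  rcases lt_trichotomy i j with hij | rfl | hij
  · exact pos i j hij s h2
  · simp
  · have := pos j i hij (-s) (by omega)
    have hne : π i ≠ π j := fun e => hij.ne' (π.injective e)
    have n1 := compl_ne hx hne h1 h2
    have n2 := compl_ne hy hne h1 h2
    push_cast at this
    constructor
    · intro h
      by_contra h'
      have := this.2 (by have := lt_of_le_of_ne (not_lt.1 h') n2; linarith)
      linarith
    · intro h
      by_contra h'
      have := this.1 (by have := lt_of_le_of_ne (not_lt.1 h') n1; linarith)
      linarith

lemma spec_of_sameSign {r n : ℕ} {x y : Fin n → ℝ} (hs : SameSign r x y)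
    {π : Equiv.Perm (Fin n)} {h : Fin n → ℕ} (sx : Spec r x π h) : Spec r y π h := by
  refine ⟨fun i j hij => ?_, fun j => ?_⟩
  · have h1 : x (π j) < x (π i) := sx.1 hij
    have := (hs (π i) (π j) 0 (by omega) (by omega)).1 (by push_cast; linarith)
    push_cast at this
    simp only [Function.comp]
    linarith
  · rw [sx.2 j]
    congr 1
    ext p
    simp only [mem_cnt, Function.comp]
    refine and_congr_right fun hp => ?_
    have := hs (π p.1) (π j) (p.2 : ℤ) (by omega) (by omega)
    push_cast at this
    constructor
    · intro h; have := this.1 (by linarith); linarith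
    · intro h; have := this.2 (by linarith); linarith

lemma perm_unique {n : ℕ} {x : Fin n → ℝ} {π σ : Equiv.Perm (Fin n)}
    (h1 : StrictAnti (x ∘ π)) (h2 : StrictAnti (x ∘ σ)) : π = σ := by
  have e : (-x) ∘ π = (-x) ∘ σ := Tuple.unique_monotone
    (fun i j hij => by simpa using h1.antitone hij) (fun i j hij => by simpa using h2.antitone hij)
  have inj : Function.Injective x := by
    intro a b hab
    obtain ⟨a, rfl⟩ := π.surjective a
    obtain ⟨b, rfl⟩ := π.surjective b
    rw [h1.injective hab]
  ext i
  have := congrFun e i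
  simp only [Function.comp, Pi.neg_apply, neg_inj] at this
  rw [inj this]

lemma spec_exists {r n : ℕ} {x : Fin n → ℝ} (hx : x ∈ catalanArrangementCompl r n) :
    ∃ p : Equiv.Perm (Fin n) × DyckHeight r n, Spec r x p.1 p.2.val := by
  have inj : Function.Injective x := by
    intro a b hab
    by_contra hne
    exact compl_ne hx hne (s := 0) (by omega) (by omega) (by simp [hab])
  let π := Tuple.sort (-x)
  have hm : Monotone ((-x) ∘ π) := Tuple.monotone_sort (-x)
  have hπ : StrictAnti (x ∘ π) := by
    have : Antitone (x ∘ π) := fun i j hij => by simpa using hm hij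
    exact this.strictAnti_of_injective (inj.comp π.injective)
  refine ⟨(π, ⟨fun j => (cnt r (x ∘ π) j).card, ?_, ?_⟩), hπ, fun j => rfl⟩
  · intro i j hij
    refine Finset.card_le_card fun p hp => ?_
    rw [mem_cnt] at hp ⊢
    exact ⟨hp.1, by linarith [hp.2, hπ.antitone hij]⟩
  · intro j
    have : cnt r (x ∘ π) j ⊆ Finset.Iio j ×ˢ Finset.Icc 1 r := by
      intro p hp
      have h1 := lt_of_mem_cnt hπ hp
      rw [mem_cnt] at hp
      simp [h1, hp.1]
    have := Finset.card_le_card this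
    simpa [mul_comm] using this

lemma spec_unique {r n : ℕ} {x : Fin n → ℝ} {p q : Equiv.Perm (Fin n) × DyckHeight r n}
    (hp : Spec r x p.1 p.2.val) (hq : Spec r x q.1 q.2.val) : p = q := by
  obtain ⟨π, h⟩ := p
  obtain ⟨σ, g⟩ := q
  obtain rfl : π = σ := perm_unique hp.1 hq.1
  congr 1
  apply Subtype.ext
  funext j
  exact (hp.2 j).trans (hq.2 j).symm

lemma mk_eq_of_sameSign {r n : ℕ} (x y : ↥(catalanArrangementCompl r n))
    (hs : SameSign r x.val y.val) : ConnectedComponents.mk x = ConnectedComponents.mk y := by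
  have hsub : segment ℝ x.val y.val ⊆ catalanArrangementCompl r n := by
    rintro z ⟨a, b, ha, hb, hab, rfl⟩ i j hij s h1 h2 e
    have k := hs i j s h1 h2
    have n1 := compl_ne x.2 hij.ne h1 h2
    have n2 := compl_ne y.2 hij.ne h1 h2
    simp only [Pi.add_apply, Pi.smul_apply, smul_eq_mul] at e
    have e' : a * (x.val i - x.val j - s) + b * (y.val i - y.val j - s) = 0 := by
      have : (a + b) * s = s := by rw [hab, one_mul]
      linarith
    rcases lt_or_gt_of_ne n1 with h | h
    · have h' : y.val i - y.val j < s :=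
        lt_of_le_of_ne (not_lt.1 fun h' => by linarith [k.2 h']) n2
      rcases ha.eq_or_lt with rfl | ha
      · have : b = 1 := by linarith
        subst this; linarith
      · nlinarith [mul_pos ha (sub_pos.2 h), mul_nonneg hb (sub_pos.2 h').le]
    · have h' := k.1 h
      rcases ha.eq_or_lt with rfl | ha
      · have : b = 1 := by linarith
        subst this; linarith
      · nlinarith [mul_pos ha (sub_pos.2 h), mul_nonneg hb (sub_pos.2 h').le]
  have hJ : JoinedIn (catalanArrangementCompl r n) x.val y.val := JoinedIn.of_segment_subset hsub
  rw [ConnectedComponents.coe_eq_coe']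
  have := (joinedIn_iff_joined hJ.source_mem hJ.target_mem).1 hJ
  exact pathComponent_subset_component _ this.symm

lemma sameSign_of_mk_eq {r n : ℕ} (x y : ↥(catalanArrangementCompl r n))
    (h : ConnectedComponents.mk x = ConnectedComponents.mk y) : SameSign r x.val y.val := by
  intro i j s h1 h2
  by_cases hij : i = j
  · subst hij; simp
  let U : Set ↥(catalanArrangementCompl r n) := {z | (s : ℝ) < z.val i - z.val j}
  have hc : Continuous fun z : ↥(catalanArrangementCompl r n) => z.val i - z.val j :=
    ((continuous_apply i).comp continuous_subtype_val).sub
      ((continuous_apply j).comp continuous_subtype_val)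
  have hU : IsClopen U := by
    constructor
    · have : U = {z | (s : ℝ) ≤ z.val i - z.val j} := by
        ext z
        simp only [U, Set.mem_setOf_eq]
        exact ⟨fun h => le_of_lt h, fun h => lt_of_le_of_ne h (compl_ne z.2 hij h1 h2).symm⟩
      rw [this]
      exact isClosed_le continuous_const hc
    · exact isOpen_lt continuous_const hc
  rw [ConnectedComponents.coe_eq_coe] at h
  constructor
  · intro hx
    have : y ∈ connectedComponent x := h ▸ mem_connectedComponent
    exact hU.connectedComponent_subset (show x ∈ U from hx) this
  · intro hx
    have : x ∈ connectedComponent y := h ▸ mem_connectedComponent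
    exact hU.connectedComponent_subset (show y ∈ U from hx) this

lemma exists_cut {α : Type*} [DecidableEq α] (A : Finset α) (g : α → ℝ) (hg : Set.InjOn g A)
    (a : ℝ) (m : ℕ) (h1 : (A.filter (fun p => a ≤ g p)).card ≤ m) (h2 : m ≤ A.card) :
    ∃ b ≤ a, (A.filter (fun p => b ≤ g p)).card = m := by
  induction m, h1 using Nat.le_induction with
  | base => exact ⟨a, le_rfl, rfl⟩
  | succ m hm ih =>
    obtain ⟨b, hb, hc⟩ := ih (by omega)
    have hne : (A.filter (fun p => g p < b)).Nonempty := by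
      by_contra hne
      rw [Finset.not_nonempty_iff_eq_empty, Finset.filter_eq_empty_iff] at hne
      rw [Finset.filter_true_of_mem (fun p hp => not_lt.1 (hne hp))] at hc
      omega
    obtain ⟨q, hq, hmax⟩ := Finset.exists_max_image _ g hne
    rw [Finset.mem_filter] at hq
    refine ⟨g q, by linarith [hq.2], ?_⟩
    have : A.filter (fun p => g q ≤ g p) = insert q (A.filter (fun p => b ≤ g p)) := by
      ext p
      simp only [Finset.mem_filter, Finset.mem_insert]
      constructor
      · rintro ⟨hp, hpq⟩
        by_cases hpb : b ≤ g p
        · exact Or.inr ⟨hp, hpb⟩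
        · left
          have := hmax p (by simp [hp]; linarith)
          exact hg hp hq.1 (le_antisymm this hpq)
      · rintro (rfl | ⟨hp, hpb⟩)
        · exact ⟨hq.1, le_rfl⟩
        · exact ⟨hp, by linarith [hq.2]⟩
    rw [this, Finset.card_insert_of_notMem, hc]
    simp only [Finset.mem_filter, not_and, not_le]
    exact fun _ => hq.2

lemma exists_cut' {α : Type*} [DecidableEq α] (A : Finset α) (g : α → ℝ) (hg : Set.InjOn g A)
    (a : ℝ) (m : ℕ) (h1 : (A.filter (fun p => a ≤ g p)).card ≤ m) (h2 : m ≤ A.card)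
    (F : Finset ℝ) :
    ∃ t < a, t ∉ F ∧ (A.filter (fun p => t < g p)).card = m := by
  obtain ⟨b, hb, hc⟩ := exists_cut A g hg a m h1 h2
  have e1 : ∀ᶠ t in nhdsWithin b (Set.Iio b), t < b := eventually_mem_nhdsWithin
  have e2 : ∀ c : ℝ, ∀ᶠ t in nhdsWithin b (Set.Iio b), (t < c ↔ b ≤ c) ∧ t ≠ c := by
    intro c
    rcases le_or_gt b c with h | h
    · filter_upwards [e1] with t ht
      exact ⟨⟨fun _ => h, fun _ => by linarith⟩, by linarith⟩
    · filter_upwards [nhdsWithin_le_nhds (Ioi_mem_nhds h)] with t ht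
      have ht : c < t := ht
      exact ⟨⟨fun _ => by linarith, fun _ => by linarith⟩, ht.ne'⟩
  have e3 : ∀ᶠ t in nhdsWithin b (Set.Iio b), ∀ c ∈ F, t ≠ c :=
    (Filter.eventually_all_finset F).2 fun c _ => (e2 c).mono fun _ h => h.2
  have e4 : ∀ᶠ t in nhdsWithin b (Set.Iio b), ∀ p ∈ A, (t < g p ↔ b ≤ g p) :=
    (Filter.eventually_all_finset A).2 fun p _ => (e2 (g p)).mono fun _ h => h.1
  obtain ⟨t, ht1, ht3, ht4⟩ := (e1.and (e3.and e4)).exists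
  refine ⟨t, by linarith, fun h => ht3 t h rfl, ?_⟩
  rw [← hc, Finset.filter_congr ht4]

open Finset in
lemma exists_point (r : ℕ) (h : ℕ → ℕ) (N : ℕ) (hmono : ∀ i j, i ≤ j → j < N → h i ≤ h j)
    (hle : ∀ i < N, h i ≤ r * i) :
    ∃ y : ℕ → ℝ, (∀ i j, i < j → j < N → y j < y i) ∧
      (∀ i j, i < j → j < N → ∀ s : ℕ, s ≤ r → y i - y j ≠ s) ∧
      ∀ j < N, ((range j ×ˢ Icc 1 r).filter (fun p => y j < y p.1 - p.2)).card = h j := by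
  induction N with
  | zero => exact ⟨fun _ => 0, by simp, by simp, by simp⟩
  | succ N ih =>
    obtain ⟨y, hy1, hy2, hy3⟩ := ih (fun i j hij hj => hmono i j hij (by omega))
      (fun i hi => hle i (by omega))
    have hinj : Set.InjOn (fun p : ℕ × ℕ => y p.1 - p.2)
        ((range N ×ˢ Icc 1 r : Finset (ℕ × ℕ)) : Set (ℕ × ℕ)) := by
      have aux : ∀ i j k l : ℕ, i < j → j < N → 1 ≤ l → k ≤ r → y i - k = y j - l → False := by
        intro i j k l hij hj hl hk e
        have := hy1 i j hij hj
        have hlk : l < k := by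
          have : (l : ℝ) < k := by linarith
          exact_mod_cast this
        refine hy2 i j hij hj (k - l) (by omega) ?_
        push_cast [hlk.le]
        linarith
      rintro ⟨i, k⟩ hp ⟨j, l⟩ hq e
      simp only [coe_product, Set.mem_prod, mem_coe, mem_range, mem_Icc] at hp hq e
      rcases lt_trichotomy i j with hij | rfl | hij
      · exact (aux i j k l hij hq.1 hq.2.1 hp.2.2 e).elim
      · have : (k : ℝ) = l := by linarith
        have : k = l := by exact_mod_cast this
        rw [this]
      · exact (aux j i l k hij hp.1 hp.2.1 hq.2.2 e.symm).elim
    have hcard : (range N ×ˢ Icc 1 r).card = r * N := by simp [mul_comm]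
    have ha : ∃ a : ℝ, (∀ i < N, a ≤ y i) ∧
        ((range N ×ˢ Icc 1 r).filter (fun p => a ≤ y p.1 - p.2)).card ≤ h N := by
      rcases N with _ | M
      · exact ⟨0, by simp, by simp⟩
      · refine ⟨y M, fun i hi => ?_, ?_⟩
        · rcases (Nat.lt_succ_iff.1 hi).eq_or_lt with rfl | hlt
          · exact le_rfl
          · exact (hy1 i M hlt (by omega)).le
        · refine le_trans ?_ (hmono M (M + 1) (by omega) (by omega))
          rw [← hy3 M (by omega)]
          refine card_le_card ?_
          rintro ⟨i, k⟩ hp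
          simp only [mem_filter, mem_product, mem_range, mem_Icc] at hp ⊢
          obtain ⟨⟨hi, hk1, hk2⟩, hle'⟩ := hp
          have hk : (1 : ℝ) ≤ k := by exact_mod_cast hk1
          have hiM : i < M := by
            rcases (Nat.lt_succ_iff.1 hi).eq_or_lt with rfl | hlt
            · linarith
            · exact hlt
          refine ⟨⟨hiM, hk1, hk2⟩, lt_of_le_of_ne hle' fun e => ?_⟩
          exact hy2 i M hiM (by omega) k hk2 (by linarith)
    obtain ⟨a, ha1, ha2⟩ := ha
    obtain ⟨t, hta, htF, htc⟩ := exists_cut' _ _ hinj a (h N) ha2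
      (by rw [hcard]; exact hle N (by omega))
      ((range N ×ˢ range (r + 1)).image (fun p => y p.1 - (p.2 : ℝ)))
    have up : ∀ i < N, Function.update y N t i = y i := fun i hi =>
      Function.update_of_ne hi.ne _ _
    refine ⟨Function.update y N t, ?_, ?_, ?_⟩
    · intro i j hij hj
      rcases (Nat.lt_succ_iff.1 hj).eq_or_lt with rfl | hlt
      · rw [up i hij, Function.update_self]
        linarith [ha1 i hij]
      · rw [up i (by omega), up j hlt]
        exact hy1 i j hij hlt
    · intro i j hij hj s hs e
      rcases (Nat.lt_succ_iff.1 hj).eq_or_lt with rfl | hlt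
      · rw [up i hij, Function.update_self] at e
        apply htF
        rw [mem_image]
        refine ⟨(i, s), by simp; omega, ?_⟩
        simp only
        linarith
      · rw [up i (by omega), up j hlt] at e
        exact hy2 i j hij hlt s hs e
    · intro j hj
      have : ∀ p ∈ range j ×ˢ Icc 1 r, Function.update y N t p.1 = y p.1 := by
        intro p hp
        simp only [mem_product, mem_range] at hp
        exact up _ (by omega)
      rcases (Nat.lt_succ_iff.1 hj).eq_or_lt with rfl | hlt
      · rw [← htc]
        congr 1
        refine filter_congr fun p hp => ?_
        rw [this p hp, Function.update_self]
      · rw [← hy3 j hlt]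
        congr 1
        refine filter_congr fun p hp => ?_
        rw [this p hp, up j hlt]

lemma spec_surj {r n : ℕ} (p : Equiv.Perm (Fin n) × DyckHeight r n) :
    ∃ x ∈ catalanArrangementCompl r n, Spec r x p.1 p.2.val := by
  obtain ⟨π, h, hm, hle⟩ := p
  obtain ⟨y, hy1, hy2, hy3⟩ := exists_point r (fun i => if hi : i < n then h ⟨i, hi⟩ else 0) n
    (by
      intro i j hij hj
      simp only [hj, lt_of_le_of_lt hij hj, dif_pos]
      exact hm (by simpa using hij))
    (by
      intro i hi
      simp only [hi, dif_pos]
      exact hle ⟨i, hi⟩)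
  have hcomp : (fun i => y (π.symm i).val) ∘ π = fun i : Fin n => y i.val := by
    funext i; simp
  have hanti : StrictAnti (fun i : Fin n => y i.val) := fun i j hij => hy1 i j hij j.2
  have aux : ∀ i j : Fin n, i < j → ∀ s : ℤ, s ≤ r → y i - y j ≠ (s : ℝ) := by
    intro i j hij s hs e
    have : (0 : ℝ) < s := by rw [← e]; linarith [hanti hij]
    have h0 : 0 < s := by exact_mod_cast this
    lift s to ℕ using h0.le
    exact hy2 i j hij j.2 s (by omega) (by simpa using e)
  refine ⟨fun i => y (π.symm i).val, ?_, ?_, ?_⟩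
  · intro i j hij s h1 h2 e
    have hne : π.symm i ≠ π.symm j := fun e => hij.ne (π.symm.injective e)
    rcases lt_or_gt_of_ne hne with h | h
    · exact aux _ _ h s h2 e
    · exact aux _ _ h (-s) (by omega) (by push_cast; linarith)
  · simp only [hcomp]; exact hanti
  · intro j
    simp only [hcomp]
    have := hy3 j j.2
    simp only [j.2, dif_pos] at this
    rw [← this]
    symm
    refine Finset.card_bij (fun p _ => (p.1.val, p.2)) ?_ ?_ ?_
    · intro p hp
      have h1 := lt_of_mem_cnt hanti hp
      rw [mem_cnt] at hp
      simp only [Finset.mem_filter, Finset.mem_product, Finset.mem_range, Finset.mem_Icc]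
      exact ⟨⟨h1, hp.1⟩, by linarith [hp.2]⟩
    · rintro ⟨a, b⟩ _ ⟨c, d⟩ _ e
      simp only [Prod.mk.injEq] at e ⊢
      exact ⟨Fin.ext e.1, e.2⟩
    · rintro ⟨i, k⟩ hp
      simp only [Finset.mem_filter, Finset.mem_product, Finset.mem_range, Finset.mem_Icc] at hp
      refine ⟨(⟨i, by omega⟩, k), ?_, rfl⟩
      rw [mem_cnt]
      exact ⟨hp.1.2, by simp only; linarith [hp.2]⟩

/-- The map `Δ ↦ (π_Δ, P_Δ)` is a bijection from the regions of the `r`-Catalan arrangement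
`C_n^r` onto `S_n × D_n^r`: there is a bijection `Φ` from regions to pairs of a permutation
and an `r`-Dyck path (given by its height sequence) such that for every point `x` of the
complement, writing `Φ(Δ) = (π, h)` for the region `Δ` containing `x`, the permutation `π`
sorts the coordinates of `x` decreasingly, and
`h j = #{(i,k) ∈ [n]×[r] : x_{π(i)} - x_{π(j)} - k > 0}` (which for the region with
`π_Δ = id` is the height count of the statement, and in general realizes
`P_Δ = P_{π_Δ(Δ)}`). -/
theorem catalan_regions_equiv_perm_dyck (r n : ℕ) (hr : 0 < r) (hn : 0 < n) :
    ∃ Φ : ConnectedComponents ↥(catalanArrangementCompl r n) →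
        Equiv.Perm (Fin n) × DyckHeight r n,
      Function.Bijective Φ ∧
      ∀ x : ↥(catalanArrangementCompl r n),
        (∀ i j : Fin n, i < j →
            x.val ((Φ (ConnectedComponents.mk x)).1 j) <
              x.val ((Φ (ConnectedComponents.mk x)).1 i)) ∧
        (∀ j : Fin n,
            (Φ (ConnectedComponents.mk x)).2.val j =
              Nat.card {p : Fin n × ℕ | p.2 ∈ Finset.Icc 1 r ∧
                0 < x.val ((Φ (ConnectedComponents.mk x)).1 p.1) -
                    x.val ((Φ (ConnectedComponents.mk x)).1 j) - (p.2 : ℝ)}) := by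
  choose f hf using fun x : ↥(catalanArrangementCompl r n) => spec_exists x.2
  choose g hg using (ConnectedComponents.surjective_coe (α := ↥(catalanArrangementCompl r n)))
  have hΦ : ∀ x : ↥(catalanArrangementCompl r n),
      f (g (ConnectedComponents.mk x)) = f x := fun x =>
    spec_unique (spec_of_sameSign (sameSign_of_mk_eq _ _ (hg (ConnectedComponents.mk x))) (hf _))
      (hf x)
  refine ⟨fun c => f (g c), ⟨?_, ?_⟩, ?_⟩
  · intro c d hcd
    simp only at hcd
    rw [← hg c, ← hg d]
    refine mk_eq_of_sameSign _ _ (sameSign_of_spec (g c).2 (g d).2 (hf (g c)) ?_)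
    rw [hcd]
    exact hf (g d)
  · intro p
    obtain ⟨x, hx, hs⟩ := spec_surj p
    refine ⟨ConnectedComponents.mk ⟨x, hx⟩, ?_⟩
    simp only
    rw [hΦ]
    exact spec_unique (hf ⟨x, hx⟩) hs
  · intro x
    simp only [hΦ]
    refine ⟨fun i j hij => (hf x).1 hij, fun j => ?_⟩
    rw [(hf x).2 j, ← natCard_cnt]
    rfl
end

section
/- Let x, y ∈ ℝⁿ satisfy x_1 > x_2 > ⋯ > x_n and y_1 > y_2 > ⋯ > y_n, with x_i − x_j ≠ k and y_i − y_j ≠ k for all i ≠ j and all k ∈ {1,…,r}. If for every j ∈ {1,…,n} one has #{(i,k) ∈ {1,…,n}×{1,…,r} : x_i − x_j − k > 0} = #{(i,k) ∈ {1,…,n}×{1,…,r} : y_i − y_j − k > 0}, then for all i ≠ j and k ∈ {1,…,r}, the numbers x_i − x_j − k and y_i − y_j − k have the same sign; consequently x and y lie in the same region of the r-Catalan arrangement C_n^r. -/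
theorem aux_key (r n : ℕ) (x y : Fin n → ℝ)
    (hxdec : ∀ i j : Fin n, i < j → x j < x i)
    (hydec : ∀ i j : Fin n, i < j → y j < y i)
    (hcount : ∀ j : Fin n,
      Nat.card {p : Fin n × ℕ | p.2 ∈ Finset.Icc 1 r ∧ 0 < x p.1 - x j - (p.2 : ℝ)} =
        Nat.card {p : Fin n × ℕ | p.2 ∈ Finset.Icc 1 r ∧ 0 < y p.1 - y j - (p.2 : ℝ)})
    (j : Fin n) : {p : Fin n × ℕ | p.2 ∈ Finset.Icc 1 r ∧ 0 < x p.1 - x j - (p.2 : ℝ)} =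
        {p : Fin n × ℕ | p.2 ∈ Finset.Icc 1 r ∧ 0 < y p.1 - y j - (p.2 : ℝ)} := by
  have hanti : ∀ z : Fin n → ℝ, (∀ i j : Fin n, i < j → z j < z i) →
      ∀ i j : Fin n, z j < z i → i < j := by
    intro z hz i j h
    by_contra hc
    rcases eq_or_lt_of_le (not_lt.mp hc) with h1 | h1
    · subst h1; exact lt_irrefl _ h
    · exact lt_asymm h (hz _ _ h1)
  have hfin : ∀ z : Fin n → ℝ,
      {p : Fin n × ℕ | p.2 ∈ Finset.Icc 1 r ∧ 0 < z p.1 - z j - (p.2 : ℝ)}.Finite := by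
    intro z
    refine ((Set.finite_univ (α := Fin n)).prod (Finset.Icc 1 r).finite_toSet).subset ?_
    rintro ⟨i, k⟩ ⟨h, _⟩
    exact ⟨Set.mem_univ _, h⟩
  induction j using WellFoundedLT.induction with
  | ind j ih =>
  have ih' : ∀ l, l < j → ∀ i : Fin n, ∀ k : ℕ, 1 ≤ k → k ≤ r →
      (0 < x i - x l - (k : ℝ) ↔ 0 < y i - y l - (k : ℝ)) := by
    intro l hl i k h1 h2
    have := Set.ext_iff.mp (ih l hl (by
      intro z
      refine ((Set.finite_univ (α := Fin n)).prod (Finset.Icc 1 r).finite_toSet).subset ?_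
      rintro ⟨i, k⟩ ⟨h, _⟩
      exact ⟨Set.mem_univ _, h⟩)) (i, k)
    simpa [h1, h2] using this
  have hc := hcount j
  rw [Nat.card_coe_set_eq, Nat.card_coe_set_eq] at hc
  by_contra hne
  have e1 : ¬ {p : Fin n × ℕ | p.2 ∈ Finset.Icc 1 r ∧ 0 < x p.1 - x j - (p.2 : ℝ)} ⊆
        {p : Fin n × ℕ | p.2 ∈ Finset.Icc 1 r ∧ 0 < y p.1 - y j - (p.2 : ℝ)} :=
    fun h => hne (Set.eq_of_subset_of_ncard_le h hc.ge (hfin y))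
  have e2 : ¬ {p : Fin n × ℕ | p.2 ∈ Finset.Icc 1 r ∧ 0 < y p.1 - y j - (p.2 : ℝ)} ⊆
        {p : Fin n × ℕ | p.2 ∈ Finset.Icc 1 r ∧ 0 < x p.1 - x j - (p.2 : ℝ)} :=
    fun h => hne (Set.eq_of_subset_of_ncard_le h hc.le (hfin x)).symm
  obtain ⟨⟨i, k⟩, ⟨hk, hx1⟩, hy1⟩ := Set.not_subset.mp e1
  obtain ⟨⟨i', k'⟩, ⟨hk', hy2⟩, hx2⟩ := Set.not_subset.mp e2
  have hy1' : ¬ 0 < y i - y j - (k : ℝ) := fun h => hy1 ⟨hk, h⟩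
  have hx2' : ¬ 0 < x i' - x j - (k' : ℝ) := fun h => hx2 ⟨hk', h⟩
  simp only [Finset.mem_Icc] at hk hk' hx1 hy2
  have hkp : (0 : ℝ) ≤ k := Nat.cast_nonneg _
  have hkp' : (0 : ℝ) ≤ k' := Nat.cast_nonneg _
  have hij : i < j := hanti x hxdec _ _ (by linarith)
  have hij' : i' < j := hanti y hydec _ _ (by linarith)
  rcases lt_trichotomy k k' with h | h | h
  · have := ih' i hij i' (k' - k) (by omega) (by omega)
    rw [Nat.cast_sub h.le] at this
    have h3 := this.mpr (by linarith)
    linarith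
  · subst h
    have h1 := hanti x hxdec i i' (by linarith)
    have h2 := hydec _ _ h1
    linarith
  · have := ih' i' hij' i (k - k') (by omega) (by omega)
    rw [Nat.cast_sub h.le] at this
    have h3 := this.mp (by linarith)
    linarith

/-- Let `x, y ∈ ℝⁿ` be strictly decreasing and generic for the `r`-Catalan arrangement.
If for every `j` the counts `#{(i,k) : xᵢ - xⱼ - k > 0}` and `#{(i,k) : yᵢ - yⱼ - k > 0}`
agree, then all the quantities `xᵢ - xⱼ - k` and `yᵢ - yⱼ - k` (for `i ≠ j`, `k ∈ {1,…,r}`)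
have the same sign; consequently `x` and `y` lie in the same region of `C_n^r`. -/
theorem same_heights_same_region (r n : ℕ) (hr : 0 < r) (hn : 0 < n) (x y : Fin n → ℝ)
    (hxdec : ∀ i j : Fin n, i < j → x j < x i)
    (hydec : ∀ i j : Fin n, i < j → y j < y i)
    (hxgen : ∀ i j : Fin n, i ≠ j → ∀ k ∈ Finset.Icc 1 r, x i - x j ≠ (k : ℝ))
    (hygen : ∀ i j : Fin n, i ≠ j → ∀ k ∈ Finset.Icc 1 r, y i - y j ≠ (k : ℝ))
    (hcount : ∀ j : Fin n,
      Nat.card {p : Fin n × ℕ | p.2 ∈ Finset.Icc 1 r ∧ 0 < x p.1 - x j - (p.2 : ℝ)} =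
        Nat.card {p : Fin n × ℕ | p.2 ∈ Finset.Icc 1 r ∧ 0 < y p.1 - y j - (p.2 : ℝ)}) :
    (∀ i j : Fin n, i ≠ j → ∀ k ∈ Finset.Icc 1 r,
        Real.sign (x i - x j - (k : ℝ)) = Real.sign (y i - y j - (k : ℝ))) ∧
      ∀ (hxC : x ∈ catalanArrangementCompl r n) (hyC : y ∈ catalanArrangementCompl r n),
        ConnectedComponents.mk (⟨x, hxC⟩ : ↥(catalanArrangementCompl r n)) =
          ConnectedComponents.mk ⟨y, hyC⟩ := by
  have key : ∀ i j : Fin n, ∀ k ∈ Finset.Icc 1 r,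
      (0 < x i - x j - (k : ℝ) ↔ 0 < y i - y j - (k : ℝ)) := by
    intro i j k hk
    have := Set.ext_iff.mp (aux_key r n x y hxdec hydec hcount j) (i, k)
    simp only [Set.mem_setOf_eq, hk, true_and] at this
    exact this
  refine ⟨?_, ?_⟩
  · intro i j hij k hk
    have h := key i j k hk
    by_cases hx : 0 < x i - x j - (k : ℝ)
    · rw [Real.sign_of_pos hx, Real.sign_of_pos (h.mp hx)]
    · have hy : ¬ 0 < y i - y j - (k : ℝ) := fun h' => hx (h.mpr h')
      rw [Real.sign_of_neg (lt_of_le_of_ne (not_lt.mp hx) (sub_ne_zero.mpr (hxgen i j hij k hk))),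
        Real.sign_of_neg (lt_of_le_of_ne (not_lt.mp hy) (sub_ne_zero.mpr (hygen i j hij k hk)))]
  · intro hxC hyC
    have hseg : segment ℝ x y ⊆ catalanArrangementCompl r n := by
      rintro z ⟨a, b, ha, hb, hab, rfl⟩ i j hij s hs1 hs2 heq
      have comb : ∀ u v : ℝ, 0 < u → 0 < v → 0 < a * u + b * v := by
        intro u v hu hv
        rcases eq_or_lt_of_le ha with h | h
        · have : b = 1 := by linarith
          subst this; subst h; linarith
        · have := mul_pos h hu
          have := mul_nonneg hb hv.le
          linarith
      simp only [Pi.add_apply, Pi.smul_apply, smul_eq_mul] at heq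
      have hbs : b = 1 - a := by linarith
      rcases le_or_gt s 0 with h0 | h0
      · have h1 := comb _ _ (sub_pos.mpr (hxdec i j hij)) (sub_pos.mpr (hydec i j hij))
        have : (s : ℝ) ≤ 0 := by exact_mod_cast h0
        linarith
      · lift s to ℕ using h0.le
        have hk : s ∈ Finset.Icc 1 r := by
          rw [Finset.mem_Icc]; omega
        have h := key i j s hk
        rw [Int.cast_natCast] at heq
        by_cases hx : 0 < x i - x j - (s : ℝ)
        · have h1 := comb _ _ hx (h.mp hx)
          subst hbs
          linarith
        · have hy : ¬ 0 < y i - y j - (s : ℝ) := fun h' => hx (h.mpr h')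
          have hx' := lt_of_le_of_ne (not_lt.mp hx) (sub_ne_zero.mpr (hxgen i j hij.ne s hk))
          have hy' := lt_of_le_of_ne (not_lt.mp hy) (sub_ne_zero.mpr (hygen i j hij.ne s hk))
          have h1 := comb _ _ (neg_pos.mpr hx') (neg_pos.mpr hy')
          subst hbs
          linarith
    have hJ := (JoinedIn.of_segment_subset hseg).joined_subtype
    rw [ConnectedComponents.coe_eq_coe]
    exact connectedComponent_eq (pathComponent_subset_component _ hJ)
end

section
/- For a region Δ of the r-Shi arrangement S_n^r and x ∈ Δ, set λ_i(Δ) = #{(j,k) ∈ {1,…,n}×{1,…,r} : c_{ijk}(x) > 0} for each i ∈ {1,…,n}. Then λ_i(Δ) is independent of the choice of x ∈ Δ, and the map Δ ↦ (λ_1(Δ),…,λ_n(Δ)) is a bijection from the set of regions of S_n^r onto the set of r-parking functions of length n. -/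
/-- The cubic matrix entry `c_{ijk}(x)`: equal to `xᵢ - xⱼ - k` if `i < j`, to `0` if
`i = j`, and to `xᵢ - xⱼ - k + 1` if `i > j` (here `k` is the actual value in `{1,…,r}`). -/
noncomputable def cEntry {n : ℕ} (x : Fin n → ℝ) (i j : Fin n) (k : ℕ) : ℝ :=
  if i < j then x i - x j - k else if j < i then x i - x j - k + 1 else 0

/-- The complement of the `r`-Shi arrangement in `ℝⁿ`, i.e. the set of points that are
generic for `S_n^r`: `c_{ijk}(x) ≠ 0` for all `i ≠ j` and `k ∈ {1,…,r}`. -/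
def shiCompl (r n : ℕ) : Set (Fin n → ℝ) :=
  {x | ∀ i j : Fin n, i ≠ j → ∀ k ∈ Finset.Icc 1 r, cEntry x i j k ≠ 0}

/-- The `j`-th column slice of the cubic matrix `C_x` has its (unique) minimal positive
entry at position `(p, q)`. -/
def IsMinPosAt (r : ℕ) {n : ℕ} (x : Fin n → ℝ) (j p : Fin n) (q : ℕ) : Prop :=
  q ∈ Finset.Icc 1 r ∧ 0 < cEntry x p j q ∧
    ∀ i : Fin n, ∀ k ∈ Finset.Icc 1 r, 0 < cEntry x i j k → cEntry x p j q ≤ cEntry x i j k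

open Finset Filter Topology

/-- shift of the `k`-th shadow of `i` as seen by `j` -/
noncomputable def shf {n : ℕ} (j i : Fin n) (k : ℕ) : ℝ := if j < i then (k : ℝ) else (k : ℝ) - 1

/-- shadows of points of `A` that an observer `j` at position `u` has passed -/
noncomputable def sset (r : ℕ) {n : ℕ} (x : Fin n → ℝ) (A : Finset (Fin n)) (j : Fin n) (u : ℝ) :
    Finset (Fin n × ℕ) :=
  (A ×ˢ Finset.Icc 1 r).filter (fun p => x p.1 + shf j p.1 p.2 < u)

lemma mem_sset {r n : ℕ} {x : Fin n → ℝ} {A : Finset (Fin n)} {j : Fin n} {u : ℝ}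
    {p : Fin n × ℕ} :
    p ∈ sset r x A j u ↔ (p.1 ∈ A ∧ (1 ≤ p.2 ∧ p.2 ≤ r)) ∧ x p.1 + shf j p.1 p.2 < u := by
  simp [sset]

lemma shf_nonneg {n : ℕ} (j i : Fin n) {k : ℕ} (hk : 1 ≤ k) : 0 ≤ shf j i k := by
  have : (1 : ℝ) ≤ k := by exact_mod_cast hk
  unfold shf; split_ifs <;> linarith

lemma cEntry_pos {n : ℕ} (x : Fin n → ℝ) (i j : Fin n) {k : ℕ} (hk : 1 ≤ k) :
    0 < cEntry x i j k ↔ x j + shf i j k < x i := by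
  have : (1 : ℝ) ≤ k := by exact_mod_cast hk
  unfold cEntry shf
  split_ifs with h1 h2
  · constructor <;> intro h <;> linarith
  · constructor <;> intro h <;> linarith
  · have : i = j := le_antisymm (not_lt.1 h2) (not_lt.1 h1)
    subst this
    constructor <;> intro h <;> linarith

noncomputable def lamf (r : ℕ) {n : ℕ} (x : Fin n → ℝ) (i : Fin n) : ℕ :=
  (sset r x Finset.univ i (x i)).card

lemma card_eq_lamf (r : ℕ) {n : ℕ} (x : Fin n → ℝ) (i : Fin n) :
    Nat.card {p : Fin n × ℕ | p.2 ∈ Finset.Icc 1 r ∧ 0 < cEntry x i p.1 p.2} = lamf r x i := by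
  have : {p : Fin n × ℕ | p.2 ∈ Finset.Icc 1 r ∧ 0 < cEntry x i p.1 p.2}
      = ((sset r x Finset.univ i (x i) : Finset (Fin n × ℕ)) : Set (Fin n × ℕ)) := by
    ext p
    simp only [Set.mem_ofPred_eq, Finset.mem_coe, mem_sset, Finset.mem_univ, true_and,
      Finset.mem_Icc]
    constructor
    · rintro ⟨h, h'⟩; exact ⟨h, (cEntry_pos x i p.1 h.1).1 h'⟩
    · rintro ⟨h, h'⟩; exact ⟨h, (cEntry_pos x i p.1 h.1).2 h'⟩
  rw [this, lamf]
  simp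

lemma sset_mono {r n : ℕ} (x : Fin n → ℝ) {A B : Finset (Fin n)} (h : A ⊆ B) (j : Fin n)
    {u v : ℝ} (huv : u ≤ v) : sset r x A j u ⊆ sset r x B j v := by
  intro p hp
  rw [mem_sset] at *
  exact ⟨⟨h hp.1.1, hp.1.2⟩, lt_of_lt_of_le hp.2 huv⟩

/-- if everything outside `A` is weakly right of `u`, only `A` is seen. -/
lemma sset_univ_eq {r n : ℕ} (x : Fin n → ℝ) {A : Finset (Fin n)} (j : Fin n) {u : ℝ}
    (h : ∀ b, b ∉ A → u ≤ x b) : sset r x Finset.univ j u = sset r x A j u := by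
  ext p
  rw [mem_sset, mem_sset]
  constructor
  · rintro ⟨⟨_, h1⟩, h2⟩
    refine ⟨⟨?_, h1⟩, h2⟩
    by_contra hb
    have := h _ hb
    have := shf_nonneg j p.1 h1.1
    linarith
  · rintro ⟨⟨_, h1⟩, h2⟩
    exact ⟨⟨Finset.mem_univ _, h1⟩, h2⟩

/-- sign agreement on `A` -/
def Agree (r : ℕ) {n : ℕ} (x y : Fin n → ℝ) (A : Finset (Fin n)) : Prop :=
  ∀ i ∈ A, ∀ j ∈ A, i ≠ j → ∀ k, 1 ≤ k → k ≤ r →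
    (x j + shf i j k < x i ↔ y j + shf i j k < y i)

lemma shi_ne {r n : ℕ} {x : Fin n → ℝ} (hx : x ∈ shiCompl r n) {i j : Fin n} (hij : i ≠ j)
    {k : ℕ} (h1 : 1 ≤ k) (h2 : k ≤ r) : x j + shf i j k ≠ x i := by
  have := hx i j hij k (Finset.mem_Icc.2 ⟨h1, h2⟩)
  intro h
  apply this
  unfold cEntry
  unfold shf at h
  rcases lt_or_gt_of_ne hij with h' | h'
  · rw [if_pos h'] at *; linarith
  · rw [if_neg (not_lt.2 h'.le)] at *; rw [if_pos h']; linarith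

lemma shi_inj {r n : ℕ} (hr : 0 < r) {x : Fin n → ℝ} (hx : x ∈ shiCompl r n) {i j : Fin n}
    (hij : i ≠ j) : x i ≠ x j := by
  rcases lt_or_gt_of_ne hij with h' | h'
  · have := shi_ne hx hij.symm (k := 1) le_rfl hr
    simpa [shf, not_lt.2 h'.le] using this
  · have := shi_ne hx hij (k := 1) le_rfl hr
    have h2 : x j ≠ x i := by simpa [shf, not_lt.2 h'.le] using this
    exact h2.symm

lemma agree_symm {r n : ℕ} {x y : Fin n → ℝ} {A : Finset (Fin n)} (h : Agree r x y A) :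
    Agree r y x A := fun i hi j hj hij k h1 h2 => (h i hi j hj hij k h1 h2).symm

/-- No Shi hyperplane separates `x` and `y` on `A`. -/
lemma agree_no_sep {r n : ℕ} {x y : Fin n → ℝ} {A : Finset (Fin n)}
    (hx : x ∈ shiCompl r n) (hy : y ∈ shiCompl r n) (h : Agree r x y A)
    {i i' j : Fin n} (hi : i ∈ A) (hi' : i' ∈ A) (hji : j ≠ i) (hji' : j ≠ i') (hii : i ≠ i')
    {k k' : ℕ} (h1 : 1 ≤ k) (h2 : k ≤ r) (h1' : 1 ≤ k') (h2' : k' ≤ r)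
    (hX : x i + shf j i k < x i' + shf j i' k') (hY : y i' + shf j i' k' < y i + shf j i k) :
    False := by
  -- the integer s
  obtain ⟨s, hs, hs1⟩ : ∃ s : ℤ, shf j i' k' - shf j i k = s ∧
      ((∃ q : ℕ, 1 ≤ q ∧ q ≤ r ∧ shf i i' q = s) ∨ (∃ q : ℕ, 1 ≤ q ∧ q ≤ r ∧ shf i' i q = -s)) := by
    set e : ℤ := if j < i then 0 else 1 with he
    set e' : ℤ := if j < i' then 0 else 1 with he'
    have a1 : shf j i k = ((k - e : ℤ) : ℝ) := by
      unfold shf; rw [he]; split_ifs <;> push_cast <;> ring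
    have a2 : shf j i' k' = ((k' - e' : ℤ) : ℝ) := by
      unfold shf; rw [he']; split_ifs <;> push_cast <;> ring
    refine ⟨(k' - e') - (k - e), by rw [a1, a2]; push_cast; ring, ?_⟩
    set s : ℤ := (k' - e') - (k - e) with hs
    have b1 : ∀ q : ℕ, shf i i' q = ((q - (if i < i' then 0 else 1) : ℤ) : ℝ) := by
      intro q; unfold shf; split_ifs <;> push_cast <;> ring
    have b2 : ∀ q : ℕ, shf i' i q = ((q - (if i' < i then 0 else 1) : ℤ) : ℝ) := by
      intro q; unfold shf; split_ifs <;> push_cast <;> ring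
    rcases lt_or_gt_of_ne hii with hlt | hlt
    · have : e' ≤ e := by
        rw [he, he']; split_ifs <;> first | omega | (exfalso; order)
      have e1 : e ≤ 1 := by rw [he]; split_ifs <;> omega
      have e0 : 0 ≤ e' := by rw [he']; split_ifs <;> omega
      by_cases hsp : 1 ≤ s
      · left
        refine ⟨s.toNat, by omega, by omega, ?_⟩
        rw [b1, if_pos hlt]; congr 1; omega
      · right
        refine ⟨(1 - s).toNat, by omega, by omega, ?_⟩
        rw [b2, if_neg (not_lt.2 hlt.le)]; rw [← Int.cast_neg]; congr 1; omega
    · have : e ≤ e' := by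
        rw [he, he']; split_ifs <;> first | omega | (exfalso; order)
      have e1 : e' ≤ 1 := by rw [he']; split_ifs <;> omega
      have e0 : 0 ≤ e := by rw [he]; split_ifs <;> omega
      by_cases hsp : 0 ≤ s
      · left
        refine ⟨(s + 1).toNat, by omega, by omega, ?_⟩
        rw [b1, if_neg (not_lt.2 hlt.le)]; congr 1; omega
      · right
        refine ⟨(- s).toNat, by omega, by omega, ?_⟩
        rw [b2, if_pos hlt]; rw [← Int.cast_neg]; congr 1; omega
  rcases hs1 with ⟨q, q1, q2, hq⟩ | ⟨q, q1, q2, hq⟩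
  · have := (h i hi i' hi' hii q q1 q2).2 (by rw [hq]; linarith)
    rw [hq] at this; linarith
  · have := (h i' hi' i hi hii.symm q q1 q2).1 (by rw [hq]; linarith)
    rw [hq] at this; linarith

lemma nested {r n : ℕ} {x y : Fin n → ℝ} {A : Finset (Fin n)}
    (hx : x ∈ shiCompl r n) (hy : y ∈ shiCompl r n) (h : Agree r x y A)
    {j : Fin n} (hj : j ∉ A) (u v : ℝ) :
    sset r x A j u ⊆ sset r y A j v ∨ sset r y A j v ⊆ sset r x A j u := by
  by_contra hcon
  rw [not_or, Finset.not_subset, Finset.not_subset] at hcon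
  obtain ⟨⟨⟨i, k⟩, hp, hp'⟩, ⟨⟨i', k'⟩, hq, hq'⟩⟩ := hcon
  rw [mem_sset] at hp hp' hq hq'
  simp only at hp hp' hq hq'
  have g1 : v ≤ y i + shf j i k := by
    by_contra hlt; exact hp' ⟨hp.1, not_le.1 hlt⟩
  have g2 : u ≤ x i' + shf j i' k' := by
    by_contra hlt; exact hq' ⟨hq.1, not_le.1 hlt⟩
  have ji : j ≠ i := fun e => hj (e ▸ hp.1.1)
  have ji' : j ≠ i' := fun e => hj (e ▸ hq.1.1)
  by_cases hii : i = i'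
  · subst hii; linarith
  · exact agree_no_sep hx hy h hp.1.1 hq.1.1 ji ji' hii hp.1.2.1 hp.1.2.2 hq.1.2.1 hq.1.2.2
      (by linarith) (by linarith)

lemma nested_card {r n : ℕ} {x y : Fin n → ℝ} {A : Finset (Fin n)}
    (hx : x ∈ shiCompl r n) (hy : y ∈ shiCompl r n) (h : Agree r x y A)
    {j : Fin n} (hj : j ∉ A) (u v : ℝ)
    (hc : (sset r x A j u).card ≤ (sset r y A j v).card) :
    sset r x A j u ⊆ sset r y A j v := by
  rcases nested hx hy h hj u v with h | h
  · exact h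
  · rw [Finset.eq_of_subset_of_card_le h hc]

/-- the impossible case: next points differ, `j < j'`. -/
lemma next_not_lt {r n : ℕ} (hr : 0 < r) {x y : Fin n → ℝ} {A : Finset (Fin n)}
    (hx : x ∈ shiCompl r n) (hy : y ∈ shiCompl r n) (h : Agree r x y A)
    (hl : lamf r x = lamf r y) {j j' : Fin n} (hj : j ∉ A) (hj' : j' ∉ A)
    (hA : ∀ a ∈ A, x a < x j)
    (mx : ∀ b, b ∉ A → x j ≤ x b) (my : ∀ b, b ∉ A → y j' ≤ y b) (hlt : j < j') : False := by
  have s1 : sset r y A j (y j') ⊆ sset r x A j (x j) := by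
    apply nested_card hy hx (agree_symm h) hj
    calc _ ≤ lamf r y j := Finset.card_le_card (sset_mono y (Finset.subset_univ _) j (my j hj))
      _ = lamf r x j := by rw [hl]
      _ = _ := by rw [lamf, sset_univ_eq x j mx]
  have s2 : (sset r x A j' (x j)).card < (sset r y A j' (y j')).card := by
    have e : (sset r y A j' (y j')).card = lamf r x j' := by
      rw [hl, lamf, sset_univ_eq y j' my]
    rw [e]
    apply Finset.card_lt_card
    rw [Finset.ssubset_iff_of_subset (sset_mono x (Finset.subset_univ _) j' (mx j' hj'))]
    refine ⟨(j, 1), ?_, ?_⟩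
    · rw [mem_sset]
      refine ⟨⟨Finset.mem_univ _, le_rfl, hr⟩, ?_⟩
      have := lt_of_le_of_ne (mx j' hj') (shi_inj hr hx hlt.ne)
      simpa [shf, not_lt.2 hlt.le] using this
    · rw [mem_sset]; exact fun hh => hj hh.1.1
  obtain ⟨⟨i, k⟩, hp, hp'⟩ := Finset.exists_mem_notMem_of_card_lt_card s2
  rw [mem_sset] at hp hp'
  simp only at hp hp'
  have g1 : x j ≤ x i + shf j' i k := by
    by_contra hlt; exact hp' ⟨hp.1, not_le.1 hlt⟩
  have key : ∀ q : ℕ, 1 ≤ q → q ≤ r → shf j i q = shf j' i k → False := by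
    intro q q1 q2 hq
    have m : (i, q) ∈ sset r y A j (y j') := by
      rw [mem_sset]; exact ⟨⟨hp.1.1, q1, q2⟩, by simp only [hq]; exact hp.2⟩
    have := s1 m
    rw [mem_sset] at this
    simp only [hq] at this
    linarith [this.2]
  have ji : j ≠ i := fun e => hj (e ▸ hp.1.1)
  have ji' : j' ≠ i := fun e => hj' (e ▸ hp.1.1)
  obtain ⟨hiA, k1, k2⟩ := hp.1
  by_cases c1 : j < i
  · by_cases c2 : j' < i
    · exact key k k1 k2 (by simp [shf, c1, c2])
    · rcases Nat.eq_or_lt_of_le k1 with hk | hk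
      · subst hk
        have := hA i hiA
        simp [shf, c2] at g1
        linarith
      · refine key (k - 1) (by omega) (by omega) ?_
        simp [shf, c1, c2, Nat.cast_sub k1]
  · have c2 : ¬ j' < i := by intro hh; exact c1 (hlt.trans hh)
    exact key k k1 k2 (by simp [shf, c1, c2])

lemma lam_inj {r n : ℕ} (hr : 0 < r) {x y : Fin n → ℝ}
    (hx : x ∈ shiCompl r n) (hy : y ∈ shiCompl r n) (hl : lamf r x = lamf r y) :
    Agree r x y Finset.univ := by
  have main : ∀ m : ℕ, m ≤ n → ∃ A : Finset (Fin n), A.card = m ∧ Agree r x y A ∧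
      ∀ a ∈ A, ∀ b, b ∉ A → x a < x b ∧ y a < y b := by
    intro m
    induction m with
    | zero => intro _; exact ⟨∅, rfl, by intro i hi; simp at hi, by intro a ha; simp at ha⟩
    | succ m ih =>
      intro hm
      obtain ⟨A, hc, hag, hlow⟩ := ih (by omega)
      have hne : (Aᶜ).Nonempty := by
        rw [← Finset.card_pos, Finset.card_compl, Fintype.card_fin]; omega
      obtain ⟨j, hj, mx⟩ := Finset.exists_min_image Aᶜ x hne
      obtain ⟨j', hj', my⟩ := Finset.exists_min_image Aᶜ y hne
      simp only [Finset.mem_compl] at hj hj' mx my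
      have hjj : j = j' := by
        rcases lt_trichotomy j j' with hlt | he | hlt
        · exact (next_not_lt hr hx hy hag hl hj hj' (fun a ha => (hlow a ha j hj).1)
            mx my hlt).elim
        · exact he
        · exact (next_not_lt hr hy hx (agree_symm hag) hl.symm hj' hj
            (fun a ha => (hlow a ha j' hj').2) my mx hlt).elim
      subst hjj
      have ce : (sset r x A j (x j)).card = (sset r y A j (y j)).card := by
        rw [← sset_univ_eq x j mx, ← sset_univ_eq y j my]
        exact congrFun hl j
      have se : sset r x A j (x j) = sset r y A j (y j) :=
        Finset.eq_of_subset_of_card_le (nested_card hx hy hag hj _ _ ce.le) ce.ge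
      refine ⟨insert j A, by rw [Finset.card_insert_of_notMem hj, hc], ?_, ?_⟩
      · intro a ha b hb hab k k1 k2
        rw [Finset.mem_insert] at ha hb
        rcases ha with rfl | ha <;> rcases hb with rfl | hb
        · exact absurd rfl hab
        · have := Finset.ext_iff.1 se (b, k)
          rw [mem_sset, mem_sset] at this
          simpa [hb, k1, k2] using this
        · have := hlow a ha b hj
          have := shf_nonneg a b k1
          constructor <;> intro _ <;> exfalso <;> linarith
        · exact hag a ha b hb hab k k1 k2
      · intro a ha b hb
        rw [Finset.mem_insert, not_or] at hb
        rw [Finset.mem_insert] at ha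
        rcases ha with rfl | ha
        · exact ⟨lt_of_le_of_ne (mx b hb.2) (shi_inj hr hx (Ne.symm hb.1)),
            lt_of_le_of_ne (my b hb.2) (shi_inj hr hy (Ne.symm hb.1))⟩
        · exact hlow a ha b hb.2
  obtain ⟨A, hc, hag, _⟩ := main n le_rfl
  have : A = Finset.univ := by
    rw [← Finset.card_eq_iff_eq_univ, Fintype.card_fin]; exact hc
  rw [← this]; exact hag

lemma parking_of_perm {r n : ℕ} (α : Fin n → ℕ) (τ : Equiv.Perm (Fin n))
    (h : ∀ i : Fin n, α (τ i) ≤ r * i.val) : IsRParkingFunction r n α := by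
  refine ⟨Tuple.sort α, Tuple.monotone_sort α, ?_⟩
  intro i
  by_contra hcon
  rw [not_le] at hcon
  have hsub : (Finset.Iic i).image τ ⊆ (Finset.Iio i).image (Tuple.sort α) := by
    intro a ha
    rw [Finset.mem_image] at ha ⊢
    obtain ⟨b, hb, rfl⟩ := ha
    rw [Finset.mem_Iic] at hb
    refine ⟨(Tuple.sort α).symm (τ b), ?_, by simp⟩
    rw [Finset.mem_Iio]
    by_contra hge
    rw [not_lt] at hge
    have h1 := Tuple.monotone_sort α hge
    simp only [Function.comp_apply, Equiv.apply_symm_apply] at h1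
    have h2 := h b
    have h3 : r * b.val ≤ r * i.val := Nat.mul_le_mul_left r hb
    omega
  have := Finset.card_le_card hsub
  rw [Finset.card_image_of_injective _ τ.injective,
    Finset.card_image_of_injective _ (Tuple.sort α).injective] at this
  simp at this

lemma lamf_parking {r n : ℕ} (x : Fin n → ℝ) : IsRParkingFunction r n (lamf r x) := by
  apply parking_of_perm _ (Tuple.sort x)
  intro i
  have hsub : sset r x Finset.univ (Tuple.sort x i) (x (Tuple.sort x i)) ⊆
      ((Finset.Iio i).image (Tuple.sort x)) ×ˢ Finset.Icc 1 r := by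
    intro p hp
    rw [mem_sset] at hp
    rw [Finset.mem_product, Finset.mem_image, Finset.mem_Icc]
    refine ⟨⟨(Tuple.sort x).symm p.1, ?_, by simp⟩, hp.1.2⟩
    rw [Finset.mem_Iio]
    by_contra hge
    rw [not_lt] at hge
    have h1 := Tuple.monotone_sort x hge
    simp only [Function.comp_apply, Equiv.apply_symm_apply] at h1
    have := shf_nonneg (Tuple.sort x i) p.1 hp.1.2.1
    linarith [hp.2]
  have := Finset.card_le_card hsub
  rw [Finset.card_product, Finset.card_image_of_injective _ (Tuple.sort x).injective] at this
  simp at this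
  rw [lamf, mul_comm]
  exact this

lemma parking_exists {r n : ℕ} {α : Fin n → ℕ} (h : IsRParkingFunction r n α)
    (A : Finset (Fin n)) (hA : A.card < n) : ∃ j, j ∉ A ∧ α j ≤ r * A.card := by
  obtain ⟨σ, hm, hb⟩ := h
  have : A.card < ((Finset.Iic (⟨A.card, hA⟩ : Fin n)).image σ).card := by
    rw [Finset.card_image_of_injective _ σ.injective]; simp
  obtain ⟨j, hj, hj'⟩ := Finset.exists_mem_notMem_of_card_lt_card this
  refine ⟨j, hj', ?_⟩
  rw [Finset.mem_image] at hj
  obtain ⟨b, hb', rfl⟩ := hj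
  refine (hb b).trans (Nat.mul_le_mul_left r ?_)
  rw [Finset.mem_Iic] at hb'
  exact hb'

lemma sset_left {r n : ℕ} (x : Fin n → ℝ) (A : Finset (Fin n)) (u : ℝ) :
    ∃ w < u, ∀ v, w < v → v ≤ u → ∀ j, sset r x A j v = sset r x A j u := by
  have h : ∀ᶠ v in 𝓝 u, ∀ j : Fin n, ∀ p ∈ A ×ˢ Finset.Icc 1 r,
      x p.1 + shf j p.1 p.2 < u → x p.1 + shf j p.1 p.2 < v := by
    rw [eventually_all]
    intro j
    rw [Filter.eventually_all_finset]
    intro p _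
    by_cases hp : x p.1 + shf j p.1 p.2 < u
    · filter_upwards [lt_mem_nhds hp] with v hv _ using hv
    · exact Eventually.of_forall fun v h => absurd h hp
  obtain ⟨ε, hε, H⟩ := Metric.eventually_nhds_iff.1 h
  refine ⟨u - ε, by linarith, ?_⟩
  intro v h1 h2 j
  apply Finset.Subset.antisymm (sset_mono x subset_rfl j h2)
  intro p hp
  have hv : dist v u < ε := by rw [Real.dist_eq, abs_lt]; constructor <;> linarith
  unfold sset at *
  rw [Finset.mem_filter] at *
  exact ⟨hp.1, H hv j p hp.1 hp.2⟩

/-- genericity on `A` -/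
def Gen {n : ℕ} (x : Fin n → ℝ) (A : Finset (Fin n)) : Prop :=
  ∀ i ∈ A, ∀ j ∈ A, i ≠ j → ∀ s : ℤ, x i - x j ≠ s

lemma shf_int {n : ℕ} (j i : Fin n) (k : ℕ) : ∃ s : ℤ, shf j i k = s := by
  unfold shf; split_ifs
  · exact ⟨k, by simp⟩
  · exact ⟨k - 1, by simp⟩

lemma sset_right {r n : ℕ} (x : Fin n → ℝ) (A : Finset (Fin n)) (hg : Gen x A) (u : ℝ) :
    ∃ w > u, ∀ j, (sset r x A j w).card ≤ (sset r x A j u).card + 1 := by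
  have h : ∀ᶠ v in 𝓝 u, ∀ j : Fin n, ∀ p ∈ A ×ˢ Finset.Icc 1 r,
      u < x p.1 + shf j p.1 p.2 → v < x p.1 + shf j p.1 p.2 := by
    rw [eventually_all]
    intro j
    rw [Filter.eventually_all_finset]
    intro p _
    by_cases hp : u < x p.1 + shf j p.1 p.2
    · filter_upwards [gt_mem_nhds hp] with v hv _ using hv
    · exact Eventually.of_forall fun v h => absurd h hp
  obtain ⟨ε, hε, H⟩ := Metric.eventually_nhds_iff.1 h
  refine ⟨u + ε / 2, by linarith, ?_⟩
  intro j
  have hv : dist (u + ε / 2) u < ε := by rw [Real.dist_eq, abs_lt]; constructor <;> linarith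
  set T := (A ×ˢ Finset.Icc 1 r).filter (fun p => x p.1 + shf j p.1 p.2 = u) with hT
  have hT1 : T.card ≤ 1 := by
    rw [Finset.card_le_one]
    rintro ⟨a, k⟩ ha ⟨b, l⟩ hb
    simp only [hT, Finset.mem_filter, Finset.mem_product] at ha hb
    have hab : a = b := by
      by_contra hne
      obtain ⟨s, hs⟩ := shf_int j a k
      obtain ⟨t, ht⟩ := shf_int j b l
      apply hg a ha.1.1 b hb.1.1 hne (t - s)
      push_cast
      rw [← hs, ← ht]; linarith
    subst hab
    have : shf j a k = shf j a l := by linarith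
    have hk : (k : ℝ) = l := by
      unfold shf at this; split_ifs at this <;> linarith
    have hk' : k = l := by exact_mod_cast hk
    rw [hk']
  have hsub : sset r x A j (u + ε / 2) ⊆ sset r x A j u ∪ T := by
    intro p hp
    unfold sset at *
    rw [Finset.mem_union, hT, Finset.mem_filter, Finset.mem_filter]
    rw [Finset.mem_filter] at hp
    rcases lt_trichotomy (x p.1 + shf j p.1 p.2) u with h1 | h1 | h1
    · exact Or.inl ⟨hp.1, h1⟩
    · exact Or.inr ⟨hp.1, h1⟩
    · exact absurd hp.2 (not_lt.2 (H hv j p hp.1 h1).le)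
  calc _ ≤ _ := Finset.card_le_card hsub
    _ ≤ _ := Finset.card_union_le _ _
    _ ≤ _ := by omega

lemma sset_large {r n : ℕ} (x : Fin n → ℝ) (A : Finset (Fin n)) :
    ∃ W, ∀ u ≥ W, ∀ j, (sset r x A j u).card = r * A.card := by
  have h : ∀ᶠ v in (atTop : Filter ℝ), ∀ j : Fin n, ∀ p ∈ A ×ˢ Finset.Icc 1 r,
      x p.1 + shf j p.1 p.2 < v := by
    rw [eventually_all]
    intro j
    rw [Filter.eventually_all_finset]
    intro p _
    exact eventually_gt_atTop _
  obtain ⟨W, hW⟩ := eventually_atTop.1 h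
  refine ⟨W, fun u hu j => ?_⟩
  rw [sset, Finset.filter_true_of_mem (hW u hu j), Finset.card_product, mul_comm]
  simp

lemma exists_stop {r n : ℕ} {α : Fin n → ℕ} (hα : IsRParkingFunction r n α)
    (x : Fin n → ℝ) (A : Finset (Fin n)) (hA : A.card < n) (hg : Gen x A) (M : ℝ)
    (hM : ∀ j, j ∉ A → (sset r x A j M).card ≤ α j) :
    ∃ u ≥ M, (∀ j, j ∉ A → (sset r x A j u).card ≤ α j) ∧
      ∃ j, j ∉ A ∧ (sset r x A j u).card = α j := by
  set U : Set ℝ := {u | ∀ j, j ∉ A → (sset r x A j u).card ≤ α j} with hU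
  by_cases hb : BddAbove U
  · have hne : U.Nonempty := ⟨M, hM⟩
    have hmem : sSup U ∈ U := by
      obtain ⟨w, hw, H⟩ := sset_left (r := r) x A (sSup U)
      obtain ⟨v, hv, hwv⟩ := exists_lt_of_lt_csSup hne hw
      intro j hj
      rw [← H v hwv (le_csSup hb hv) j]
      exact hv j hj
    refine ⟨sSup U, le_csSup hb hM, hmem, ?_⟩
    by_contra hcon
    push Not at hcon
    obtain ⟨w, hw, H⟩ := sset_right (r := r) x A hg (sSup U)
    have : w ∈ U := by
      intro j hj
      have h1 := hcon j hj
      have h2 := hmem j hj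
      have h3 := H j
      omega
    exact absurd (le_csSup hb this) (not_le.2 hw)
  · obtain ⟨W, hW⟩ := sset_large (r := r) x A
    rw [not_bddAbove_iff] at hb
    obtain ⟨u, hu, hlt⟩ := hb (max W M)
    refine ⟨u, ((le_max_right _ _).trans hlt.le), hu, ?_⟩
    obtain ⟨j, hj, hle⟩ := parking_exists hα A hA
    refine ⟨j, hj, le_antisymm (hu j hj) ?_⟩
    rw [hW u ((le_max_left _ _).trans hlt.le)]
    exact hle

lemma exists_generic {n : ℕ} (x : Fin n → ℝ) {a b : ℝ} (hab : a < b) :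
    ∃ u, a < u ∧ u < b ∧ ∀ i, ∀ s : ℤ, u - x i ≠ s := by
  have hc : (Set.range (fun p : Fin n × ℤ => x p.1 + p.2)).Countable := Set.countable_range _
  obtain ⟨u, hu, h1, h2⟩ := (hc.dense_compl ℝ).exists_between hab
  refine ⟨u, h1, h2, fun i s h => hu ⟨(i, s), ?_⟩⟩
  simp only; linarith

lemma sset_congr {r n : ℕ} {x y : Fin n → ℝ} {A : Finset (Fin n)} (h : ∀ a ∈ A, x a = y a)
    (j : Fin n) (u : ℝ) : sset r x A j u = sset r y A j u := by
  ext p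
  rw [mem_sset, mem_sset]
  constructor
  · rintro ⟨h1, h2⟩; exact ⟨h1, by rw [← h _ h1.1]; exact h2⟩
  · rintro ⟨h1, h2⟩; exact ⟨h1, by rw [h _ h1.1]; exact h2⟩

lemma sset_insert {r n : ℕ} {x : Fin n → ℝ} {A : Finset (Fin n)} (a : Fin n)
    (j : Fin n) {u : ℝ} (hu : u ≤ x a) : sset r x (insert a A) j u = sset r x A j u := by
  ext p
  rw [mem_sset, mem_sset]
  constructor
  · rintro ⟨⟨h0, h1⟩, h2⟩
    refine ⟨⟨?_, h1⟩, h2⟩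
    rcases Finset.mem_insert.1 h0 with h | h
    · have := shf_nonneg j p.1 h1.1
      rw [h] at this h2
      linarith
    · exact h
  · rintro ⟨⟨h0, h1⟩, h2⟩
    exact ⟨⟨Finset.mem_insert_of_mem h0, h1⟩, h2⟩

lemma surj_step {r n : ℕ} {α : Fin n → ℕ} (hα : IsRParkingFunction r n α) (m : ℕ) (hm : m ≤ n) :
    ∃ (A : Finset (Fin n)) (x : Fin n → ℝ) (M : ℝ), A.card = m ∧ Gen x A ∧
      (∀ a ∈ A, (sset r x A a (x a)).card = α a) ∧ (∀ a ∈ A, x a < M) ∧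
      ∀ j, j ∉ A → (sset r x A j M).card ≤ α j := by
  induction m with
  | zero =>
    refine ⟨∅, 0, 0, rfl, by intro i hi; simp at hi, by simp, by simp, ?_⟩
    intro j _; simp [sset]
  | succ m ih =>
    obtain ⟨A, x, M, hc, hg, hA, hxM, hM⟩ := ih (by omega)
    obtain ⟨u0, hu0, hle, j0, hj0, hj0e⟩ := exists_stop hα x A (by omega) hg M hM
    set C : Finset (Fin n) := Finset.univ.filter
      (fun j => j ∉ A ∧ (sset r x A j u0).card = α j) with hC
    have hCne : C.Nonempty := ⟨j0, by simp [hC, hj0, hj0e]⟩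
    obtain ⟨j, hjC, hjmax⟩ := Finset.exists_max_image C id hCne
    simp only [hC, Finset.mem_filter, Finset.mem_univ, true_and, id] at hjC hjmax
    obtain ⟨hjA, hje⟩ := hjC
    obtain ⟨w, hw, hwe⟩ := sset_left (r := r) x A u0
    obtain ⟨w', hw', hwx⟩ : ∃ w' < u0, ∀ a ∈ A, x a ≤ w' := by
      by_cases hAn : A.Nonempty
      · obtain ⟨a, ha, h⟩ := Finset.exists_max_image A x hAn
        exact ⟨x a, by linarith [hxM a ha], h⟩
      · refine ⟨u0 - 1, by linarith, ?_⟩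
        intro a ha; exact absurd ⟨a, ha⟩ hAn
    obtain ⟨u, hu1, hu2, hug⟩ := exists_generic x (max_lt hw hw')
    have huw : w < u := lt_of_le_of_lt (le_max_left _ _) hu1
    have hux : ∀ a ∈ A, x a < u := fun a ha =>
      (hwx a ha).trans_lt (lt_of_le_of_lt (le_max_right _ _) hu1)
    have hxe : ∀ a ∈ A, Function.update x j u a = x a := by
      intro a ha
      have hne : a ≠ j := by rintro rfl; exact hjA ha
      exact Function.update_of_ne hne _ _
    have hxj : Function.update x j u j = u := Function.update_self _ _ _
    refine ⟨insert j A, Function.update x j u, min u0 (u + 1), ?_, ?_, ?_, ?_, ?_⟩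
    · rw [Finset.card_insert_of_notMem hjA, hc]
    · intro a ha b hb hab s
      rw [Finset.mem_insert] at ha hb
      rcases ha with rfl | ha <;> rcases hb with rfl | hb
      · exact absurd rfl hab
      · rw [hxj, hxe b hb]; exact hug b s
      · rw [hxj, hxe a ha]
        intro h
        apply hug a (-s); push_cast; linarith
      · rw [hxe a ha, hxe b hb]; exact hg a ha b hb hab s
    · intro a ha
      rcases Finset.mem_insert.1 ha with rfl | ha
      · rw [sset_insert _ _ le_rfl, hxj, sset_congr hxe, hwe u huw hu2.le]; exact hje
      · rw [sset_insert _ _ (by rw [hxj, hxe a ha]; exact (hux a ha).le), sset_congr hxe,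
          hxe a ha]
        exact hA a ha
    · intro a ha
      rcases Finset.mem_insert.1 ha with rfl | ha
      · rw [hxj]; exact lt_min hu2 (by linarith)
      · rw [hxe a ha]; exact (hux a ha).trans (lt_min hu2 (by linarith))
    · intro b hb
      rw [Finset.mem_insert, not_or] at hb
      obtain ⟨hbj, hbA⟩ := hb
      set M' := min u0 (u + 1) with hM'
      have hM1 : M' ≤ u + 1 := min_le_right _ _
      have hM0 : M' ≤ u0 := min_le_left _ _
      have key : sset r (Function.update x j u) (insert j A) b M' ⊆
          sset r x A b u0 ∪ (if j < b then {(j, 1)} else ∅) := by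
        rintro ⟨i, k⟩ hp
        rw [mem_sset] at hp
        obtain ⟨⟨h0, h1⟩, h2⟩ := hp
        simp only at h0 h1 h2
        rw [Finset.mem_union]
        rcases Finset.mem_insert.1 h0 with h | h
        · right
          subst h
          rw [hxj] at h2
          have k1 : (1 : ℝ) ≤ k := by exact_mod_cast h1.1
          unfold shf at h2
          rcases lt_or_gt_of_ne hbj with hlt | hlt
          · rw [if_pos hlt] at h2; linarith
          · rw [if_neg (not_lt.2 hlt.le)] at h2
            rw [if_pos hlt, Finset.mem_singleton]
            have : (k : ℝ) < 2 := by linarith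
            have : k < 2 := by exact_mod_cast this
            have : k = 1 := by omega
            rw [this]
        · left
          rw [mem_sset]
          simp only
          rw [hxe i h] at h2
          exact ⟨⟨h, h1⟩, h2.trans_le hM0⟩
      have h1 := (Finset.card_le_card key).trans (Finset.card_union_le _ _)
      have h2 := hle b hbA
      by_cases hlt : j < b
      · rw [if_pos hlt, Finset.card_singleton] at h1
        have h3 : (sset r x A b u0).card ≠ α b := by
          intro h
          exact absurd (hjmax b ⟨hbA, h⟩) (not_le.2 hlt)
        omega
      · rw [if_neg hlt, Finset.card_empty] at h1
        omega

lemma lam_surj {r n : ℕ} {α : Fin n → ℕ} (hα : IsRParkingFunction r n α) :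
    ∃ x ∈ shiCompl r n, lamf r x = α := by
  obtain ⟨A, x, M, hc, hg, hA, _⟩ := surj_step hα n le_rfl
  have : A = Finset.univ := by
    rw [← Finset.card_eq_iff_eq_univ, Fintype.card_fin]; exact hc
  subst this
  refine ⟨x, ?_, funext fun a => hA a (Finset.mem_univ _)⟩
  intro i j hij k _
  have h := hg i (Finset.mem_univ _) j (Finset.mem_univ _) hij
  unfold cEntry
  split_ifs with h1 h2
  · intro h'; apply h k; push_cast; linarith
  · intro h'; apply h (k - 1); push_cast; linarith
  · exact absurd (le_antisymm (not_lt.1 h2) (not_lt.1 h1)) hij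

lemma cEntry_cont {n : ℕ} (i j : Fin n) (k : ℕ) : Continuous (fun x => cEntry x i j k) := by
  unfold cEntry
  split_ifs <;> fun_prop

lemma lamf_locConst (r n : ℕ) : IsLocallyConstant (fun x : shiCompl r n => lamf r x.val) := by
  rw [IsLocallyConstant.iff_eventually_eq]
  intro x
  have h : ∀ᶠ y : shiCompl r n in 𝓝 x, ∀ i j : Fin n, ∀ k ∈ Finset.Icc 1 r,
      (0 < cEntry y.val i j k ↔ 0 < cEntry x.val i j k) := by
    rw [eventually_all]; intro i
    rw [eventually_all]; intro j
    rw [Filter.eventually_all_finset]; intro k hk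
    by_cases hij : i = j
    · subst hij
      exact Eventually.of_forall fun y => by simp [cEntry]
    · have hc : Tendsto (fun y : shiCompl r n => cEntry y.val i j k) (𝓝 x)
          (𝓝 (cEntry x.val i j k)) :=
        ((cEntry_cont i j k).comp continuous_subtype_val).tendsto x
      rcases lt_or_gt_of_ne (x.2 i j hij k hk) with h | h
      · filter_upwards [hc.eventually (gt_mem_nhds h)] with y hy
        exact ⟨fun h' => absurd h' (not_lt.2 hy.le), fun h' => absurd h' (not_lt.2 h.le)⟩
      · filter_upwards [hc.eventually (lt_mem_nhds h)] with y hy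
        exact ⟨fun _ => h, fun _ => hy⟩
  filter_upwards [h] with y hy
  funext i
  rw [← card_eq_lamf, ← card_eq_lamf]
  have : {p : Fin n × ℕ | p.2 ∈ Finset.Icc 1 r ∧ 0 < cEntry y.val i p.1 p.2}
      = {p : Fin n × ℕ | p.2 ∈ Finset.Icc 1 r ∧ 0 < cEntry x.val i p.1 p.2} := by
    ext p
    exact and_congr_right fun hp => hy i p.1 p.2 hp
  rw [this]

lemma agree_connected {r n : ℕ} (x y : shiCompl r n) (h : Agree r x.val y.val Finset.univ) :
    (ConnectedComponents.mk x) = ConnectedComponents.mk y := by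
  rw [ConnectedComponents.coe_eq_coe']
  set V : Set (Fin n → ℝ) := {z | ∀ i j : Fin n, i ≠ j → ∀ k ∈ Finset.Icc 1 r,
    0 < cEntry z i j k * cEntry y.val i j k} with hV
  have hsub : V ⊆ shiCompl r n := by
    intro z hz i j hij k hk h0
    have := hz i j hij k hk
    rw [h0] at this; simp at this
  have hconv : Convex ℝ V := by
    intro z hz w hw a b ha hb hab i j hij k hk
    have e : cEntry (a • z + b • w) i j k = a * cEntry z i j k + b * cEntry w i j k := by
      have hb' : b = 1 - a := by linarith
      subst hb'
      unfold cEntry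
      split_ifs <;> simp <;> ring
    have h1 := hz i j hij k hk
    have h2 := hw i j hij k hk
    rw [e, add_mul, mul_assoc, mul_assoc]
    rcases ha.eq_or_lt with h0 | h0
    · subst h0
      have : b = 1 := by linarith
      subst this
      linarith
    · have := mul_pos h0 h1
      have := mul_nonneg hb h2.le
      linarith
  have hpre : IsPreconnected ((Subtype.val : shiCompl r n → _) ⁻¹' V) := by
    rw [← Topology.IsInducing.subtypeVal.isPreconnected_image, Subtype.image_preimage_coe,
      Set.inter_eq_right.2 hsub]
    exact hconv.isPreconnected
  have hy : y ∈ (Subtype.val : shiCompl r n → _) ⁻¹' V := by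
    intro i j hij k hk
    exact mul_self_pos.2 (y.2 i j hij k hk)
  have hx : x ∈ (Subtype.val : shiCompl r n → _) ⁻¹' V := by
    intro i j hij k hk
    have k1 := (Finset.mem_Icc.1 hk)
    have a := h i (Finset.mem_univ _) j (Finset.mem_univ _) hij k k1.1 k1.2
    rw [← cEntry_pos _ _ _ k1.1, ← cEntry_pos _ _ _ k1.1] at a
    rcases lt_or_gt_of_ne (x.2 i j hij k hk) with hh | hh
    · have : ¬ 0 < cEntry y.val i j k := fun h' => absurd (a.2 h') (not_lt.2 hh.le)
      exact mul_pos_of_neg_of_neg hh (lt_of_le_of_ne (not_lt.1 this) (y.2 i j hij k hk))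
    · exact mul_pos hh (a.1 hh)
  exact hpre.subset_connectedComponent hy hx

/-- The Pak–Stanley labeling: setting `λᵢ(Δ) = #{(j,k) : c_{ijk}(x) > 0}` for any `x ∈ Δ`,
one obtains a well-defined map (independent of the choice of `x ∈ Δ`) which is a bijection
from the regions of the `r`-Shi arrangement `S_n^r` onto the `r`-parking functions of
length `n`. -/
theorem pak_stanley_bijection (r n : ℕ) (hr : 0 < r) (hn : 0 < n) :
    ∃ lam : ConnectedComponents ↥(shiCompl r n) → {α : Fin n → ℕ // IsRParkingFunction r n α},
      Function.Bijective lam ∧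
      ∀ x : ↥(shiCompl r n), ∀ i : Fin n,
        (lam (ConnectedComponents.mk x)).val i =
          Nat.card {p : Fin n × ℕ | p.2 ∈ Finset.Icc 1 r ∧ 0 < cEntry x.val i p.1 p.2} := by
  set f : shiCompl r n → {α : Fin n → ℕ // IsRParkingFunction r n α} :=
    fun x => ⟨lamf r x.val, lamf_parking x.val⟩ with hf
  have hfc : Continuous f := (lamf_locConst r n).continuous.subtype_mk _
  have hlift : ∀ x, hfc.connectedComponentsLift (ConnectedComponents.mk x) = f x :=
    fun x => hfc.connectedComponentsLift_apply_coe x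
  refine ⟨hfc.connectedComponentsLift, ⟨?_, ?_⟩, ?_⟩
  · intro a b hab
    obtain ⟨x, rfl⟩ := ConnectedComponents.surjective_coe a
    obtain ⟨y, rfl⟩ := ConnectedComponents.surjective_coe b
    rw [hlift, hlift] at hab
    exact agree_connected x y (lam_inj hr x.2 y.2 (congrArg Subtype.val hab))
  · rintro ⟨α, hα⟩
    obtain ⟨x, hx, hl⟩ := lam_surj hα
    refine ⟨ConnectedComponents.mk ⟨x, hx⟩, ?_⟩
    rw [hlift]
    exact Subtype.ext hl
  · intro x i
    rw [hlift, card_eq_lamf]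
end
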